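/- arXiv:1812.06477 — 4 statements merged into one kernel-verified Lean document; each statement's English description precedes it below -/
import Mathlib

section
/- Let G = (V,E) be an (n,d,λ)-graph, let B ⊆ V and W = V \ B, and suppose |W| > (λ/(d+λ))·n. Let B⁺ = {v ∈ B : N(v) ∩ W ≠ ∅} and suppose B⁺ ≠ ∅. Then there exists a vertex u ∈ B⁺ such that 1 ≤ |N(u) ∩ W| ≤ (d+λ)·|W|/n + λ. -/
/-- One step of the zero forcing colour-change rule: some black vertex `v ∈ S`
whose unique white neighbour is `w` forces `w`, giving `T = insert w S`. -/
def zfStep {V : Type*} [DecidableEq V] (G : SimpleGraph V) (S T : Finset V) : Prop :=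
  ∃ v ∈ S, ∃ w, w ∉ S ∧ G.Adj v w ∧ (∀ u, G.Adj v u → u ∉ S → u = w) ∧ T = insert w S

/-- `S` is a zero forcing set: iterating the colour-change rule from `S` reaches all of `V`. -/
def IsZeroForcingSet {V : Type*} [DecidableEq V] [Fintype V] (G : SimpleGraph V)
    (S : Finset V) : Prop :=
  Relation.ReflTransGen (zfStep G) S Finset.univ

/-- The zero forcing number: minimum size of a zero forcing set. -/
noncomputable def zeroForcingNumber {V : Type*} [DecidableEq V] [Fintype V]
    (G : SimpleGraph V) : ℕ :=
  sInf {k | ∃ S : Finset V, IsZeroForcingSet G S ∧ S.card = k}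

/-- `(v 0, …, v (k-1))` is a Z-sequence: each `v i` has a neighbour outside
`⋃_{j<i} N[v j]`. -/
def IsZSeq {V : Type*} (G : SimpleGraph V) {k : ℕ} (v : Fin k → V) : Prop :=
  ∀ i : Fin k, ∃ x, G.Adj (v i) x ∧ ∀ j : Fin k, j < i → x ≠ v j ∧ ¬ G.Adj (v j) x

/-- `w` is a witness sequence for the Z-sequence `v`: each `w i` is a neighbour of `v i`
lying outside `⋃_{j<i} N[v j]`. -/
def IsWitnessSeq {V : Type*} (G : SimpleGraph V) {k : ℕ} (v w : Fin k → V) : Prop :=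
  ∀ i : Fin k, G.Adj (v i) (w i) ∧ ∀ j : Fin k, j < i → w i ≠ v j ∧ ¬ G.Adj (v j) (w i)

/-- The Z-Grundy domination number: maximum length of a Z-sequence. -/
noncomputable def zGrundyNumber {V : Type*} [Fintype V] (G : SimpleGraph V) : ℕ :=
  sSup {k | ∃ v : Fin k → V, IsZSeq G v}
/-- `G` is an `(n,d,λ)`-graph: `d`-regular on its (finite) vertex set, and all
eigenvalues of its adjacency matrix other than one (the top eigenvalue `d`) have
absolute value at most `lam ≥ 0`. -/
def IsNDLGraph {V : Type*} [Fintype V] [DecidableEq V] (G : SimpleGraph V)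
    [DecidableRel G.Adj] (d : ℕ) (lam : ℝ) : Prop :=
  0 ≤ lam ∧ G.IsRegularOfDegree d ∧
    ∃ (hA : (G.adjMatrix ℝ).IsHermitian) (i₀ : V),
      ∀ i : V, i ≠ i₀ → |hA.eigenvalues i| ≤ lam

/-- `ePairs G U W` is the number of ordered pairs `(u,w) ∈ U × W` with `{u,w}` an edge
(edges with both endpoints in `U ∩ W` are counted twice). -/
def ePairs {V : Type*} [DecidableEq V] (G : SimpleGraph V) [DecidableRel G.Adj]
    (U W : Finset V) : ℕ :=
  ((U ×ˢ W).filter fun p => G.Adj p.1 p.2).card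

open Matrix in
lemma parseval_aux {V : Type*} [Fintype V] [DecidableEq V] {A : Matrix V V ℝ}
    (hA : A.IsHermitian) (x y : V → ℝ) :
    ∑ i, ((hA.eigenvectorBasis i).ofLp ⬝ᵥ x) * ((hA.eigenvectorBasis i).ofLp ⬝ᵥ y) = x ⬝ᵥ y := by
  have h := hA.eigenvectorBasis.sum_inner_mul_inner (WithLp.toLp 2 x) (WithLp.toLp 2 y)
  simp only [EuclideanSpace.inner_eq_star_dotProduct, star_trivial] at h
  rw [dotProduct_comm x y, ← h]
  refine Finset.sum_congr rfl fun i _ => ?_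
  rw [dotProduct_comm y]

open Matrix in
lemma eig_aux {V : Type*} [Fintype V] [DecidableEq V] {A : Matrix V V ℝ}
    (hA : A.IsHermitian) (x : V → ℝ) (i : V) :
    (hA.eigenvectorBasis i).ofLp ⬝ᵥ (A *ᵥ x) =
      hA.eigenvalues i * ((hA.eigenvectorBasis i).ofLp ⬝ᵥ x) := by
  have hT : Aᵀ = A := by rw [← conjTranspose_eq_transpose_of_trivial]; exact hA
  rw [dotProduct_mulVec, ← mulVec_transpose, hT, hA.mulVec_eigenvectorBasis, smul_dotProduct]
  rfl

open Matrix in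
lemma mixing_vec {V : Type*} [Fintype V] [DecidableEq V] {A : Matrix V V ℝ}
    (hA : A.IsHermitian) (i₀ : V) (d lam : ℝ) (hl : 0 ≤ lam) (hd : lam < d)
    (h1 : A *ᵥ (fun _ => 1) = fun _ => d)
    (hi : ∀ i : V, i ≠ i₀ → |hA.eigenvalues i| ≤ lam)
    (x y : V → ℝ) (hx : ∑ i, x i = 0) :
    (y ⬝ᵥ (A *ᵥ x)) ^ 2 ≤ lam ^ 2 * (y ⬝ᵥ y) * (x ⬝ᵥ x) := by
  set o : V → ℝ := fun _ => 1 with ho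
  set b : V → V → ℝ := fun i => (hA.eigenvectorBasis i).ofLp with hb
  have hAo : A *ᵥ o = d • o := by rw [h1]; ext; simp [ho]
  have ho0 : ∀ i, i ≠ i₀ → b i ⬝ᵥ o = 0 := by
    intro i hne
    have e := eig_aux hA o i
    rw [hAo, dotProduct_smul, smul_eq_mul] at e
    have h2 : hA.eigenvalues i < d := lt_of_le_of_lt ((le_abs_self _).trans (hi i hne)) hd
    have h3 : (d - hA.eigenvalues i) * (b i ⬝ᵥ o) = 0 := by rw [sub_mul]; linarith
    rcases mul_eq_zero.1 h3 with h | h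
    · linarith
    · exact h
  have hone : b i₀ ⬝ᵥ o ≠ 0 := by
    intro h
    have p := parseval_aux hA o o
    rw [Finset.sum_eq_zero] at p
    · have : (0:ℝ) < o ⬝ᵥ o := by
        simp only [ho, dotProduct, mul_one, Finset.sum_const, nsmul_eq_mul]
        have : Nonempty V := ⟨i₀⟩
        have := Finset.card_pos.2 (Finset.univ_nonempty (α := V))
        exact_mod_cast this
      linarith
    · intro i _
      by_cases hc : i = i₀
      · subst hc; change (b i ⬝ᵥ o) * (b i ⬝ᵥ o) = 0; rw [h]; simp
      · change (b i ⬝ᵥ o) * (b i ⬝ᵥ o) = 0; rw [ho0 i hc]; simp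
  have hx0 : b i₀ ⬝ᵥ x = 0 := by
    have p := parseval_aux hA o x
    have q : o ⬝ᵥ x = 0 := by simpa [ho, dotProduct] using hx
    rw [q, Finset.sum_eq_single i₀] at p
    · exact (mul_eq_zero.1 p).resolve_left hone
    · intro i _ hc
      change (b i ⬝ᵥ o) * (b i ⬝ᵥ x) = 0; rw [ho0 i hc]; simp
    · simp; try ring
  have hAx : (A *ᵥ x) ⬝ᵥ (A *ᵥ x) ≤ lam ^ 2 * (x ⬝ᵥ x) := by
    rw [← parseval_aux hA, ← parseval_aux hA x x, Finset.mul_sum]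
    refine Finset.sum_le_sum fun i _ => ?_
    rw [eig_aux]
    change (_ * (b i ⬝ᵥ x)) * (_ * (b i ⬝ᵥ x)) ≤ lam ^ 2 * ((b i ⬝ᵥ x) * (b i ⬝ᵥ x))
    by_cases hc : i = i₀
    · rw [hc, hx0]; simp
    · have h4 : hA.eigenvalues i ^ 2 ≤ lam ^ 2 := by
        rw [sq_le_sq, abs_of_nonneg hl]; exact hi i hc
      nlinarith [mul_le_mul_of_nonneg_right h4 (mul_self_nonneg (b i ⬝ᵥ x))]
  have cs : (y ⬝ᵥ (A *ᵥ x)) ^ 2 ≤ (y ⬝ᵥ y) * ((A *ᵥ x) ⬝ᵥ (A *ᵥ x)) := by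
    have := Finset.sum_mul_sq_le_sq_mul_sq Finset.univ y (A *ᵥ x)
    simpa [dotProduct, sq] using this
  have hy : 0 ≤ y ⬝ᵥ y := Finset.sum_nonneg fun i _ => mul_self_nonneg _
  nlinarith [mul_le_mul_of_nonneg_left hAx hy]

open Matrix in
lemma mixing_set {V : Type*} [Fintype V] [DecidableEq V] (G : SimpleGraph V)
    [DecidableRel G.Adj] (d : ℕ) (lam : ℝ) (hG : IsNDLGraph G d lam) (hd : lam < d)
    (U W : Finset V) :
    ((∑ u ∈ U, ((G.neighborFinset u ∩ W).card : ℝ))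
        - d * U.card * W.card / Fintype.card V) ^ 2 ≤
      lam ^ 2 * (U.card * (1 - U.card / Fintype.card V)) *
        (W.card * (1 - W.card / Fintype.card V)) := by
  obtain ⟨hl, hreg, hA, i₀, hi⟩ := hG
  have hn : (0:ℝ) < Fintype.card V := by
    have : Nonempty V := ⟨i₀⟩
    exact_mod_cast Fintype.card_pos
  set n : ℝ := (Fintype.card V : ℝ) with hnn
  have h1 : G.adjMatrix ℝ *ᵥ (fun _ => 1) = fun _ => (d:ℝ) := by
    ext v
    simp [SimpleGraph.adjMatrix_mulVec_apply, hreg v]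
  let f : Finset V → V → ℝ := fun S v => (if v ∈ S then 1 else 0) - S.card / n
  have hsum : ∀ S : Finset V, ∑ v, f S v = 0 := by
    intro S
    simp only [f, Finset.sum_sub_distrib, Finset.sum_ite_mem, Finset.univ_inter,
      Finset.sum_const, nsmul_eq_mul, Finset.card_univ, ← hnn]
    field_simp
    ring
  have hdot : ∀ (S : Finset V) (g : V → ℝ), f S ⬝ᵥ g = ∑ v ∈ S, g v - S.card / n * ∑ v, g v := by
    intro S g
    simp only [f, dotProduct, sub_mul, Finset.sum_sub_distrib, ite_mul, one_mul, zero_mul,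
      Finset.sum_ite_mem, Finset.univ_inter, Finset.mul_sum]
  have hself : ∀ S : Finset V, f S ⬝ᵥ f S = S.card * (1 - S.card / n) := by
    intro S
    rw [hdot, hsum, Finset.sum_congr rfl (g := fun _ => 1 - S.card / n)]
    · simp; try ring
    · intro v hv; simp [f, hv]
  have hAf : ∀ v, (G.adjMatrix ℝ *ᵥ f W) v = (G.neighborFinset v ∩ W).card - d * W.card / n := by
    intro v
    simp only [SimpleGraph.adjMatrix_mulVec_apply, f, Finset.sum_sub_distrib, Finset.sum_ite_mem,
      Finset.sum_const, nsmul_eq_mul, SimpleGraph.card_neighborFinset_eq_degree, hreg v]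
    ring
  have hzero : ∑ v, (G.adjMatrix ℝ *ᵥ f W) v = 0 := by
    have : ∑ v, (G.adjMatrix ℝ *ᵥ f W) v = (fun _ => (1:ℝ)) ⬝ᵥ (G.adjMatrix ℝ *ᵥ f W) := by
      simp [dotProduct]
    rw [this, dotProduct_mulVec, ← mulVec_transpose, SimpleGraph.transpose_adjMatrix, h1]
    simp only [dotProduct, ← Finset.mul_sum, hsum, mul_zero]
  have key := mixing_vec hA i₀ d lam hl hd h1 hi (f W) (f U) (hsum W)
  rw [hself, hself, hdot, hzero, mul_zero, sub_zero] at key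
  simp only [hAf, Finset.sum_sub_distrib, Finset.sum_const, nsmul_eq_mul] at key
  convert key using 3
  ring

lemma numeric_aux (n u z w d lam e : ℝ) (hn : 0 < n) (hu : 0 < u) (hz : 0 ≤ z) (hw : 0 < w)
    (hl : 0 ≤ lam) (h2l : 2 * lam < d) (hsum : u + z + w = n)
    (u0 : u * ((d + lam) * w / n + lam) < e)
    (m1 : (e - d * u * w / n) ^ 2 ≤ lam ^ 2 * (u * (1 - u / n)) * (w * (1 - w / n)))
    (m2 : (0 - d * z * w / n) ^ 2 ≤ lam ^ 2 * (z * (1 - z / n)) * (w * (1 - w / n))) : False := by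
  obtain ⟨a, rfl⟩ : ∃ a, u = a * n := ⟨u / n, by field_simp⟩
  obtain ⟨b, rfl⟩ : ∃ b, z = b * n := ⟨z / n, by field_simp⟩
  obtain ⟨c, rfl⟩ : ∃ c, w = c * n := ⟨w / n, by field_simp⟩
  have ha : 0 < a := pos_of_mul_pos_left hu hn.le
  have hb : 0 ≤ b := nonneg_of_mul_nonneg_left hz hn
  have hc : 0 < c := pos_of_mul_pos_left hw hn.le
  have hs : a + b + c = 1 := by
    have : (a + b + c - 1) * n = 0 := by linarith
    rcases mul_eq_zero.1 this with h | h <;> linarith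
  have k1 : lam * (a * n) * (1 + c) < e - d * (a * n) * (c * n) / n := by
    have : a * n * ((d + lam) * (c * n) / n + lam) - d * (a * n) * (c * n) / n
        = lam * (a * n) * (1 + c) := by field_simp; ring
    linarith
  have k0 : 0 ≤ lam * (a * n) * (1 + c) := by positivity
  have k2 : (lam * (a * n) * (1 + c)) ^ 2 <
      lam ^ 2 * (a * n * (1 - a * n / n)) * (c * n * (1 - c * n / n)) :=
    lt_of_lt_of_le (pow_lt_pow_left₀ k1 k0 two_ne_zero) m1
  have k3 : 0 < (lam ^ 2 * n ^ 2 * a) * ((1 - a) * c * (1 - c) - a * (1 + c) ^ 2) := by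
    have : (lam ^ 2 * n ^ 2 * a) * ((1 - a) * c * (1 - c) - a * (1 + c) ^ 2) =
      lam ^ 2 * (a * n * (1 - a * n / n)) * (c * n * (1 - c * n / n)) -
        (lam * (a * n) * (1 + c)) ^ 2 := by field_simp
    linarith
  have k4 : a * (1 + 3 * c) < c * (1 - c) := by
    have := pos_of_mul_pos_right k3 (by positivity)
    nlinarith
  have m3 : 0 ≤ (n ^ 2 * c) * (b * (lam ^ 2 * ((1 - b) * (1 - c)) - d ^ 2 * (b * c))) := by
    have : (n ^ 2 * c) * (b * (lam ^ 2 * ((1 - b) * (1 - c)) - d ^ 2 * (b * c))) =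
      lam ^ 2 * (b * n * (1 - b * n / n)) * (c * n * (1 - c * n / n)) -
        (0 - d * (b * n) * (c * n) / n) ^ 2 := by field_simp; ring
    linarith
  have m4 : 0 ≤ b * (lam ^ 2 * ((1 - b) * (1 - c)) - d ^ 2 * (b * c)) :=
    nonneg_of_mul_nonneg_right m3 (by positivity)
  have hb1 : 0 ≤ (1 - b) * (1 - c) := by
    apply mul_nonneg <;> linarith
  have m5 : 4 * (b * c) ≤ (1 - b) * (1 - c) := by
    rcases hb.eq_or_lt with h | h
    · rw [← h] at hb1 ⊢; linarith
    · have m6 := nonneg_of_mul_nonneg_right m4 h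
      have hd2 : 4 * lam ^ 2 ≤ d ^ 2 := by nlinarith
      have hd0 : 0 < d ^ 2 := by have : 0 < d := by linarith
                                 positivity
      have : 0 ≤ d ^ 2 * ((1 - b) * (1 - c) - 4 * (b * c)) := by
        nlinarith [mul_le_mul_of_nonneg_right hd2 hb1]
      have := nonneg_of_mul_nonneg_right this hd0
      linarith
  have hbb : b = 1 - a - c := by linarith
  subst hbb
  have hc1 : c < 1 := by linarith
  nlinarith [mul_pos ha hc]

/-- Let `G` be an `(n,d,λ)`-graph, `B ⊆ V` a set of black vertices with white complement
`W = V \ B` satisfying `|W| > (λ/(d+λ))·n`. If some vertex of `B` has a neighbour in `W`,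
then there is a vertex `u ∈ B` with a neighbour in `W` whose type satisfies
`1 ≤ |N(u) ∩ W| ≤ (d+λ)|W|/n + λ`. -/
theorem exists_small_positive_type {V : Type*} [Fintype V] [DecidableEq V]
    (G : SimpleGraph V) [DecidableRel G.Adj] (d : ℕ) (lam : ℝ)
    (hG : IsNDLGraph G d lam) (B : Finset V)
    (hW : lam / ((d : ℝ) + lam) * Fintype.card V < ((Finset.univ \ B).card : ℝ))
    (hBp : ∃ v ∈ B, (G.neighborFinset v ∩ (Finset.univ \ B)).Nonempty) :
    ∃ u ∈ B, 1 ≤ (G.neighborFinset u ∩ (Finset.univ \ B)).card ∧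
      ((G.neighborFinset u ∩ (Finset.univ \ B)).card : ℝ) ≤
        ((d : ℝ) + lam) * ((Finset.univ \ B).card : ℝ) / Fintype.card V + lam := by
  classical
  by_contra hcon
  push Not at hcon
  have hG' := hG
  obtain ⟨hl, hreg, hA, i₀, hi⟩ := hG'
  have hn : (0:ℝ) < Fintype.card V := by
    have : Nonempty V := ⟨i₀⟩
    exact_mod_cast Fintype.card_pos
  set n : ℝ := (Fintype.card V : ℝ) with hnn
  set W := Finset.univ \ B with hWdef
  obtain ⟨v, hvB, hvW⟩ := hBp
  have hv := hcon v hvB (Finset.card_pos.2 hvW)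
  have hvd : ((G.neighborFinset v ∩ W).card : ℝ) ≤ d := by
    have : (G.neighborFinset v ∩ W).card ≤ d := by
      rw [← hreg v]; exact Finset.card_le_card Finset.inter_subset_left
    exact_mod_cast this
  set U := B.filter (fun u => (G.neighborFinset u ∩ W).Nonempty) with hU
  set Z := B.filter (fun u => ¬ (G.neighborFinset u ∩ W).Nonempty) with hZ
  have hUZ : U.card + Z.card + W.card = Fintype.card V := by
    have e1 : U.card + Z.card = B.card := Finset.card_filter_add_card_filter_not _
    have e2 : W.card + B.card = Fintype.card V := by
      rw [hWdef, Finset.card_sdiff_add_card_eq_card (Finset.subset_univ B), Finset.card_univ]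
    omega
  have hUpos : (0:ℝ) < U.card := by
    have : 0 < U.card := Finset.card_pos.2 ⟨v, by simp [hU, hvB, hvW]⟩
    exact_mod_cast this
  have hWpos : (0:ℝ) < W.card := by
    have : 0 < W.card := Finset.card_pos.2 (hvW.mono Finset.inter_subset_right)
    exact_mod_cast this
  have hdlam : 0 < (d:ℝ) + lam := by
    have : (0:ℝ) < d := by
      have h5 : (0:ℝ) < ((G.neighborFinset v ∩ W).card : ℝ) := by
        exact_mod_cast Finset.card_pos.2 hvW
      linarith
    linarith
  have hω : lam * n < (d + lam) * W.card := by
    rw [div_mul_eq_mul_div, div_lt_iff₀ hdlam] at hW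
    linarith
  have hω2 : lam < (d + lam) * W.card / n := by
    rw [lt_div_iff₀ hn]; exact hω
  have h2l : 2 * lam < d := by linarith
  have hld : lam < d := by linarith
  have m1 := mixing_set G d lam hG hld U W
  have m2 := mixing_set G d lam hG hld Z W
  have z0 : ∑ u ∈ Z, ((G.neighborFinset u ∩ W).card : ℝ) = 0 := by
    refine Finset.sum_eq_zero fun u hu => ?_
    have := (Finset.mem_filter.1 hu).2
    rw [Finset.not_nonempty_iff_eq_empty] at this
    simp [this]
  have u0 : U.card * ((d + lam) * W.card / n + lam) <
      ∑ u ∈ U, ((G.neighborFinset u ∩ W).card : ℝ) := by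
    rw [← nsmul_eq_mul, ← Finset.sum_const]
    refine Finset.sum_lt_sum_of_nonempty (Finset.card_pos.1 (by exact_mod_cast hUpos)) ?_
    intro u hu
    have hu' := Finset.mem_filter.1 hu
    exact hcon u hu'.1 (Finset.card_pos.2 hu'.2)
  rw [z0, ← hnn] at m2
  rw [← hnn] at m1
  have hsum : (U.card : ℝ) + Z.card + W.card = n := by rw [hnn]; exact_mod_cast hUZ
  exact numeric_aux n U.card Z.card W.card d lam _ hn hUpos (Nat.cast_nonneg _) hWpos hl h2l hsum
    u0 m1 m2
end

section
/- For every ε > 0 there exists d₀ such that for every fixed integer d ≥ d₀ the following holds: the probability that a uniformly random simple d-regular graph G on n labelled vertices satisfies Z(G) ≤ n·(1 − (1−ε)·(log d)/(2d)) tends to 1 as n → ∞ (along integers n with dn even). Here log denotes the natural logarithm. -/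
open scoped Classical in
/-- The proportion of simple `d`-regular graphs on the labelled vertex set `Fin n`
that satisfy the property `P`. -/
noncomputable def regularProportion (d n : ℕ) (P : SimpleGraph (Fin n) → Prop) : ℝ :=
  (Nat.card {G : SimpleGraph (Fin n) // G.IsRegularOfDegree d ∧ P G} : ℝ) /
    (Nat.card {G : SimpleGraph (Fin n) // G.IsRegularOfDegree d} : ℝ)

namespace ZFR

open Finset

section basics

set_option linter.unusedSectionVars false

variable {V : Type*} [DecidableEq V] [Fintype V]

/-- Simultaneous forcing by private neighbours. -/
lemma zf_of_private (G : SimpleGraph V) (W : Finset V)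
    (h : ∀ w ∈ W, ∃ u, u ∉ W ∧ G.Adj u w ∧ ∀ z, G.Adj u z → z ∈ W → z = w) :
    zeroForcingNumber G + W.card ≤ Fintype.card V := by
  have key : ∀ T : Finset V, T ⊆ W →
      Relation.ReflTransGen (zfStep G) (univ \ W) ((univ \ W) ∪ T) := by
    intro T
    induction T using Finset.induction_on with
    | empty => intro _; simpa using Relation.ReflTransGen.refl
    | insert a T ha ih =>
      intro hT
      have haW : a ∈ W := hT (mem_insert_self _ _)
      refine (ih (fun x hx => hT (mem_insert_of_mem hx))).tail ?_
      obtain ⟨u, hu, hua, huz⟩ := h a haW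
      refine ⟨u, by simp [hu], a, by simp [haW, ha], hua, ?_, ?_⟩
      · intro z hz hzS
        apply huz z hz
        by_contra hc
        simp [hc] at hzS
      · ext z; simp only [mem_union, mem_insert]; tauto
  have hW := key W le_rfl
  have hU : (univ \ W) ∪ W = (univ : Finset V) := by ext z; simp
  rw [hU] at hW
  have h1 : zeroForcingNumber G ≤ (univ \ W).card := Nat.sInf_le ⟨_, hW, rfl⟩
  have h2 : (univ \ W).card + W.card = Fintype.card V := by
    rw [card_sdiff_add_card_eq_card (subset_univ W), card_univ]
  omega

open scoped Classical in
/-- Neighbourhood as a finset. -/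
noncomputable def nb (G : SimpleGraph V) (v : V) : Finset V := univ.filter (fun u => G.Adj v u)

lemma mem_nb (G : SimpleGraph V) (v u : V) : u ∈ nb G v ↔ G.Adj v u := by simp [nb]

/-- Regularity in terms of `nb`. -/
def Reg (d : ℕ) (G : SimpleGraph V) : Prop := ∀ v, (nb G v).card = d

lemma isRegular_iff (d : ℕ) (G : SimpleGraph V) [G.LocallyFinite] :
    G.IsRegularOfDegree d ↔ Reg d G := by
  refine forall_congr' fun v => ?_
  have : G.neighborFinset v = nb G v := by ext u; simp [mem_nb]
  rw [← this]; rfl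

/-- `w` lies on a triangle or a 4-cycle. -/
def Bad (G : SimpleGraph V) (w : V) : Prop :=
  ∃ u b z, G.Adj w u ∧ G.Adj w b ∧ u ≠ b ∧ z ≠ w ∧ G.Adj z b ∧ (z = u ∨ G.Adj u z)

/-- Closed neighbourhood of a set. -/
noncomputable def cl (G : SimpleGraph V) (S : Finset V) : Finset V :=
  S.biUnion (fun v => insert v (nb G v))

lemma mem_cl (G : SimpleGraph V) (S : Finset V) (x : V) :
    x ∈ cl G S ↔ ∃ v ∈ S, x = v ∨ G.Adj v x := by simp [cl, mem_nb]

lemma card_cl (G : SimpleGraph V) (d : ℕ) (hG : Reg d G) (S : Finset V) :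
    (cl G S).card ≤ S.card * (d + 1) := by
  refine card_biUnion_le_card_mul _ _ _ fun v _ => ?_
  exact (card_insert_le _ _).trans (by rw [hG v])

/-- Ball of radius three. -/
noncomputable def ball3 (G : SimpleGraph V) (w : V) : Finset V := cl G (cl G (cl G {w}))

lemma card_ball3 (G : SimpleGraph V) (d : ℕ) (hG : Reg d G) (w : V) :
    (ball3 G w).card ≤ (d + 1) ^ 3 := by
  have h1 := card_cl G d hG {w}
  have h2 := card_cl G d hG (cl G {w})
  have h3 := card_cl G d hG (cl G (cl G {w}))
  rw [card_singleton] at h1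
  calc (ball3 G w).card ≤ _ := h3
    _ ≤ (1 * (d+1)) * (d+1) * (d+1) := by
      gcongr
      exact h2.trans (by gcongr)
    _ = _ := by ring

/-- Switching: replace the edges `wb`, `xy` by `wx`, `by`. -/
def sw (G : SimpleGraph V) (w b x y : V) : SimpleGraph V :=
  SimpleGraph.fromEdgeSet ((G.edgeSet \ {s(w,b), s(x,y)}) ∪ {s(w,x), s(b,y)})

lemma sw_adj (G : SimpleGraph V) (w b x y p q : V) (h1 : w ≠ x) (h2 : b ≠ y) :
    (sw G w b x y).Adj p q ↔
      (G.Adj p q ∧ s(p,q) ≠ s(w,b) ∧ s(p,q) ≠ s(x,y)) ∨ s(p,q) = s(w,x) ∨ s(p,q) = s(b,y) := by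
  have hne : G.Adj p q → p ≠ q := fun h => h.ne
  simp only [sw, SimpleGraph.fromEdgeSet_adj, Set.mem_union, Set.mem_sdiff, SimpleGraph.mem_edgeSet,
    Set.mem_insert_iff, Set.mem_singleton_iff, Sym2.eq_iff, ne_eq]
  grind

/-- Validity of a switching. -/
structure Valid (G : SimpleGraph V) (w b x y : V) : Prop where
  wb : G.Adj w b
  xy : G.Adj x y
  wx : w ≠ x
  wy : w ≠ y
  bx : b ≠ x
  byy : b ≠ y
  nwx : ¬ G.Adj w x
  nby : ¬ G.Adj b y

lemma sw_reg {G : SimpleGraph V} {d : ℕ} (hG : Reg d G) {w b x y : V} (h : Valid G w b x y) :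
    Reg d (sw G w b x y) := by
  obtain ⟨wb, xy, wx, wy, bx, byy, nwx, nby⟩ := h
  have e1 := wb.ne
  have e2 := xy.ne
  have hs := G.symm
  have wb' := wb.symm
  have xy' := xy.symm
  have nwx' : ¬ G.Adj x w := fun h => nwx h.symm
  have nby' : ¬ G.Adj y b := fun h => nby h.symm
  intro v
  have hd := hG v
  have gen : ∀ p q, p ∉ nb G v → q ∈ nb G v →
      nb (sw G w b x y) v = insert p ((nb G v).erase q) → (nb (sw G w b x y) v).card = d := by
    intro p q hp hq he
    rw [he, card_insert_of_notMem (by simp [hp]), card_erase_of_mem hq, hd]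
    have : 0 < (nb G v).card := card_pos.2 ⟨q, hq⟩
    omega
  by_cases hw : v = w
  · subst hw
    apply gen x b (by simpa [mem_nb]) (by simpa [mem_nb])
    ext t
    simp only [mem_nb, sw_adj G v b x y _ _ wx byy, mem_insert, mem_erase, Sym2.eq_iff, ne_eq]
    grind
  by_cases hb : v = b
  · subst hb
    apply gen y w (by simpa [mem_nb]) (by simpa [mem_nb])
    ext t
    simp only [mem_nb, sw_adj G w v x y _ _ wx byy, mem_insert, mem_erase, Sym2.eq_iff, ne_eq]
    grind
  by_cases hx : v = x
  · subst hx
    apply gen w y (by simpa [mem_nb]) (by simpa [mem_nb])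
    ext t
    simp only [mem_nb, sw_adj G w b v y _ _ wx byy, mem_insert, mem_erase, Sym2.eq_iff, ne_eq]
    grind
  by_cases hy : v = y
  · subst hy
    apply gen b x (by simpa [mem_nb]) (by simpa [mem_nb])
    ext t
    simp only [mem_nb, sw_adj G w b x v _ _ wx byy, mem_insert, mem_erase, Sym2.eq_iff, ne_eq]
    grind
  have : nb (sw G w b x y) v = nb G v := by
    ext t
    simp only [mem_nb, sw_adj G w b x y _ _ wx byy, Sym2.eq_iff, ne_eq]
    grind
  rw [this, hd]

lemma sw_inj {G H : SimpleGraph V} {w b x y : V} (hG : Valid G w b x y) (hH : Valid H w b x y)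
    (h : sw G w b x y = sw H w b x y) : G = H := by
  have hrec : ∀ K : SimpleGraph V, Valid K w b x y → ∀ p q, K.Adj p q ↔
      ((sw K w b x y).Adj p q ∧ s(p,q) ≠ s(w,x) ∧ s(p,q) ≠ s(b,y)) ∨
        s(p,q) = s(w,b) ∨ s(p,q) = s(x,y) := by
    intro K hK p q
    obtain ⟨wb, xy, wx, wy, bx, byy, nwx, nby⟩ := hK
    have wb' := wb.symm
    have xy' := xy.symm
    have nwx' : ¬ K.Adj x w := fun h => nwx h.symm
    have nby' : ¬ K.Adj y b := fun h => nby h.symm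
    simp only [sw_adj K w b x y _ _ wx byy, Sym2.eq_iff, ne_eq]
    grind
  ext p q
  rw [hrec G hG, hrec H hH, h]

/-- A bad vertex has a closing edge `wb` such that far switchings are valid and keep `b` close. -/
lemma bad_switch {G : SimpleGraph V} {w : V} (h : Bad G w) :
    ∃ b, ∀ x y, x ∉ ball3 G w → G.Adj x y →
      Valid G w b x y ∧ b ∈ ball3 (sw G w b x y) w := by
  obtain ⟨u, b, z, wu, wb, ub, zw, zb, hz⟩ := h
  refine ⟨b, fun x y hx xy => ?_⟩
  simp only [ball3, mem_cl, mem_singleton] at hx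
  have far : ∀ p q r, (p = w ∨ G.Adj w p) → (q = p ∨ G.Adj p q) → (r = q ∨ G.Adj q r) → x ≠ r := by
    intro p q r h1 h2 h3 hxr
    exact hx ⟨q, ⟨p, ⟨w, rfl, h1⟩, h2⟩, by rw [hxr]; exact h3⟩
  have xw : x ≠ w := far w w w (.inl rfl) (.inl rfl) (.inl rfl)
  have xb : x ≠ b := far b b b (.inr wb) (.inl rfl) (.inl rfl)
  have xu : x ≠ u := far u u u (.inr wu) (.inl rfl) (.inl rfl)
  have xz : x ≠ z := far u z z (.inr wu) hz (.inl rfl)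
  have nwx : ¬ G.Adj w x := fun h => far x x x (.inr h) (.inl rfl) (.inl rfl) rfl
  have nbx : ¬ G.Adj b x := fun h => far b x x (.inr wb) (.inr h) (.inl rfl) rfl
  have nby : ¬ G.Adj b y := fun h => far b y x (.inr wb) (.inr h) (.inr xy.symm) rfl
  have wy : w ≠ y := by rintro rfl; exact nwx xy.symm
  have hby : b ≠ y := by rintro rfl; exact nbx xy.symm
  refine ⟨⟨wb, xy, xw.symm, wy, xb.symm, hby, nwx, nby⟩, ?_⟩
  have e1 := wu.ne
  have e2 := zb.ne
  simp only [ball3, mem_cl, mem_singleton, sw_adj G w b x y _ _ xw.symm hby, Sym2.eq_iff, ne_eq]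
  refine ⟨z, ⟨u, ⟨w, rfl, .inr (.inl ⟨wu, ?_, ?_⟩)⟩, ?_⟩, .inr (.inl ⟨zb, ?_, ?_⟩)⟩
  · grind
  · grind
  · rcases hz with hz | hz
    · exact .inl hz
    · refine .inr (.inl ⟨hz, ?_, ?_⟩) <;> grind
  · grind
  · grind

open scoped Classical in
lemma bad_count (d : ℕ) (hd : 0 < d) (w : V) :
    (univ.filter (fun G : SimpleGraph V => Reg d G ∧ Bad G w)).card *
        (Fintype.card V - (d + 1) ^ 3) ≤
      (univ.filter (fun G : SimpleGraph V => Reg d G)).card * ((d + 1) ^ 3 * d * d) := by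
  have hb : ∀ G : SimpleGraph V, ∃ b, Bad G w → ∀ x y, x ∉ ball3 G w → G.Adj x y →
      Valid G w b x y ∧ b ∈ ball3 (sw G w b x y) w := by
    intro G
    by_cases h : Bad G w
    · obtain ⟨b, hb⟩ := bad_switch h
      exact ⟨b, fun _ => hb⟩
    · exact ⟨w, fun h' => absurd h' h⟩
  choose b hb using hb
  have hy : ∀ (G : SimpleGraph V) (x : V), ∃ y, Reg d G → G.Adj x y := by
    intro G x
    by_cases h : Reg d G
    · have : 0 < (nb G x).card := by rw [h x]; exact hd
      obtain ⟨y, hy⟩ := card_pos.1 this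
      exact ⟨y, fun _ => (mem_nb _ _ _).1 hy⟩
    · exact ⟨w, fun h' => absurd h' h⟩
  choose y hy using hy
  set A := univ.filter (fun G : SimpleGraph V => Reg d G ∧ Bad G w) with hA
  set R := univ.filter (fun G : SimpleGraph V => Reg d G) with hR
  let L : Finset (Σ _ : SimpleGraph V, V) := A.sigma (fun G => univ \ ball3 G w)
  let T : SimpleGraph V → Finset (Σ _ : V, V × V) := fun G =>
    (ball3 G w).sigma (fun c => nb G w ×ˢ nb G c)
  let M : Finset (Σ _ : SimpleGraph V, Σ _ : V, V × V) := R.sigma T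
  have hLM : L.card ≤ M.card := by
    refine card_le_card_of_injOn
      (fun t => ⟨sw t.1 w (b t.1) t.2 (y t.1 t.2), ⟨b t.1, (t.2, y t.1 t.2)⟩⟩) ?_ ?_
    · rintro ⟨G, x⟩ ht
      simp only [L, A, coe_sigma, Set.mem_sigma_iff, mem_coe, mem_filter, mem_univ, true_and,
        mem_sdiff] at ht
      obtain ⟨⟨hreg, hbad⟩, hx⟩ := ht
      obtain ⟨hv, hbb⟩ := hb G hbad x (y G x) hx (hy G x hreg)
      simp only [M, R, T, coe_sigma, Set.mem_sigma_iff, mem_coe, mem_filter, mem_univ, true_and,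
        mem_sigma, mem_product, mem_nb, sw_adj _ _ _ _ _ _ _ hv.wx hv.byy]
      exact ⟨sw_reg hreg hv, hbb, by simp, by simp⟩
    · rintro ⟨G, x⟩ hG ⟨H, x'⟩ hH heq
      simp only [L, A, coe_sigma, Set.mem_sigma_iff, mem_coe, mem_filter, mem_univ, true_and,
        mem_sdiff] at hG hH
      simp only [Sigma.mk.injEq, heq_eq_eq, Prod.mk.injEq] at heq
      obtain ⟨h1, h2, h3, h4⟩ := heq
      subst h3
      have v1 := (hb G hG.1.2 x (y G x) hG.2 (hy G x hG.1.1)).1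
      have v2 := (hb H hH.1.2 x (y H x) hH.2 (hy H x hH.1.1)).1
      rw [← h2, ← h4] at v2 h1
      have := sw_inj v1 v2 h1
      rw [this]
  have h1 : A.card * (Fintype.card V - (d + 1) ^ 3) ≤ L.card := by
    rw [card_sigma, ← smul_eq_mul]
    refine card_nsmul_le_sum _ _ _ fun G hG => ?_
    have hreg : Reg d G := (mem_filter.1 hG).2.1
    rw [card_sdiff_of_subset (subset_univ _), card_univ]
    have := card_ball3 G d hreg w
    omega
  have h2 : M.card ≤ R.card * ((d + 1) ^ 3 * d * d) := by
    rw [card_sigma, ← smul_eq_mul]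
    refine sum_le_card_nsmul _ _ _ fun G hG => ?_
    have hreg : Reg d G := (mem_filter.1 hG).2
    simp only [T, card_sigma, card_product, hreg _, sum_const, smul_eq_mul, mul_assoc]
    exact Nat.mul_le_mul_right _ (card_ball3 G d hreg w)
  exact h1.trans (hLM.trans h2)

end basics

end ZFR

namespace ZFR

open Finset

section expectation

set_option linter.unusedSectionVars false

variable {V : Type*} [DecidableEq V] [Fintype V]

/-- Bernoulli product weight. -/
noncomputable def wt (p : ℝ) (f : V → Bool) : ℝ := ∏ v, (if f v then p else 1 - p)

lemma wt_nonneg (p : ℝ) (h0 : 0 ≤ p) (h1 : p ≤ 1) (f : V → Bool) : 0 ≤ wt p f := by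
  refine prod_nonneg fun v _ => ?_
  split_ifs <;> linarith

lemma sum_wt (p : ℝ) : ∑ f : V → Bool, wt p f = 1 := by
  unfold wt
  rw [← Fintype.prod_sum (fun (_ : V) (c : Bool) => if c then p else 1 - p)]
  simp

/-- Indicator that `f` vanishes on `S`. -/
noncomputable def van (S : Finset V) (f : V → Bool) : ℝ := if ∀ v ∈ S, f v = false then 1 else 0

lemma sum_wt_van (p : ℝ) (w : V) (S : Finset V) (hw : w ∉ S) :
    ∑ f : V → Bool, wt p f * ((if f w then 1 else 0) * van S f) = p * (1 - p) ^ S.card := by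
  have h : ∀ f : V → Bool, wt p f * ((if f w then 1 else 0) * van S f) =
      ∏ v, (if f v then (if v ∈ S then 0 else p) else (if v = w then 0 else 1 - p)) := by
    intro f
    by_cases hfw : f w
    · by_cases hS : ∀ v ∈ S, f v = false
      · simp only [hfw, van, if_pos hS, if_true, mul_one, wt]
        refine prod_congr rfl fun v _ => ?_
        by_cases hv : f v
        · have : v ∉ S := fun h => by simp [hS v h] at hv
          simp [hv, this]
        · have : v ≠ w := by rintro rfl; exact hv hfw
          simp [hv, this]
      · simp only [van, if_neg hS, mul_zero]
        push Not at hS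
        obtain ⟨v, hv, hfv⟩ := hS
        symm
        apply prod_eq_zero (mem_univ v)
        simp at hfv
        simp [hfv, hv]
    · symm
      simp only [hfw]
      simp only [Bool.false_eq_true, if_false, zero_mul, mul_zero]
      apply prod_eq_zero (mem_univ w)
      simp [hfw]
  simp_rw [h]
  rw [← Fintype.prod_sum (fun (v : V) (c : Bool) =>
    if c then (if v ∈ S then 0 else p) else (if v = w then 0 else 1 - p))]
  have h2 : ∀ v : V, ∑ c : Bool, (if c then (if v ∈ S then 0 else p)
      else (if v = w then 0 else 1 - p)) =
      (if v = w then p else 1) * (if v ∈ S then 1 - p else 1) := by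
    intro v
    by_cases h1 : v = w
    · subst h1; simp [hw]
    · by_cases h2 : v ∈ S <;> simp [h1, h2]
  simp_rw [h2]
  rw [prod_mul_distrib, prod_ite_eq' univ w, if_pos (mem_univ w), prod_ite_mem univ S]
  simp

/-- `w` is chosen and has a private neighbour. -/
def Good (G : SimpleGraph V) (f : V → Bool) (w : V) : Prop :=
  f w = true ∧ ∃ u ∈ nb G w, ∀ v ∈ (insert u (nb G u)).erase w, f v = false

open scoped Classical in
lemma prob_good (G : SimpleGraph V) (d : ℕ) (hd : 0 < d) (hG : Reg d G) (w : V) (hw : ¬ Bad G w)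
    (p : ℝ) (h0 : 0 ≤ p) (h1 : p < 1) :
    p * (1 - 1 / (d * (1 - p) ^ d)) ≤
      ∑ f : V → Bool, wt p f * (if Good G f w then 1 else 0) := by
  set A : V → Finset V := fun u => (insert u (nb G u)).erase w with hA
  set m : ℝ := d * (1 - p) ^ d with hm
  have hq : 0 < 1 - p := by linarith
  have hd' : (0 : ℝ) < d := by exact_mod_cast hd
  have hmpos : 0 < m := by positivity
  let X : (V → Bool) → ℝ := fun f => ∑ u ∈ nb G w, van (A u) f
  have van_nonneg : ∀ S f, 0 ≤ van (V := V) S f := by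
    intro S f; unfold van; split_ifs <;> norm_num
  have hcardA : ∀ u ∈ nb G w, (A u).card = d := by
    intro u hu
    rw [mem_nb] at hu
    rw [hA]
    simp only
    rw [card_erase_of_mem (by simp [mem_nb, hu.symm]), card_insert_of_notMem (by simp [mem_nb]),
      hG u]
    simp
  have hdisj : ∀ u ∈ nb G w, ∀ b ∈ nb G w, u ≠ b → Disjoint (A u) (A b) := by
    intro u hu b hb hub
    rw [mem_nb] at hu hb
    rw [Finset.disjoint_left]
    intro z hz hz'
    simp only [hA, mem_erase, mem_insert, mem_nb] at hz hz'
    apply hw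
    rcases hz'.2 with e | hbz
    · subst e
      rcases hz.2 with e | huz
      · exact absurd e.symm hub
      · exact ⟨z, u, z, hb, hu, hub.symm, hz.1, huz.symm, .inl rfl⟩
    · exact ⟨u, b, z, hu, hb, hub, hz.1, hbz.symm, hz.2⟩
  have hwA : ∀ u, w ∉ A u := fun u => by simp [hA]
  -- pointwise bound
  have hpt : ∀ f : V → Bool, (if f w then (1 : ℝ) else 0) * (2 * X f / m - X f ^ 2 / m ^ 2) ≤
      (if Good G f w then 1 else 0) := by
    intro f
    by_cases hfw : f w
    · by_cases hg : Good G f w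
      · rw [if_pos hg, if_pos hfw, one_mul]
        have : 0 ≤ (X f / m - 1) ^ 2 := sq_nonneg _
        have e : (X f / m - 1) ^ 2 = 1 - (2 * X f / m - X f ^ 2 / m ^ 2) := by ring
        linarith
      · have hX : X f = 0 := by
          refine sum_eq_zero fun u hu => ?_
          unfold van
          rw [if_neg]
          intro h
          exact hg ⟨hfw, u, hu, h⟩
        simp [hX, hg]
    · have : ¬ Good G f w := fun h => hfw h.1
      simp [hfw, this]
  have hvv : ∀ S T f, van (V := V) S f * van T f = van (S ∪ T) f := by
    intro S T f
    have hiff : (∀ v ∈ S ∪ T, f v = false) ↔ (∀ v ∈ S, f v = false) ∧ ∀ v ∈ T, f v = false := by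
      simp only [mem_union]
      grind
    unfold van
    split_ifs <;> first | tauto | norm_num
  have hE1 : ∑ f : V → Bool, wt p f * ((if f w then 1 else 0) * X f) = p * m := by
    simp only [X, mul_sum]
    rw [sum_comm]
    rw [sum_congr rfl (fun u hu => by rw [sum_wt_van p w (A u) (hwA u), hcardA u hu])]
    rw [sum_const, hG w, nsmul_eq_mul, hm]; ring
  have hE2 : ∑ f : V → Bool, wt p f * ((if f w then 1 else 0) * X f ^ 2) ≤ p * (m + m ^ 2) := by
    have e : ∀ f : V → Bool, wt p f * ((if f w then 1 else 0) * X f ^ 2) =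
        ∑ u ∈ nb G w, ∑ b ∈ nb G w, wt p f * ((if f w then 1 else 0) * van (A u ∪ A b) f) := by
      intro f
      simp only [X]
      rw [sq, sum_mul_sum]
      simp only [hvv, mul_sum]
    simp_rw [e]
    rw [sum_comm]
    have e2 : ∀ u ∈ nb G w, ∑ f : V → Bool, ∑ b ∈ nb G w,
        wt p f * ((if f w then 1 else 0) * van (A u ∪ A b) f) ≤
        p * ((1 - p) ^ d + d * (1 - p) ^ (2 * d)) := by
      intro u hu
      rw [sum_comm]
      have e3 : ∀ b ∈ nb G w, ∑ f : V → Bool,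
          wt p f * ((if f w then 1 else 0) * van (A u ∪ A b) f) ≤
          (if u = b then p * (1 - p) ^ d else 0) + p * (1 - p) ^ (2 * d) := by
        intro b hb
        rw [sum_wt_van p w _ (by simp [hwA])]
        by_cases hub : u = b
        · subst hub
          rw [union_self, hcardA u hu, if_pos rfl]
          have : 0 ≤ p * (1 - p) ^ (2 * d) := by positivity
          linarith
        · rw [if_neg hub, card_union_of_disjoint (hdisj u hu b hb hub), hcardA u hu, hcardA b hb,
            two_mul, zero_add]
      refine (sum_le_sum e3).trans ?_
      rw [sum_add_distrib, sum_ite_eq, if_pos hu, sum_const, hG w, nsmul_eq_mul]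
      apply le_of_eq; ring
    refine (sum_le_sum e2).trans ?_
    rw [sum_const, hG w, nsmul_eq_mul, hm]
    apply le_of_eq; ring
  calc p * (1 - 1 / m) = 2 / m * (p * m) - 1 / m ^ 2 * (p * (m + m ^ 2)) := by
        field_simp; ring
    _ ≤ 2 / m * (∑ f : V → Bool, wt p f * ((if f w then 1 else 0) * X f)) -
        1 / m ^ 2 * ∑ f : V → Bool, wt p f * ((if f w then 1 else 0) * X f ^ 2) := by
        rw [hE1]
        gcongr
    _ = ∑ f : V → Bool, wt p f *
          ((if f w then (1 : ℝ) else 0) * (2 * X f / m - X f ^ 2 / m ^ 2)) := by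
        rw [mul_sum, mul_sum, ← sum_sub_distrib]
        refine sum_congr rfl fun f _ => ?_
        ring
    _ ≤ _ := sum_le_sum fun f _ =>
        mul_le_mul_of_nonneg_left (hpt f) (wt_nonneg p h0 h1.le f)

open scoped Classical in
lemma zf_bound (G : SimpleGraph V) (d : ℕ) (hd : 0 < d) (hG : Reg d G)
    (p : ℝ) (h0 : 0 ≤ p) (h1 : p < 1) :
    (zeroForcingNumber G : ℝ) + (univ.filter (fun w => ¬ Bad G w)).card *
      (p * (1 - 1 / (d * (1 - p) ^ d))) ≤ Fintype.card V := by
  set c := p * (1 - 1 / (d * (1 - p) ^ d)) with hc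
  set B := univ.filter (fun w => ¬ Bad G w) with hB
  let W : (V → Bool) → Finset V := fun f => univ.filter (fun w => Good G f w)
  have hW : ∀ f, (zeroForcingNumber G : ℝ) ≤ Fintype.card V - (W f).card := by
    intro f
    have := zf_of_private G (W f) (by
      intro w hw
      obtain ⟨hfw, u, hu, hv⟩ := (mem_filter.1 hw).2
      rw [mem_nb] at hu
      refine ⟨u, ?_, hu.symm, ?_⟩
      · intro huW
        have h2 := (mem_filter.1 huW).2.1
        have h3 := hv u (by simp [hu.ne.symm])
        simp [h3] at h2
      · intro z huz hz
        by_contra hne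
        have h2 := (mem_filter.1 hz).2.1
        have h3 := hv z (by simp [hne, mem_nb, huz])
        simp [h3] at h2)
    have h' : (zeroForcingNumber G : ℝ) + (W f).card ≤ Fintype.card V := by exact_mod_cast this
    linarith
  have h3 : (B.card : ℝ) * c ≤ ∑ f : V → Bool, wt p f * (W f).card := by
    have : ∀ f : V → Bool, wt p f * (W f).card = ∑ w, wt p f * (if Good G f w then 1 else 0) := by
      intro f
      rw [← mul_sum]
      simp [W]
    simp_rw [this]
    rw [sum_comm, ← nsmul_eq_mul, ← sum_const]
    refine (sum_le_sum (fun w hw => prob_good G d hd hG w (mem_filter.1 hw).2 p h0 h1)).trans ?_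
    refine sum_le_sum_of_subset_of_nonneg (subset_univ _) fun w _ _ => ?_
    refine sum_nonneg fun f _ => mul_nonneg (wt_nonneg p h0 h1.le f) ?_
    split_ifs <;> norm_num
  have h4 : ∑ f : V → Bool, wt p f * (W f).card ≤
      ∑ f : V → Bool, wt p f * (Fintype.card V - zeroForcingNumber G : ℝ) := by
    refine sum_le_sum fun f _ => mul_le_mul_of_nonneg_left ?_ (wt_nonneg p h0 h1.le f)
    linarith [hW f]
  rw [← sum_mul, sum_wt, one_mul] at h4
  linarith

end expectation

section existence

/-- Existence of regular graphs (circulants). -/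
lemma exists_reg (d n : ℕ) (hn : d < n) (he : Even (d * n)) :
    ∃ G : SimpleGraph (Fin n), Reg d G := by
  classical
  have : NeZero n := ⟨by omega⟩
  let P : ℕ → Prop := fun j => (1 ≤ j ∧ j ≤ d / 2) ∨ (n - d / 2 ≤ j ∧ j < n) ∨
    (d % 2 = 1 ∧ 2 * j = n)
  have hpar : d % 2 = 1 → n % 2 = 0 := by
    intro h
    rcases Nat.even_mul.1 he with h' | h'
    · have := Nat.even_iff.1 h'; omega
    · exact Nat.even_iff.1 h'
  have hP0 : ¬ P 0 := by simp only [P]; omega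
  have hsymm : ∀ a : Fin n, P a.val → P (-a).val := by
    intro a ha
    have hne : a.val ≠ 0 := fun h => hP0 (h ▸ ha)
    have hlt := a.isLt
    have : (-a).val = n - a.val := by
      rw [Fin.val_neg, if_neg]
      intro h; exact hne (by simp [h])
    rw [this]
    simp only [P] at ha ⊢
    omega
  let G : SimpleGraph (Fin n) :=
    { Adj := fun a b => P (b - a).val
      symm := ⟨fun a b h => by
        have := hsymm _ h
        rwa [neg_sub] at this⟩
      loopless := ⟨fun a h => by
        simp only [sub_self] at h
        exact hP0 (by simpa using h)⟩ }
  refine ⟨G, fun v => ?_⟩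
  have h1 : (nb G v).card = ((range n).filter P).card := by
    refine card_bij (fun b _ => (b - v).val) ?_ ?_ ?_
    · intro b hb
      rw [mem_nb] at hb
      exact mem_filter.2 ⟨mem_range.2 (b - v).isLt, hb⟩
    · intro b _ c _ h
      have := Fin.ext h
      exact sub_left_injective this
    · intro j hj
      obtain ⟨hj1, hj2⟩ := mem_filter.1 hj
      refine ⟨⟨j, mem_range.1 hj1⟩ + v, ?_, ?_⟩
      · rw [mem_nb]
        change P _
        rw [add_sub_cancel_right]; exact hj2
      · rw [add_sub_cancel_right]
  rw [h1]
  rcases Nat.mod_two_eq_zero_or_one d with h | h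
  · have : (range n).filter P = Icc 1 (d/2) ∪ Ico (n - d/2) n := by
      ext j; simp only [P, mem_filter, mem_range, mem_union, mem_Icc, mem_Ico]; omega
    rw [this, card_union_of_disjoint, Nat.card_Icc, Nat.card_Ico]
    · omega
    · rw [Finset.disjoint_left]; intro j; simp only [mem_Icc, mem_Ico]; omega
  · have hp := hpar h
    have : (range n).filter P = insert (n/2) (Icc 1 (d/2) ∪ Ico (n - d/2) n) := by
      ext j; simp only [P, mem_filter, mem_range, mem_union, mem_Icc, mem_Ico, mem_insert]; omega
    rw [this, card_insert_of_notMem, card_union_of_disjoint, Nat.card_Icc, Nat.card_Ico]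
    · omega
    · rw [Finset.disjoint_left]; intro j; simp only [mem_Icc, mem_Ico]; omega
    · simp only [mem_union, mem_Icc, mem_Ico]; omega

end existence

end ZFR

namespace ZFR

open Finset

section final

open scoped Classical in
/-- Markov inequality for the number of bad vertices. -/
lemma few_bad (d n : ℕ) (hd : 0 < d) (δ : ℝ) (hδ : 0 < δ) (hn : (d + 1) ^ 3 < n) :
    ((univ.filter (fun G : SimpleGraph (Fin n) =>
      Reg d G ∧ δ * n < (univ.filter (fun w => Bad G w)).card)).card : ℝ) ≤
    (univ.filter (fun G : SimpleGraph (Fin n) => Reg d G)).card *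
      (((d + 1) ^ 3 * d * d : ℝ) / δ * ((n : ℝ) - (d + 1) ^ 3)⁻¹) := by
  set R := univ.filter (fun G : SimpleGraph (Fin n) => Reg d G) with hR
  set Q := univ.filter (fun G : SimpleGraph (Fin n) =>
      Reg d G ∧ δ * n < (univ.filter (fun w => Bad G w)).card) with hQ
  set K : ℝ := (d + 1) ^ 3 * d * d with hK
  have hgap : (0 : ℝ) < (n : ℝ) - (d + 1) ^ 3 := by
    have : (((d + 1) ^ 3 : ℕ) : ℝ) < n := by exact_mod_cast hn
    push_cast at this; linarith
  have hn0 : (0 : ℝ) < n := by exact_mod_cast (by omega : 0 < n)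
  have hw : ∀ w : Fin n, ((univ.filter (fun G : SimpleGraph (Fin n) => Reg d G ∧ Bad G w)).card : ℝ)
      ≤ R.card * K * ((n : ℝ) - (d + 1) ^ 3)⁻¹ := by
    intro w
    have h := bad_count d hd w
    rw [Fintype.card_fin] at h
    have h' : ((univ.filter (fun G : SimpleGraph (Fin n) => Reg d G ∧ Bad G w)).card : ℝ) *
        ((n : ℝ) - (d + 1) ^ 3) ≤ R.card * K := by
      have := (Nat.cast_le (α := ℝ)).2 h
      rw [Nat.cast_mul, Nat.cast_sub hn.le] at this
      push_cast at this
      exact this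
    rw [← div_eq_mul_inv, le_div_iff₀ hgap]
    exact h'
  have hdc : ∑ G ∈ R, ((univ.filter (fun w => Bad G w)).card : ℝ) =
      ∑ w : Fin n, ((univ.filter (fun G : SimpleGraph (Fin n) => Reg d G ∧ Bad G w)).card : ℝ) := by
    have e1 : ∀ G : SimpleGraph (Fin n), ((univ.filter (fun w => Bad G w)).card : ℝ) =
        ∑ w : Fin n, if Bad G w then 1 else 0 := by intro G; simp
    have e2 : ∀ w : Fin n,
        ((univ.filter (fun G : SimpleGraph (Fin n) => Reg d G ∧ Bad G w)).card : ℝ) =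
        ∑ G ∈ R, if Bad G w then 1 else 0 := by
      intro w
      rw [← filter_filter]; simp [R]
    simp_rw [e1, e2]
    exact sum_comm
  have h1 : (Q.card : ℝ) * (δ * n) ≤ ∑ G ∈ R, ((univ.filter (fun w => Bad G w)).card : ℝ) := by
    rw [← nsmul_eq_mul, ← sum_const]
    refine (sum_le_sum (fun G hG => (mem_filter.1 hG).2.2.le)).trans ?_
    refine sum_le_sum_of_subset_of_nonneg ?_ fun _ _ _ => Nat.cast_nonneg _
    intro G hG
    exact mem_filter.2 ⟨mem_univ _, (mem_filter.1 hG).2.1⟩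
  have h2 : ∑ w : Fin n,
      ((univ.filter (fun G : SimpleGraph (Fin n) => Reg d G ∧ Bad G w)).card : ℝ) ≤
      n * (R.card * K * ((n : ℝ) - (d + 1) ^ 3)⁻¹) := by
    refine (sum_le_sum fun w _ => hw w).trans ?_
    simp
  rw [hdc] at h1
  have h3 := h1.trans h2
  have h4 : (Q.card : ℝ) * δ ≤ R.card * K * ((n : ℝ) - (d + 1) ^ 3)⁻¹ := by
    refine le_of_mul_le_mul_left ?_ hn0
    linarith
  calc (Q.card : ℝ) ≤ R.card * K * ((n : ℝ) - (d + 1) ^ 3)⁻¹ / δ := by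
        rw [le_div_iff₀ hδ]; exact h4
    _ = _ := by ring

/-- The analytic estimate for the choice `p = log d / (2d)`. -/
lemma analytic (d : ℕ) (hd : 1 ≤ d) :
    0 ≤ Real.log d / (2 * d) ∧ Real.log d / (2 * d) < 1 ∧
      Real.exp (Real.log d / 4) ≤ d * (1 - Real.log d / (2 * d)) ^ d := by
  have hd1 : (1 : ℝ) ≤ d := by exact_mod_cast hd
  have hd0 : (0 : ℝ) < d := by linarith
  have hlog : 0 ≤ Real.log d := Real.log_nonneg hd1
  have hle : Real.log d ≤ d / 2 := by
    have h1 : Real.log d = Real.log (d / 2) + Real.log 2 := by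
      rw [← Real.log_mul (by positivity) (by norm_num)]; congr 1; ring
    have h2 := Real.log_le_sub_one_of_pos (show (0 : ℝ) < d / 2 by positivity)
    have h3 := Real.log_two_lt_d9
    linarith
  set p := Real.log d / (2 * d) with hp
  have hp0 : 0 ≤ p := by positivity
  have hp4 : p ≤ 1 / 4 := by
    rw [hp, div_le_iff₀ (by positivity)]; linarith
  refine ⟨hp0, by linarith, ?_⟩
  have hexp : Real.exp (-(3 / 2 * p)) ≤ 1 - p := by
    rw [Real.exp_neg]
    have h1 : 1 + 3 / 2 * p ≤ Real.exp (3 / 2 * p) := by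
      linarith [Real.add_one_le_exp (3 / 2 * p)]
    have h2 : (Real.exp (3 / 2 * p))⁻¹ ≤ (1 + 3 / 2 * p)⁻¹ := inv_anti₀ (by positivity) h1
    refine h2.trans ?_
    rw [inv_le_iff_one_le_mul₀ (by positivity)]
    nlinarith
  have h5 : Real.exp (-(3 / 4 * Real.log d)) ≤ (1 - p) ^ d := by
    have : Real.exp (-(3 / 4 * Real.log d)) = Real.exp (-(3 / 2 * p)) ^ d := by
      rw [← Real.exp_nat_mul]
      congr 1
      rw [hp]; field_simp; ring
    rw [this]
    exact pow_le_pow_left₀ (Real.exp_pos _).le hexp d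
  calc Real.exp (Real.log d / 4) = d * Real.exp (-(3 / 4 * Real.log d)) := by
        nth_rewrite 2 [← Real.exp_log hd0]
        rw [← Real.exp_add]; congr 1; ring
    _ ≤ _ := by gcongr

open scoped Classical in
lemma zf_of_few_bad (ε : ℝ) (hε : 0 < ε) (d n : ℕ) (hd : 1 ≤ d)
    (hbig : max 1 (2 / ε) ≤ Real.exp (Real.log d / 4)) (G : SimpleGraph (Fin n)) (hG : Reg d G)
    (hb : ((univ.filter (fun w => Bad G w)).card : ℝ) ≤ ε / 2 * n) :
    (zeroForcingNumber G : ℝ) ≤ n * (1 - (1 - ε) * Real.log d / (2 * d)) := by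
  obtain ⟨h0, h1, h2⟩ := analytic d hd
  have h := zf_bound G d hd hG _ h0 h1
  rw [Fintype.card_fin] at h
  set p := Real.log d / (2 * d) with hp
  set m : ℝ := d * (1 - p) ^ d with hm
  have hm1 : 1 ≤ m := (le_max_left _ _).trans (hbig.trans h2)
  have hm2 : 2 / ε ≤ m := (le_max_right _ _).trans (hbig.trans h2)
  have hm0 : 0 < m := by linarith
  have hinv : 1 / m ≤ ε / 2 := by
    rw [div_le_iff₀ hm0]
    rw [div_le_iff₀ hε] at hm2
    linarith
  have hinv1 : 1 / m ≤ 1 := by rw [div_le_iff₀ hm0]; linarith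
  have hinv0 : 0 < 1 / m := by positivity
  have hcard : ((univ.filter (fun w => Bad G w)).card : ℝ) +
      (univ.filter (fun w => ¬ Bad G w)).card = n := by
    have := card_filter_add_card_filter_not (s := (univ : Finset (Fin n))) (fun w => Bad G w)
    rw [card_univ, Fintype.card_fin] at this
    exact_mod_cast this
  set g : ℝ := ((univ.filter (fun w => ¬ Bad G w)).card : ℝ) with hg
  have hgn : (1 - ε / 2) * n ≤ g := by linarith
  have hn0 : (0 : ℝ) ≤ n := Nat.cast_nonneg n
  have key : (1 - ε) * n ≤ g * (1 - 1 / m) := by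
    calc (1 - ε) * n ≤ ((1 - ε / 2) * n) * (1 - 1 / m) := by
          have : 0 ≤ n * (ε / 2 - 1 / m) := mul_nonneg hn0 (by linarith)
          have : 0 ≤ n * (ε / 2 * (1 / m)) := by positivity
          nlinarith
      _ ≤ _ := mul_le_mul_of_nonneg_right hgn (by linarith)
  have key2 := mul_le_mul_of_nonneg_right key h0
  have e : (1 - ε) * Real.log d / (2 * d) = (1 - ε) * p := by rw [hp]; ring
  rw [e]
  linarith

end final

end ZFR

theorem aas_zeroForcing_upper (ε : ℝ) (hε : 0 < ε) :
    ∃ d₀ : ℕ, ∀ d : ℕ, d₀ ≤ d →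
      Filter.Tendsto
        (fun n : ℕ => regularProportion d n fun G =>
          (zeroForcingNumber G : ℝ) ≤ n * (1 - (1 - ε) * Real.log d / (2 * d)))
        (Filter.atTop ⊓ Filter.principal {n : ℕ | Even (d * n)}) (nhds 1) := by
  classical
  have hlim : Filter.Tendsto (fun d : ℕ => Real.exp (Real.log d / 4)) Filter.atTop Filter.atTop :=
    Real.tendsto_exp_atTop.comp ((Real.tendsto_log_atTop.comp
      tendsto_natCast_atTop_atTop).atTop_div_const (by norm_num))
  obtain ⟨d₁, hd₁⟩ := Filter.eventually_atTop.1
    (Filter.tendsto_atTop.1 hlim (max 1 (2 / ε)))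
  refine ⟨max 1 d₁, fun d hd => ?_⟩
  have hd1 : 1 ≤ d := (le_max_left _ _).trans hd
  have hbig := hd₁ d ((le_max_right _ _).trans hd)
  set K : ℝ := ((d + 1) ^ 3 * d * d : ℝ) / (ε / 2) with hK
  have hlow : Filter.Tendsto (fun n : ℕ => 1 - K * ((n : ℝ) - (d + 1) ^ 3)⁻¹)
      (Filter.atTop ⊓ Filter.principal {n : ℕ | Even (d * n)}) (nhds 1) := by
    have h1 : Filter.Tendsto (fun n : ℕ => ((n : ℝ) - (d + 1) ^ 3)⁻¹) Filter.atTop (nhds 0) :=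
      (Filter.tendsto_atTop_add_const_right _ (-((d : ℝ) + 1) ^ 3)
        tendsto_natCast_atTop_atTop).inv_tendsto_atTop.congr fun n => by
          simp [sub_eq_add_neg]
    have h2 := (h1.const_mul K).const_sub 1
    rw [mul_zero, sub_zero] at h2
    exact h2.mono_left inf_le_left
  have hev : ∀ᶠ n : ℕ in Filter.atTop ⊓ Filter.principal {n : ℕ | Even (d * n)},
      (d + 1) ^ 3 < n ∧ Even (d * n) := by
    rw [Filter.eventually_inf_principal]
    filter_upwards [Filter.eventually_gt_atTop ((d + 1) ^ 3)] with n hn he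
    exact ⟨hn, he⟩
  have hcard : ∀ n : ℕ, ∀ P : SimpleGraph (Fin n) → Prop, regularProportion d n P =
      ((Finset.univ.filter (fun G : SimpleGraph (Fin n) => ZFR.Reg d G ∧ P G)).card : ℝ) /
      (Finset.univ.filter (fun G : SimpleGraph (Fin n) => ZFR.Reg d G)).card := by
    intro n P
    unfold regularProportion
    congr 2
    · refine Nat.subtype_card _ fun G => ?_
      simp only [Finset.mem_filter, Finset.mem_univ, true_and, ZFR.isRegular_iff]
    · refine Nat.subtype_card _ fun G => ?_
      simp only [Finset.mem_filter, Finset.mem_univ, true_and, ZFR.isRegular_iff]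
  refine tendsto_of_tendsto_of_tendsto_of_le_of_le' hlow tendsto_const_nhds ?_ ?_
  · filter_upwards [hev] with n hn
    obtain ⟨hn, he⟩ := hn
    rw [hcard]
    set R := Finset.univ.filter (fun G : SimpleGraph (Fin n) => ZFR.Reg d G) with hR
    have hdn : d < n := by
      have : d + 1 ≤ (d + 1) ^ 3 := Nat.le_self_pow (by norm_num) _
      omega
    have hRpos : (0 : ℝ) < R.card := by
      obtain ⟨G, hG⟩ := ZFR.exists_reg d n hdn he
      exact_mod_cast Finset.card_pos.2 ⟨G, Finset.mem_filter.2 ⟨Finset.mem_univ _, hG⟩⟩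
    have hfew := ZFR.few_bad d n hd1 (ε / 2) (by positivity) hn
    rw [le_div_iff₀ hRpos]
    set Q := Finset.univ.filter (fun G : SimpleGraph (Fin n) =>
      ZFR.Reg d G ∧ ε / 2 * n < (Finset.univ.filter (fun w => ZFR.Bad G w)).card) with hQ
    set S := Finset.univ.filter (fun G : SimpleGraph (Fin n) => ZFR.Reg d G ∧
      (zeroForcingNumber G : ℝ) ≤ n * (1 - (1 - ε) * Real.log d / (2 * d))) with hS
    have hsub : R ⊆ S ∪ Q := by
      intro G hG
      have hreg : ZFR.Reg d G := (Finset.mem_filter.1 hG).2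
      by_cases hb : ε / 2 * n < ((Finset.univ.filter (fun w => ZFR.Bad G w)).card : ℝ)
      · exact Finset.mem_union_right _ (Finset.mem_filter.2 ⟨Finset.mem_univ _, hreg, hb⟩)
      · refine Finset.mem_union_left _ (Finset.mem_filter.2 ⟨Finset.mem_univ _, hreg, ?_⟩)
        exact ZFR.zf_of_few_bad ε hε d n hd1 hbig G hreg (not_lt.1 hb)
    have hle : (R.card : ℝ) ≤ S.card + Q.card := by
      exact_mod_cast (Finset.card_le_card hsub).trans (Finset.card_union_le _ _)
    have hfew' : (Q.card : ℝ) ≤ R.card * (K * ((n : ℝ) - (d + 1) ^ 3)⁻¹) := hfew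
    linarith
  · filter_upwards with n
    rw [hcard]
    refine div_le_one_of_le₀ ?_ (Nat.cast_nonneg _)
    rw [Nat.cast_le]
    refine Finset.card_le_card fun G hG => ?_
    exact Finset.mem_filter.2 ⟨Finset.mem_univ _, (Finset.mem_filter.1 hG).2.1⟩
end

section
/- For every ε > 0 there exists d₀ such that for every fixed integer d ≥ d₀ the following holds: the probability that a uniformly random simple d-regular graph G on n labelled vertices satisfies Z(G) ≥ n·(1 − (1+ε)·(4 log d)/d) tends to 1 as n → ∞ (along integers n with dn even). Here log denotes the natural logarithm. -/
section RR
open scoped Classical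

lemma rr_card_fiber_le {S P ι : Type*} [Fintype S] [Fintype P] [Fintype ι]
    [DecidableEq S] [DecidableEq P] [DecidableEq ι]
    (f : P → ι) (g : S → ι) :
    (Finset.univ.filter (fun σ : S ≃ P => ∀ s, f (σ s) = g s)).card ≤
      ∏ i, (Fintype.card {p // f p = i}).factorial := by
  by_cases h : ∃ σ0 : S ≃ P, ∀ s, f (σ0 s) = g s
  · obtain ⟨σ0, h0⟩ := h
    rw [← DomMulAct.stabilizer_card f, ← Fintype.card_coe]
    refine Fintype.card_le_of_injective
      (fun σ => (⟨σ0.symm.trans σ.1, ?_⟩ : {g : Equiv.Perm P // f ∘ g = f})) ?_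
    · have := (Finset.mem_filter.1 σ.2).2
      funext p
      simp [this, ← h0]
    · intro σ τ hst
      simp only [Subtype.mk.injEq] at hst
      apply Subtype.ext
      ext s : 1
      simpa using DFunLike.congr_fun hst (σ0 s)
  · rw [Finset.card_eq_zero.2]
    · exact Nat.zero_le _
    · rw [Finset.filter_eq_empty_iff]
      intro σ _ hσ
      exact h ⟨σ, hσ⟩

lemma rr_card_fiber_eq {S P ι : Type*} [Fintype S] [Fintype P] [Fintype ι]
    [DecidableEq S] [DecidableEq P] [DecidableEq ι]
    (f : P → ι) (g : S → ι)
    (h : ∀ i, Fintype.card {s // g s = i} = Fintype.card {p // f p = i}) :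
    (Finset.univ.filter (fun σ : S ≃ P => ∀ s, f (σ s) = g s)).card =
      ∏ i, (Fintype.card {p // f p = i}).factorial := by
  have e : ∀ i, {s // g s = i} ≃ {p // f p = i} := fun i => Fintype.equivOfCardEq (h i)
  let σ0 : S ≃ P := Equiv.ofFiberEquiv e
  have h0 : ∀ s, f (σ0 s) = g s := fun s => Equiv.ofFiberEquiv_map e s
  rw [← DomMulAct.stabilizer_card f, ← Fintype.card_coe]
  refine Fintype.card_congr ⟨fun σ => ⟨σ0.symm.trans σ.1, ?_⟩, fun τ => ⟨σ0.trans τ.1, ?_⟩, ?_, ?_⟩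
  · have := (Finset.mem_filter.1 σ.2).2
    funext p
    simp [this, ← h0]
  · refine Finset.mem_filter.2 ⟨Finset.mem_univ _, fun s => ?_⟩
    have := congrFun τ.2 (σ0 s)
    simp only [Function.comp] at this
    simp [this, h0]
  · intro σ; apply Subtype.ext; ext s; simp
  · intro σ; apply Subtype.ext; ext s; simp

/-- number of bijections with prescribed values -/
lemma rr_card_prescribed {S P : Type*} [Fintype S] [Fintype P] [DecidableEq S] [DecidableEq P]
    (k : ℕ) (a : Fin k → S) (ha : Function.Injective a)
    (b : Fin k → P) :
    (Finset.univ.filter (fun σ : S ≃ P => ∀ j, σ (a j) = b j)).card ≤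
      (Fintype.card P - k).factorial := by
  by_cases h : ∃ σ0 : S ≃ P, ∀ j, σ0 (a j) = b j
  · obtain ⟨σ0, h0⟩ := h
    have hb : Function.Injective b := by
      intro i j hij
      apply ha; apply σ0.injective; rw [h0, h0, hij]
    have hcard : Fintype.card {p // p ∉ Set.range b} = Fintype.card P - k := by
      rw [Fintype.card_subtype_compl]
      congr 1
      have := Fintype.card_congr (Equiv.ofInjective b hb)
      rw [Fintype.card_fin] at this
      convert this.symm
    rw [← hcard, ← Fintype.card_perm,
      Fintype.card_congr (Equiv.Perm.subtypeEquivSubtypePerm (fun p => p ∉ Set.range b)),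
      ← Fintype.card_coe]
    refine Fintype.card_le_of_injective
      (fun σ => ⟨σ0.symm.trans σ.1, ?_⟩) ?_
    · have := (Finset.mem_filter.1 σ.2).2
      intro p hp
      rw [not_not] at hp
      obtain ⟨j, rfl⟩ := hp
      have h1 : σ0.symm (b j) = a j := by rw [← h0]; simp
      simp [h1, this]
    · intro σ τ hst
      simp only [Subtype.mk.injEq] at hst
      apply Subtype.ext
      ext s : 1
      simpa using DFunLike.congr_fun hst (σ0 s)
  · rw [Finset.card_eq_zero.2]
    · exact Nat.zero_le _
    · rw [Finset.filter_eq_empty_iff]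
      intro σ _ hσ
      exact h ⟨σ, hσ⟩

lemma rr_factorial_le (k : ℕ) : (k.factorial : ℝ) * Real.exp k ≤ Real.exp 1 * (k + 1) * (k : ℝ) ^ k := by
  have key : ∀ k : ℕ, ((k+1).factorial : ℝ) * Real.exp (k+1 : ℕ) ≤ Real.exp 1 * ((k+1 : ℕ) : ℝ) ^ (k+2) := by
    intro k
    induction k with
    | zero => simp
    | succ k ih =>
      have h1 : Real.exp 1 * ((k+1 : ℕ) : ℝ) ^ (k+2) ≤ ((k+1+1 : ℕ) : ℝ) ^ (k+2) := by
        have hpos : (0:ℝ) < ((k+1+1 : ℕ) : ℝ) := by positivity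
        have h2 : ((k+1 : ℕ) : ℝ) ≤ ((k+1+1 : ℕ) : ℝ) * Real.exp (-(1 / ((k+1+1 : ℕ) : ℝ))) := by
          have := Real.add_one_le_exp (-(1 / ((k+1+1 : ℕ) : ℝ)))
          have h3 : ((k+1 : ℕ) : ℝ) = ((k+1+1 : ℕ) : ℝ) * (-(1 / ((k+1+1 : ℕ) : ℝ)) + 1) := by
            push_cast at hpos ⊢; field_simp; ring
          rw [h3]; gcongr
        calc Real.exp 1 * ((k+1 : ℕ) : ℝ) ^ (k+2)
            ≤ Real.exp 1 * (((k+1+1 : ℕ) : ℝ) * Real.exp (-(1 / ((k+1+1 : ℕ) : ℝ)))) ^ (k+2) := by gcongr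
          _ = ((k+1+1 : ℕ) : ℝ) ^ (k+2) := by
            rw [mul_pow, ← Real.exp_nat_mul]
            have : ((k+2 : ℕ) : ℝ) * -(1 / ((k+1+1 : ℕ) : ℝ)) = -1 := by
              push_cast at hpos ⊢; field_simp; ring
            rw [this, Real.exp_neg]; field_simp
      rw [Nat.factorial_succ]
      calc (((k+1+1) * (k+1).factorial : ℕ) : ℝ) * Real.exp (k+1+1 : ℕ)
          = ((k+1+1 : ℕ) : ℝ) * Real.exp 1 * (((k+1).factorial : ℝ) * Real.exp (k+1 : ℕ)) := by
            push_cast; rw [show ((k:ℝ)+1+1) = 1 + (k+1) by ring, Real.exp_add 1]; ring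
        _ ≤ ((k+1+1 : ℕ) : ℝ) * Real.exp 1 * (Real.exp 1 * ((k+1 : ℕ) : ℝ) ^ (k+2)) := by gcongr
        _ ≤ ((k+1+1 : ℕ) : ℝ) * Real.exp 1 * ((k+1+1 : ℕ) : ℝ) ^ (k+2) := by gcongr
        _ = _ := by ring
  cases k with
  | zero => simp
  | succ k =>
    refine (key k).trans ?_
    rw [pow_succ, mul_assoc, mul_comm _ ((k+1 : ℕ) : ℝ)]
    gcongr
    linarith

lemma rr_pow_le_factorial (k : ℕ) : (k : ℝ) ^ k ≤ k.factorial * Real.exp k := by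
  have := Real.pow_div_factorial_le_exp (k : ℝ) (by positivity) k
  rw [div_le_iff₀ (by positivity)] at this
  linarith
end RR

section RR
open scoped Classical

lemma rr_noAB_aux {P : Type*} [Fintype P] [DecidableEq P] (M : ℕ) (cl : P → Fin 3) (w : Fin 3 → ℝ)
    (hw : ∀ i, 0 ≤ w i) (hw1 : w 0 + w 1 + w 2 = 1) :
    ((Finset.univ.filter (fun σ : (Fin M × Fin 2) ≃ P => ∀ i : Fin M,
      ¬ (cl (σ (i,0)) = 0 ∧ cl (σ (i,1)) = 1) ∧ ¬ (cl (σ (i,0)) = 1 ∧ cl (σ (i,1)) = 0))).card : ℝ)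
      * (∏ p, w (cl p)) ≤
    ((∏ i, (Fintype.card {p // cl p = i}).factorial : ℕ) : ℝ) * (1 - 2 * (w 0 * w 1)) ^ M := by
  set ok : Finset (Fin 3 × Fin 3) := Finset.univ.filter
    (fun q => ¬ (q.1 = 0 ∧ q.2 = 1) ∧ ¬ (q.1 = 1 ∧ q.2 = 0)) with hok
  have hQ : ∑ q ∈ ok, w q.1 * w q.2 = 1 - 2 * (w 0 * w 1) := by
    rw [hok, Finset.sum_filter, Fintype.sum_prod_type]
    simp only [Fin.sum_univ_three]
    have : w 2 = 1 - w 0 - w 1 := by linarith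
    simp [this]
    ring
  set Pi : Finset (Fin M → Fin 3 × Fin 3) := Fintype.piFinset (fun _ => ok) with hPi
  set A := Finset.univ.filter (fun σ : (Fin M × Fin 2) ≃ P => ∀ i : Fin M,
      ¬ (cl (σ (i,0)) = 0 ∧ cl (σ (i,1)) = 1) ∧ ¬ (cl (σ (i,0)) = 1 ∧ cl (σ (i,1)) = 0)) with hA
  set F := ∏ i, (Fintype.card {p // cl p = i}).factorial with hF
  let pat : ((Fin M × Fin 2) ≃ P) → (Fin M → Fin 3 × Fin 3) :=
    fun σ i => (cl (σ (i,0)), cl (σ (i,1)))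
  have hmap : ∀ σ ∈ A, pat σ ∈ Pi := by
    intro σ hσ
    rw [hPi, Fintype.mem_piFinset]
    intro i
    rw [hok, Finset.mem_filter]
    exact ⟨Finset.mem_univ _, (Finset.mem_filter.1 hσ).2 i⟩
  have hwt : ∀ σ, ∏ i, (w (pat σ i).1 * w (pat σ i).2) = ∏ p, w (cl p) := by
    intro σ
    rw [← Equiv.prod_comp σ, Fintype.prod_prod_type]
    simp [pat]
  have hfib : ∀ π ∈ Pi, ((A.filter (fun σ => pat σ = π)).card : ℝ) * (∏ p, w (cl p)) ≤
      (F : ℝ) * ∏ i, (w (π i).1 * w (π i).2) := by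
    intro π _
    by_cases hne : (A.filter (fun σ => pat σ = π)).Nonempty
    · obtain ⟨σ, hσ⟩ := hne
      have h1 := (Finset.mem_filter.1 hσ).2
      rw [← hwt σ, h1]
      refine mul_le_mul_of_nonneg_right ?_ (Finset.prod_nonneg fun i _ => mul_nonneg (hw _) (hw _))
      norm_cast
      refine le_trans (Finset.card_le_card ?_) ((rr_card_fiber_le cl
        (fun s : Fin M × Fin 2 => if s.2 = 0 then (π s.1).1 else (π s.1).2)).trans
          (le_of_eq (by rw [hF])))
      intro τ hτ
      have h2 := (Finset.mem_filter.1 hτ).2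
      refine Finset.mem_filter.2 ⟨Finset.mem_univ _, ?_⟩
      rintro ⟨i, b⟩
      rw [← h2]
      fin_cases b <;> simp [pat]
    · rw [Finset.not_nonempty_iff_eq_empty] at hne
      rw [hne]
      simp only [Finset.card_empty, Nat.cast_zero, zero_mul]
      exact mul_nonneg (by positivity) (Finset.prod_nonneg fun i _ => mul_nonneg (hw _) (hw _))
  rw [Finset.card_eq_sum_card_fiberwise hmap, Nat.cast_sum, Finset.sum_mul, ← hQ]
  refine (Finset.sum_le_sum hfib).trans ?_
  rw [← Finset.mul_sum]
  refine mul_le_mul_of_nonneg_left ?_ (by positivity)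
  have := Finset.prod_univ_sum (fun _ : Fin M => ok) (fun _ q => w q.1 * w q.2)
  rw [hPi, ← this]
  simp

lemma rr_noAB {P : Type*} [Fintype P] [DecidableEq P] (M : ℕ) (cl : P → Fin 3) (hN : 0 < Fintype.card P) (x y : ℝ)
    (hx : (Fintype.card {p // cl p = 0} : ℝ) = x * Fintype.card P)
    (hy : (Fintype.card {p // cl p = 1} : ℝ) = y * Fintype.card P) :
    ((Finset.univ.filter (fun σ : (Fin M × Fin 2) ≃ P => ∀ i : Fin M,
      ¬ (cl (σ (i,0)) = 0 ∧ cl (σ (i,1)) = 1) ∧ ¬ (cl (σ (i,0)) = 1 ∧ cl (σ (i,1)) = 0))).card : ℝ)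
    ≤ (Fintype.card P).factorial * (Real.exp 1 * (Fintype.card P + 1)) ^ 3
        * (1 - 2 * (x * y)) ^ M := by
  set N := Fintype.card P with hNdef
  set c : Fin 3 → ℕ := fun i => Fintype.card {p // cl p = i} with hc
  have hcsum : c 0 + c 1 + c 2 = N := by
    have := Fintype.card_congr (Equiv.sigmaFiberEquiv cl)
    rw [Fintype.card_sigma, Fin.sum_univ_three] at this
    exact this
  have hNR : (0:ℝ) < N := by exact_mod_cast hN
  set w : Fin 3 → ℝ := fun i => c i / N with hw
  have hw0 : w 0 = x := by simp only [hw, hc]; rw [hx]; field_simp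
  have hw1 : w 1 = y := by simp only [hw, hc]; rw [hy]; field_simp
  have haux := rr_noAB_aux M cl w (fun i => by positivity) (by
    simp only [hw]; rw [← add_div, ← add_div]
    rw [div_eq_one_iff_eq hNR.ne']; exact_mod_cast hcsum)
  rw [hw0, hw1] at haux
  have hW : ∏ p, w (cl p) = ∏ i, w i ^ c i := by
    rw [← Finset.prod_fiberwise_of_maps_to (g := cl) (t := Finset.univ) (fun _ _ => Finset.mem_univ _)]
    refine Finset.prod_congr rfl fun i _ => ?_
    rw [Finset.prod_congr rfl (g := fun _ => w i) (fun p hp => by rw [(Finset.mem_filter.1 hp).2]),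
      Finset.prod_const]
    simp only [hc]; rw [Fintype.card_subtype]
  have hWpos : 0 < ∏ p, w (cl p) := by
    refine Finset.prod_pos fun p _ => ?_
    have : 0 < c (cl p) := Fintype.card_pos_iff.2 ⟨⟨p, rfl⟩⟩
    simp only [hw]; positivity
  have hcN : ∀ i, c i ≤ N := fun i => Fintype.card_subtype_le _
  have hF : ((∏ i, (c i).factorial : ℕ) : ℝ) ≤
      (∏ p, w (cl p)) * (N.factorial * (Real.exp 1 * (N + 1)) ^ 3) := by
    have h1 : ∏ i, (((c i).factorial : ℝ) * Real.exp (c i)) ≤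
        ∏ i, (Real.exp 1 * (N + 1) * (c i : ℝ) ^ (c i)) := by
      refine Finset.prod_le_prod (fun i _ => by positivity) fun i _ => ?_
      refine (rr_factorial_le (c i)).trans ?_
      have : (c i : ℝ) ≤ N := by exact_mod_cast hcN i
      gcongr
    have h2 : ∏ i, (c i : ℝ) ^ (c i) = (∏ p, w (cl p)) * (N:ℝ) ^ N := by
      rw [hW]
      have : (N:ℝ)^N = ∏ i, (N:ℝ) ^ (c i) := by
        rw [Finset.prod_pow_eq_pow_sum, Fin.sum_univ_three, hcsum]
      rw [this, ← Finset.prod_mul_distrib]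
      refine Finset.prod_congr rfl fun i _ => ?_
      rw [← mul_pow]; congr 1; simp only [hw]; field_simp
    have h3 : ∏ i, Real.exp (c i) = Real.exp N := by
      rw [← Real.exp_sum, Fin.sum_univ_three]; congr 1; exact_mod_cast hcsum
    rw [Finset.prod_mul_distrib, Finset.prod_mul_distrib, h2, h3, Finset.prod_const] at h1
    simp only [Finset.card_univ, Fintype.card_fin] at h1
    have h4 := rr_pow_le_factorial N
    generalize (∏ p, w (cl p)) = W at hWpos h1 ⊢
    have he := Real.exp_pos (N:ℝ)
    have hE : (0:ℝ) ≤ (Real.exp 1 * (N + 1)) ^ 3 := by positivity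
    generalize (Real.exp 1 * ((N:ℝ) + 1)) ^ 3 = E at hE h1 ⊢
    have h5 := mul_le_mul_of_nonneg_left (mul_le_mul_of_nonneg_left h4 hWpos.le) hE
    have h6 := h1.trans h5
    rw [Nat.cast_prod]
    refine le_of_mul_le_mul_right (h6.trans (le_of_eq ?_)) he
    ring
  have hQ : 0 ≤ (1 - 2 * (x * y)) := by
    have h1 : w 0 + w 1 ≤ 1 := by
      simp only [hw]; rw [← add_div, div_le_one hNR]; norm_cast; omega
    rw [hw0, hw1] at h1
    have hx0 : 0 ≤ x := by rw [← hw0]; positivity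
    have hy0 : 0 ≤ y := by rw [← hw1]; positivity
    nlinarith [sq_nonneg (x - y), sq_nonneg (x+y)]
  refine le_of_mul_le_mul_right (haux.trans ?_) hWpos
  have h7 := mul_le_mul_of_nonneg_right hF (pow_nonneg hQ M)
  refine (le_of_eq ?_).trans (h7.trans (le_of_eq ?_))
  · congr!
  · ring
end RR

section RR
open scoped Classical

lemma rr_zf_forcers {V : Type*} [DecidableEq V] (G : SimpleGraph V) (S T : Finset V)
    (h : Relation.ReflTransGen (zfStep G) S T) :
    ∃ U : Finset V, U ⊆ T ∧ U.card + S.card = T.card ∧ ∀ u ∈ U, ∀ x, G.Adj u x → x ∈ T := by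
  induction h with
  | refl => exact ⟨∅, by simp, by simp, by simp⟩
  | tail hst hstep ih =>
    rename_i T T'
    obtain ⟨U, hUT, hc, hU⟩ := ih
    obtain ⟨v, hv, w, hw, hvw, huniq, rfl⟩ := hstep
    have hvU : v ∉ U := fun hvU => hw (hU v hvU w hvw)
    refine ⟨insert v U, ?_, ?_, ?_⟩
    · intro x hx
      rw [Finset.mem_insert] at hx ⊢
      rcases hx with rfl | hx
      · exact Or.inr hv
      · exact Or.inr (hUT hx)
    · rw [Finset.card_insert_of_notMem hvU, Finset.card_insert_of_notMem hw]; omega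
    · intro u hu x hux
      rw [Finset.mem_insert] at hu ⊢
      rcases hu with rfl | hu
      · by_cases hx : x ∈ T
        · exact Or.inr hx
        · exact Or.inl (huniq x hux hx)
      · exact Or.inr (hU u hu x hux)

lemma rr_zf_inter {V : Type*} [DecidableEq V] (G : SimpleGraph V) (S T : Finset V)
    (h : Relation.ReflTransGen (zfStep G) S T) (k : ℕ) (hk : S.card ≤ k) (hk2 : k ≤ T.card) :
    ∃ R, Relation.ReflTransGen (zfStep G) S R ∧ R.card = k := by
  induction h with
  | refl => exact ⟨S, .refl, le_antisymm hk hk2⟩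
  | tail hst hstep ih =>
    rename_i T T'
    by_cases hkT : k ≤ T.card
    · exact ih hkT
    · refine ⟨T', hst.tail hstep, ?_⟩
      obtain ⟨v, hv, w, hw, hvw, huniq, rfl⟩ := hstep
      rw [Finset.card_insert_of_notMem hw] at hk2 ⊢
      omega

lemma rr_zf_hole {n : ℕ} (G : SimpleGraph (Fin n)) (m : ℕ)
    (h : zeroForcingNumber G + 2 * m ≤ n) :
    ∃ A B : Finset (Fin n), A.card = m ∧ B.card = m ∧ Disjoint A B ∧
      ∀ a ∈ A, ∀ b ∈ B, ¬ G.Adj a b := by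
  have hne : {k | ∃ S : Finset (Fin n), IsZeroForcingSet G S ∧ S.card = k}.Nonempty :=
    ⟨_, Finset.univ, .refl, rfl⟩
  obtain ⟨S, hS, hSc⟩ := Nat.sInf_mem hne
  change S.card = zeroForcingNumber G at hSc
  obtain ⟨R, hR, hRc⟩ := rr_zf_inter G S Finset.univ hS (S.card + m) (by omega)
    (by rw [Finset.card_univ, Fintype.card_fin]; omega)
  obtain ⟨U, hUR, hUc, hU⟩ := rr_zf_forcers G S R hR
  obtain ⟨B, hB, hBc⟩ := Finset.exists_subset_card_eq (s := Rᶜ) (n := m) (by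
    rw [Finset.card_compl, Fintype.card_fin]; omega)
  refine ⟨U, B, by omega, hBc, ?_, ?_⟩
  · rw [Finset.disjoint_left]
    intro a ha hb
    exact Finset.mem_compl.1 (hB hb) (hUR ha)
  · intro a ha b hb hab
    exact Finset.mem_compl.1 (hB hb) (hU a ha b hab)

abbrev RRCfg (n d M : ℕ) := (Fin M × Fin 2) ≃ (Fin n × Fin d)

def rrE {n d M : ℕ} (σ : RRCfg n d M) (i : Fin M) : Sym2 (Fin n) :=
  s((σ (i,0)).1, (σ (i,1)).1)

def rrSimple {n d M : ℕ} (σ : RRCfg n d M) : Prop :=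
  (∀ i, (σ (i,0)).1 ≠ (σ (i,1)).1) ∧ Function.Injective (rrE σ)

def rrRep {n d M : ℕ} (G : SimpleGraph (Fin n)) (σ : RRCfg n d M) : Prop :=
  (∀ i, G.Adj (σ (i,0)).1 (σ (i,1)).1) ∧ Function.Injective (rrE σ)

lemma rr_edges {n d M : ℕ} (G : SimpleGraph (Fin n)) (hG : ∀ v, G.degree v = d)
    (hM : n * d = 2 * M) : G.edgeFinset.card = M := by
  have := G.sum_degrees_eq_twice_card_edges
  simp only [hG, Finset.sum_const, Finset.card_univ, Fintype.card_fin, smul_eq_mul] at this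
  omega

/-- the ordered-oriented edge lists of G -/
lemma rr_card_words {n d M : ℕ} (G : SimpleGraph (Fin n)) (hG : ∀ v, G.degree v = d)
    (hM : n * d = 2 * M) :
    (Finset.univ.filter (fun f : Fin M → G.Dart =>
      Function.Injective (fun i => (f i).edge))).card = M.factorial * 2 ^ M := by
  have hE := rr_edges G hG hM
  set T : Finset (Fin M → Sym2 (Fin n)) :=
    (Finset.univ : Finset (Fin M ↪ G.edgeFinset)).image (fun e i => (e i : Sym2 (Fin n))) with hT
  have hTc : T.card = M.factorial := by
    rw [hT, Finset.card_image_of_injective, Finset.card_univ, Fintype.card_embedding_eq,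
      Fintype.card_fin, Fintype.card_coe, hE, Nat.descFactorial_self]
    intro e e' h
    ext i : 2
    exact congrFun h i
  have hmap : ∀ f ∈ Finset.univ.filter (fun f : Fin M → G.Dart =>
      Function.Injective (fun i => (f i).edge)), (fun i => (f i).edge) ∈ T := by
    intro f hf
    rw [hT, Finset.mem_image]
    refine ⟨⟨fun i => ⟨(f i).edge, ?_⟩, ?_⟩, Finset.mem_univ _, rfl⟩
    · rw [SimpleGraph.mem_edgeFinset]; exact (f i).edge_mem
    · intro i j hij
      exact (Finset.mem_filter.1 hf).2 (congrArg Subtype.val hij)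
  rw [Finset.card_eq_sum_card_fiberwise hmap, Finset.sum_const_nat (m := 2 ^ M), hTc]
  intro g hg
  obtain ⟨e, -, rfl⟩ := Finset.mem_image.1 hg
  have : (Finset.filter (fun f : Fin M → G.Dart => (fun i => (f i).edge) =
      fun i => (e i : Sym2 (Fin n))) (Finset.univ.filter (fun f : Fin M → G.Dart =>
      Function.Injective (fun i => (f i).edge)))) =
      Fintype.piFinset (fun i => Finset.univ.filter
        (fun a : G.Dart => a.edge = (e i : Sym2 (Fin n)))) := by
    ext f
    simp only [Finset.mem_filter, Finset.mem_univ, true_and, Fintype.mem_piFinset]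
    constructor
    · rintro ⟨_, h⟩ i
      exact congrFun h i
    · intro h
      refine ⟨?_, funext h⟩
      intro i j hij
      simp only [h] at hij
      exact e.injective (Subtype.ext hij)
  rw [this, Fintype.card_piFinset, Finset.prod_congr rfl (g := fun _ => 2)]
  · simp
  · intro i _
    have := G.dart_edge_fiber_card (e i : Sym2 (Fin n)) (SimpleGraph.mem_edgeFinset.1 (e i).2)
    convert this
end RR

section RR
open scoped Classical

def rrWord {n M : ℕ} {G : SimpleGraph (Fin n)} (f : Fin M → G.Dart) (s : Fin M × Fin 2) : Fin n :=
  if s.2 = 0 then (f s.1).fst else (f s.1).snd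

lemma rr_word_fiber {n d M : ℕ} (G : SimpleGraph (Fin n)) (hG : ∀ v, G.degree v = d)
    (hM : n * d = 2 * M) (f : Fin M → G.Dart) (hf : Function.Injective (fun i => (f i).edge))
    (v : Fin n) : Fintype.card {s // rrWord f s = v} = d := by
  let ψ : Fin M × Fin 2 → G.Dart := fun s => if s.2 = 0 then f s.1 else (f s.1).symm
  have hedge : ∀ s, (ψ s).edge = (f s.1).edge := by
    intro s
    by_cases h : s.2 = 0 <;> simp [ψ, h]
  have hψi : Function.Injective ψ := by
    rintro ⟨i, b⟩ ⟨j, c⟩ h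
    have h1 : i = j := hf (by
      have := congrArg SimpleGraph.Dart.edge h
      rwa [hedge, hedge] at this)
    subst h1
    have hs := (f i).symm_ne
    fin_cases b <;> fin_cases c
    · rfl
    · exact absurd (by simpa [ψ] using h) hs.symm
    · exact absurd (by simpa [ψ] using h) hs
    · rfl
  have hcard : Fintype.card (Fin M × Fin 2) = Fintype.card G.Dart := by
    rw [SimpleGraph.dart_card_eq_twice_card_edges, rr_edges G hG hM]
    simp [mul_comm]
  have hψ : Function.Bijective ψ := (Fintype.bijective_iff_injective_and_card ψ).2 ⟨hψi, hcard⟩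
  have hw : ∀ s, rrWord f s = (ψ s).fst := by
    intro s
    by_cases h : s.2 = 0 <;> simp [ψ, h, rrWord]
  rw [← hG v, ← SimpleGraph.dart_fst_fiber_card_eq_degree, ← Fintype.card_subtype]
  refine Fintype.card_congr ((Equiv.ofBijective ψ hψ).subtypeEquiv ?_)
  intro s
  rw [hw]; rfl

lemma rr_card_rep {n d M : ℕ} (G : SimpleGraph (Fin n)) (hG : ∀ v, G.degree v = d)
    (hM : n * d = 2 * M) :
    (Finset.univ.filter (fun σ : RRCfg n d M => rrRep G σ)).card =
      M.factorial * 2 ^ M * d.factorial ^ n := by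
  have hU : Finset.univ.filter (fun σ : RRCfg n d M => rrRep G σ) =
      (Finset.univ.filter (fun f : Fin M → G.Dart =>
        Function.Injective (fun i => (f i).edge))).biUnion
        (fun f => Finset.univ.filter (fun σ : RRCfg n d M => ∀ s, (σ s).1 = rrWord f s)) := by
    ext σ
    simp only [Finset.mem_filter, Finset.mem_univ, true_and, Finset.mem_biUnion]
    constructor
    · rintro ⟨h1, h2⟩
      refine ⟨fun i => ⟨((σ (i,0)).1, (σ (i,1)).1), h1 i⟩, h2, ?_⟩
      rintro ⟨i, b⟩
      fin_cases b <;> simp [rrWord]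
    · rintro ⟨f, hf, h⟩
      have h0 : ∀ i, (σ (i,0)).1 = (f i).fst := fun i => by simp [h, rrWord]
      have h1 : ∀ i, (σ (i,1)).1 = (f i).snd := fun i => by simp [h, rrWord]
      refine ⟨fun i => by rw [h0, h1]; exact (f i).adj, ?_⟩
      convert hf using 2 with i
      simp only [rrE, h0, h1]
      rfl
  rw [hU, Finset.card_biUnion]
  · rw [← rr_card_words G hG hM]
    refine Finset.sum_const_nat ?_
    intro f hf
    have hfib : ∀ v : Fin n, Fintype.card {p : Fin n × Fin d // p.1 = v} = d := by
      intro v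
      rw [Fintype.card_subtype]
      have : (Finset.univ.filter (fun p : Fin n × Fin d => p.1 = v)) = {v} ×ˢ Finset.univ := by
        ext ⟨a, b⟩; simp [eq_comm]
      rw [this]; simp
    have := rr_card_fiber_eq (Prod.fst : Fin n × Fin d → Fin n) (rrWord f) (fun v => by
      rw [hfib]
      exact rr_word_fiber G hG hM f (Finset.mem_filter.1 hf).2 v)
    simp only [hfib, Finset.prod_const, Finset.card_univ, Fintype.card_fin] at this
    convert this
  · intro f _ f' _ hne
    change Disjoint _ _
    rw [Finset.disjoint_left]
    intro σ hσ hσ'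
    apply hne
    have h := (Finset.mem_filter.1 hσ).2
    have h' := (Finset.mem_filter.1 hσ').2
    funext i
    have h0 : (f i).fst = (f' i).fst := by
      have := (h (i,0)).symm.trans (h' (i,0)); simpa [rrWord] using this
    have h1 : (f i).snd = (f' i).snd := by
      have := (h (i,1)).symm.trans (h' (i,1)); simpa [rrWord] using this
    exact SimpleGraph.Dart.ext _ _ (Prod.ext h0 h1)

lemma rr_rep_edgeSet {n d M : ℕ} (G : SimpleGraph (Fin n)) (hG : ∀ v, G.degree v = d)
    (hM : n * d = 2 * M) (σ : RRCfg n d M) (h : rrRep G σ) : G.edgeSet = Set.range (rrE σ) := by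
  have h1 : Finset.univ.image (rrE σ) = G.edgeFinset := by
    refine Finset.eq_of_subset_of_card_le ?_ ?_
    · intro e he
      obtain ⟨i, -, rfl⟩ := Finset.mem_image.1 he
      rw [SimpleGraph.mem_edgeFinset]
      exact h.1 i
    · rw [rr_edges G hG hM, Finset.card_image_of_injective _ h.2]; simp
  rw [← SimpleGraph.coe_edgeFinset, ← h1]; simp

lemma rr_rep_unique {n d M : ℕ} (G G' : SimpleGraph (Fin n)) (hG : ∀ v, G.degree v = d)
    (hG' : ∀ v, G'.degree v = d)
    (hM : n * d = 2 * M) (σ : RRCfg n d M) (h : rrRep G σ) (h' : rrRep G' σ) : G = G' := by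
  apply SimpleGraph.edgeSet_injective
  rw [rr_rep_edgeSet G hG hM σ h, rr_rep_edgeSet G' hG' hM σ h']

lemma rr_E_slot {n d M : ℕ} (σ : RRCfg n d M) (s : Fin M × Fin 2) :
    rrE σ s.1 = s((σ s).1, (σ (s.1, s.2 + 1)).1) := by
  obtain ⟨i, b⟩ := s
  fin_cases b
  · simp [rrE]
  · simp [rrE, Sym2.eq_swap]

lemma rr_simple_rep {n d M : ℕ} (σ : RRCfg n d M) (h : rrSimple σ) :
    ∃ G : SimpleGraph (Fin n), (∀ v, G.degree v = d) ∧ rrRep G σ := by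
  obtain ⟨G, hGd⟩ : ∃ G : SimpleGraph (Fin n),
    G = SimpleGraph.fromEdgeSet (Set.range (rrE σ)) := ⟨_, rfl⟩
  have hadj : ∀ i, G.Adj (σ (i,0)).1 (σ (i,1)).1 := fun i => by
    rw [hGd, SimpleGraph.fromEdgeSet_adj]
    exact ⟨⟨i, rfl⟩, h.1 i⟩
  have hne : ∀ s : Fin M × Fin 2, (σ s).1 ≠ (σ (s.1, s.2 + 1)).1 := by
    rintro ⟨i, b⟩
    fin_cases b
    · simpa using h.1 i
    · simpa using (h.1 i).symm
  refine ⟨G, fun v => ?_, hadj, h.2⟩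
  have himg : G.neighborFinset v = Finset.univ.image (fun j : Fin d =>
      (σ ((σ.symm (v, j)).1, (σ.symm (v,j)).2 + 1)).1) := by
    ext x
    rw [SimpleGraph.mem_neighborFinset, hGd, SimpleGraph.fromEdgeSet_adj, Finset.mem_image]
    constructor
    · rintro ⟨⟨i, hi⟩, hvx⟩
      have hcase : ∃ b : Fin 2, (σ (i,b)).1 = v ∧ (σ (i,b+1)).1 = x := by
        simp only [rrE, Sym2.eq_iff] at hi
        rcases hi with ⟨h1, h2⟩ | ⟨h1, h2⟩
        · exact ⟨0, h1, by simpa using h2⟩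
        · exact ⟨1, h2, by simpa using h1⟩
      obtain ⟨b, hb1, hb2⟩ := hcase
      refine ⟨(σ (i,b)).2, Finset.mem_univ _, ?_⟩
      have : σ.symm (v, (σ (i,b)).2) = (i,b) := by
        rw [← hb1, Prod.mk.eta]; simp
      rw [this, hb2]
    · rintro ⟨j, -, rfl⟩
      set s := σ.symm (v, j) with hs
      have hσ : σ s = (v, j) := by simp [hs]
      have h1 := rr_E_slot σ s
      have h2 := hne s
      rw [hσ] at h1 h2
      exact ⟨⟨s.1, h1⟩, h2⟩
  rw [← SimpleGraph.card_neighborFinset_eq_degree, himg, Finset.card_image_of_injective]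
  · simp
  · intro j j' hj
    simp only at hj
    set s := σ.symm (v, j) with hs
    set s' := σ.symm (v, j') with hs'
    have hσ : σ s = (v, j) := by simp [hs]
    have hσ' : σ s' = (v, j') := by simp [hs']
    have h1 := rr_E_slot σ s
    have h1' := rr_E_slot σ s'
    have h2 := hne s
    rw [hσ] at h1 h2
    rw [hσ', ← hj, ← h1] at h1'
    have hi := h.2 h1'
    have hb : s'.2 = s.2 ∨ s'.2 = s.2 + 1 := by
      generalize s'.2 = b
      generalize s.2 = c
      revert b c; decide
    rcases hb with hb | hb
    · have : s' = s := Prod.ext hi hb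
      rw [this, hσ] at hσ'
      exact (Prod.ext_iff.1 hσ').2
    · exfalso
      apply h2
      have : s' = (s.1, s.2 + 1) := Prod.ext hi hb
      rw [← this, hσ']
end RR

section RR
open scoped Classical

def rrBad {V : Type*} {M : ℕ} (E : Fin M → Sym2 V) (i : Fin M) : Prop :=
  (E i).IsDiag ∨ ∃ j, j ≠ i ∧ E j = E i

noncomputable def rrD {n d M : ℕ} (σ : RRCfg n d M) : ℕ :=
  (Finset.univ.filter (rrBad (rrE σ))).card

lemma rr_simple_of_D {n d M : ℕ} (σ : RRCfg n d M) (h : rrD σ = 0) : rrSimple σ := by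
  rw [rrD, Finset.card_eq_zero, Finset.filter_eq_empty_iff] at h
  refine ⟨fun i hi => h (Finset.mem_univ i) (Or.inl ?_), fun i j hij => ?_⟩
  · rw [rrE, Sym2.mk_isDiag_iff]; exact hi
  · by_contra hne
    exact h (Finset.mem_univ j) (Or.inr ⟨i, hne, hij⟩)

lemma rr_bad_lt {V : Type*} {M : ℕ} (E E' : Fin M → Sym2 V) (i j : Fin M)
    (hother : ∀ k, k ≠ i → k ≠ j → E' k = E k)
    (h1 : ¬ (E' i).IsDiag) (h2 : ¬ (E' j).IsDiag) (h12 : i ≠ j → E' i ≠ E' j)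
    (hr1 : ∀ k, E k ≠ E' i) (hr2 : ∀ k, E k ≠ E' j) (hi : rrBad E i) :
    (Finset.univ.filter (rrBad E')).card < (Finset.univ.filter (rrBad E)).card := by
  have hgi : ¬ rrBad E' i := by
    rintro (h | ⟨k, hk, hE⟩)
    · exact h1 h
    · by_cases hkj : k = j
      · subst hkj; exact h12 (Ne.symm hk) hE.symm
      · rw [hother k hk hkj] at hE; exact hr1 k hE
  have hgj : ¬ rrBad E' j := by
    rintro (h | ⟨k, hk, hE⟩)
    · exact h2 h
    · by_cases hki : k = i
      · subst hki; exact h12 hk hE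
      · rw [hother k hki hk] at hE; exact hr2 k hE
  apply Finset.card_lt_card
  rw [Finset.ssubset_iff_of_subset]
  · exact ⟨i, by simpa using hi, by simpa using hgi⟩
  · intro k hk
    simp only [Finset.mem_filter, Finset.mem_univ, true_and] at hk ⊢
    have hki : k ≠ i := fun h => hgi (h ▸ hk)
    have hkj : k ≠ j := fun h => hgj (h ▸ hk)
    rcases hk with h | ⟨l, hl, hE⟩
    · left; rwa [hother k hki hkj] at h
    · right
      rw [hother k hki hkj] at hE
      have hli : l ≠ i := fun h => hr1 k (by rw [← hE, h])
      have hlj : l ≠ j := fun h => hr2 k (by rw [← hE, h])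
      exact ⟨l, hl, by rw [← hother l hli hlj, hE]⟩

noncomputable def rrNb {n d M : ℕ} (σ : RRCfg n d M) (v : Fin n) : Finset (Fin n) :=
  Finset.univ.image (fun j : Fin d => (σ ((σ.symm (v, j)).1, (σ.symm (v,j)).2 + 1)).1)

lemma rr_mem_nb {n d M : ℕ} (σ : RRCfg n d M) (v x : Fin n) (i : Fin M)
    (hi : rrE σ i = s(v, x)) : x ∈ rrNb σ v := by
  rw [rrNb, Finset.mem_image]
  have hcase : ∃ b : Fin 2, (σ (i,b)).1 = v ∧ (σ (i,b+1)).1 = x := by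
    simp only [rrE, Sym2.eq_iff] at hi
    rcases hi with ⟨h1, h2⟩ | ⟨h1, h2⟩
    · exact ⟨0, h1, by simpa using h2⟩
    · exact ⟨1, h2, by simpa using h1⟩
  obtain ⟨b, hb1, hb2⟩ := hcase
  refine ⟨(σ (i,b)).2, Finset.mem_univ _, ?_⟩
  have : σ.symm (v, (σ (i,b)).2) = (i,b) := by
    rw [← hb1, Prod.mk.eta]; simp
  rw [this, hb2]

lemma rr_switch {n d M : ℕ} (σ : RRCfg n d M) (K : ℕ) (hM : K + (2 * d + 2) * d < M)
    (hD : rrD σ ≤ K) (hD0 : 0 < rrD σ) :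
    ∃ s t : Fin M × Fin 2, rrD ((Equiv.swap s t).trans σ) < rrD σ := by
  obtain ⟨i, hi⟩ := Finset.card_pos.1 hD0
  have hi := (Finset.mem_filter.1 hi).2
  obtain ⟨u, hu⟩ : ∃ u, (σ (i,0)).1 = u := ⟨_, rfl⟩
  obtain ⟨v, hv⟩ : ∃ v, (σ (i,1)).1 = v := ⟨_, rfl⟩
  set X : Finset (Fin n) := {u, v} ∪ (rrNb σ u ∪ rrNb σ v) with hX
  have hnb : ∀ v, (rrNb σ v).card ≤ d := fun v => by
    refine Finset.card_image_le.trans ?_; simp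
  have hXc : X.card ≤ 2 * d + 2 := by
    rw [hX]
    refine (Finset.card_union_le _ _).trans ?_
    have h2 := Finset.card_union_le (rrNb σ u) (rrNb σ v)
    have h3 := Finset.card_le_two (a := u) (b := v)
    have h4 := hnb u
    have h5 := hnb v
    omega
  set Y : Finset (Fin M) := ((X ×ˢ (Finset.univ : Finset (Fin d))).image
    (fun p => (σ.symm p).1)) ∪ Finset.univ.filter (rrBad (rrE σ)) with hY
  have hYc : Y.card < Fintype.card (Fin M) := by
    rw [Fintype.card_fin]
    refine (Finset.card_union_le _ _).trans_lt ?_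
    have h1 : ((X ×ˢ (Finset.univ : Finset (Fin d))).image
      (fun p => (σ.symm p).1)).card ≤ (2 * d + 2) * d := by
      refine Finset.card_image_le.trans ?_
      rw [Finset.card_product, Finset.card_univ, Fintype.card_fin]
      exact Nat.mul_le_mul_right _ hXc
    have h2 : (Finset.univ.filter (rrBad (rrE σ))).card ≤ K := hD
    omega
  obtain ⟨j, hj⟩ : ∃ j, j ∉ Y := by
    by_contra hcon
    push Not at hcon
    rw [Finset.eq_univ_iff_forall.2 hcon, Finset.card_univ] at hYc
    exact lt_irrefl _ hYc
  rw [hY, Finset.mem_union, not_or] at hj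
  obtain ⟨hj1, hj2⟩ := hj
  have hjX : ∀ b, (σ (j,b)).1 ∉ X := by
    intro b hb
    apply hj1
    rw [Finset.mem_image]
    exact ⟨σ (j,b), by simp [hb], by simp⟩
  have hjbad : ¬ rrBad (rrE σ) j := by simpa using hj2
  obtain ⟨x, hx⟩ : ∃ x, (σ (j,0)).1 = x := ⟨_, rfl⟩
  obtain ⟨y, hy⟩ : ∃ y, (σ (j,1)).1 = y := ⟨_, rfl⟩
  have hxX : x ∉ X := hx ▸ hjX 0
  have hyX : y ∉ X := hy ▸ hjX 1
  simp only [hX, Finset.mem_union, Finset.mem_insert, Finset.mem_singleton, not_or] at hxX hyX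
  have hij : i ≠ j := fun h => hjbad (h ▸ hi)
  have hxy : x ≠ y := fun h => hjbad (Or.inl (by
    rw [rrE, hx, hy, Sym2.mk_isDiag_iff]; exact h))
  refine ⟨(i,1), (j,0), ?_⟩
  have e1 : rrE ((Equiv.swap ((i,1) : Fin M × Fin 2) (j,0)).trans σ) i = s(u, x) := by
    rw [rrE, Equiv.trans_apply, Equiv.trans_apply, Equiv.swap_apply_left,
      Equiv.swap_apply_of_ne_of_ne (by simp) (by simp [hij]), hu, hx]
  have e2 : rrE ((Equiv.swap ((i,1) : Fin M × Fin 2) (j,0)).trans σ) j = s(v, y) := by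
    rw [rrE, Equiv.trans_apply, Equiv.trans_apply, Equiv.swap_apply_right,
      Equiv.swap_apply_of_ne_of_ne (by simp [hij.symm]) (by simp), hv, hy]
  refine rr_bad_lt _ _ i j ?_ ?_ ?_ ?_ ?_ ?_ hi
  · intro k hki hkj
    rw [rrE, Equiv.trans_apply, Equiv.trans_apply,
      Equiv.swap_apply_of_ne_of_ne (by simp [hki]) (by simp [hkj]),
      Equiv.swap_apply_of_ne_of_ne (by simp [hki]) (by simp [hkj]), rrE]
  · rw [e1, Sym2.mk_isDiag_iff]; exact fun h => hxX.1.1 h.symm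
  · rw [e2, Sym2.mk_isDiag_iff]; exact fun h => hyX.1.2 h.symm
  · intro _ h
    rw [e1, e2, Sym2.eq_iff] at h
    rcases h with ⟨_, h⟩ | ⟨_, h⟩
    · exact hxy h
    · exact hxX.1.2 h
  · intro k hk
    rw [e1] at hk
    exact hxX.2.1 (rr_mem_nb σ u x k hk)
  · intro k hk
    rw [e2] at hk
    exact hyX.2.2 (rr_mem_nb σ v y k hk)

lemma rr_switch_count {n d M : ℕ} (K : ℕ) (hM : K + (2 * d + 2) * d < M) (k : ℕ) (hk : k ≤ K) :
    (Finset.univ.filter (fun σ : RRCfg n d M => rrD σ ≤ k)).card ≤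
      ((2 * M) ^ 2) ^ k * (Finset.univ.filter (fun σ : RRCfg n d M => rrSimple σ)).card := by
  induction k with
  | zero =>
    rw [pow_zero, one_mul]
    refine Finset.card_le_card fun σ hσ => ?_
    simp only [Finset.mem_filter, Finset.mem_univ, true_and, Nat.le_zero] at hσ ⊢
    exact rr_simple_of_D σ hσ
  | succ k ih =>
    have h1 : Finset.univ.filter (fun σ : RRCfg n d M => rrD σ ≤ k + 1) ⊆
        (((Finset.univ : Finset ((Fin M × Fin 2) × (Fin M × Fin 2))) ×ˢ
          Finset.univ.filter (fun σ : RRCfg n d M => rrD σ ≤ k))).image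
          (fun q => (Equiv.swap q.1.1 q.1.2).trans q.2) := by
      intro σ hσ
      have hσ := (Finset.mem_filter.1 hσ).2
      rw [Finset.mem_image]
      by_cases h0 : rrD σ = 0
      · have hM0 : 0 < M := by omega
        refine ⟨((((⟨0, hM0⟩, 0)), ((⟨0, hM0⟩, 0))), σ), ?_, ?_⟩
        · simp [h0]
        · ext1 s; simp
      · obtain ⟨s, t, hst⟩ := rr_switch σ K hM (by omega) (by omega)
        refine ⟨((s, t), (Equiv.swap s t).trans σ), ?_, ?_⟩
        · simp only [Finset.mem_product, Finset.mem_univ, Finset.mem_filter, true_and]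
          omega
        · ext1 r; simp
    refine (Finset.card_le_card h1).trans (Finset.card_image_le.trans ?_)
    rw [Finset.card_product, Finset.card_univ, pow_succ, mul_comm _ ((2*M)^2), mul_assoc]
    refine Nat.mul_le_mul (le_of_eq ?_) (ih (by omega))
    simp; ring
end RR

section RR
open scoped Classical

lemma rr_loop_count {n d M : ℕ} (i : Fin M) :
    (Finset.univ.filter (fun σ : RRCfg n d M => (rrE σ i).IsDiag)).card ≤
      (n * d * d) * (n * d - 2).factorial := by
  have hsub : Finset.univ.filter (fun σ : RRCfg n d M => (rrE σ i).IsDiag) ⊆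
      (Finset.univ : Finset ((Fin n × Fin d) × Fin d)).biUnion
        (fun q => Finset.univ.filter (fun σ : RRCfg n d M =>
          ∀ j : Fin 2, σ (i, j) = (![q.1, (q.1.1, q.2)] : Fin 2 → Fin n × Fin d) j)) := by
    intro σ hσ
    have h := (Finset.mem_filter.1 hσ).2
    rw [rrE, Sym2.mk_isDiag_iff] at h
    rw [Finset.mem_biUnion]
    refine ⟨(σ (i,0), (σ (i,1)).2), Finset.mem_univ _, ?_⟩
    rw [Finset.mem_filter]
    refine ⟨Finset.mem_univ _, fun j => ?_⟩
    fin_cases j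
    · simp
    · simp [h]
  refine (Finset.card_le_card hsub).trans ?_
  refine (Finset.card_biUnion_le_card_mul _ _ (n * d - 2).factorial ?_).trans (le_of_eq ?_)
  · intro q _
    have := rr_card_prescribed 2 (fun j : Fin 2 => ((i, j) : Fin M × Fin 2))
      (fun a b h => (Prod.ext_iff.1 h).2) ![q.1, (q.1.1, q.2)]
    simpa using this
  · simp

lemma rr_par_count {n d M : ℕ} (i j : Fin M) (hij : j ≠ i) :
    (Finset.univ.filter (fun σ : RRCfg n d M => rrE σ j = rrE σ i)).card ≤
      ((n * d) * (n * d) * (d * d) * 2) * (n * d - 4).factorial := by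
  let b : ((Fin n × Fin d) × (Fin n × Fin d)) × (Fin d × Fin d) × Bool → Fin 4 → Fin n × Fin d :=
    fun q => if q.2.2 then ![q.1.1, q.1.2, (q.1.1.1, q.2.1.1), (q.1.2.1, q.2.1.2)]
      else ![q.1.1, q.1.2, (q.1.2.1, q.2.1.1), (q.1.1.1, q.2.1.2)]
  let a : Fin 4 → Fin M × Fin 2 := ![(i,0),(i,1),(j,0),(j,1)]
  have ha : Function.Injective a := by
    intro x y h
    have := hij.symm
    fin_cases x <;> fin_cases y <;> simp_all [a]
  have hsub : Finset.univ.filter (fun σ : RRCfg n d M => rrE σ j = rrE σ i) ⊆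
      (Finset.univ : Finset (((Fin n × Fin d) × (Fin n × Fin d)) × (Fin d × Fin d) × Bool)).biUnion
        (fun q => Finset.univ.filter (fun σ : RRCfg n d M => ∀ k, σ (a k) = b q k)) := by
    intro σ hσ
    have h := (Finset.mem_filter.1 hσ).2
    rw [rrE, rrE, Sym2.eq_iff] at h
    rw [Finset.mem_biUnion]
    rcases h with ⟨h1, h2⟩ | ⟨h1, h2⟩
    · refine ⟨((σ (i,0), σ (i,1)), ((σ (j,0)).2, (σ (j,1)).2), true), Finset.mem_univ _, ?_⟩
      rw [Finset.mem_filter]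
      refine ⟨Finset.mem_univ _, fun k => ?_⟩
      fin_cases k
      · simp [a, b]
      · simp [a, b]
      · simp [a, b, ← h1]
      · simp [a, b, ← h2]
    · refine ⟨((σ (i,0), σ (i,1)), ((σ (j,0)).2, (σ (j,1)).2), false), Finset.mem_univ _, ?_⟩
      rw [Finset.mem_filter]
      refine ⟨Finset.mem_univ _, fun k => ?_⟩
      fin_cases k
      · simp [a, b]
      · simp [a, b]
      · simp [a, b, ← h1]
      · simp [a, b, ← h2]
  refine (Finset.card_le_card hsub).trans ?_
  refine (Finset.card_biUnion_le_card_mul _ _ (n * d - 4).factorial ?_).trans (le_of_eq ?_)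
  · intro q _
    have := rr_card_prescribed 4 a ha (b q)
    simpa using this
  · simp; left; ring

lemma rr_sum_D {n d M : ℕ} (hM : n * d = 2 * M) (h6 : 6 ≤ n * d) :
    ∑ σ : RRCfg n d M, rrD σ ≤ (d + 4 * d ^ 2) * (n * d).factorial := by
  have h1 : ∑ σ : RRCfg n d M, rrD σ =
      ∑ i : Fin M, (Finset.univ.filter (fun σ : RRCfg n d M => rrBad (rrE σ) i)).card := by
    simp only [rrD, Finset.card_filter]
    exact Finset.sum_comm
  set N := n * d with hN
  have h2 : ∀ i : Fin M, (Finset.univ.filter (fun σ : RRCfg n d M => rrBad (rrE σ) i)).card ≤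
      N * d * (N - 2).factorial + M * ((N * N * (d * d) * 2) * (N - 4).factorial) := by
    intro i
    have hsub : Finset.univ.filter (fun σ : RRCfg n d M => rrBad (rrE σ) i) ⊆
        Finset.univ.filter (fun σ : RRCfg n d M => (rrE σ i).IsDiag) ∪
        (Finset.univ.filter (fun j : Fin M => j ≠ i)).biUnion (fun j =>
          Finset.univ.filter (fun σ : RRCfg n d M => rrE σ j = rrE σ i)) := by
      intro σ hσ
      rcases (Finset.mem_filter.1 hσ).2 with h | ⟨j, hj, hE⟩
      · exact Finset.mem_union_left _ (by simpa using h)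
      · refine Finset.mem_union_right _ (Finset.mem_biUnion.2 ⟨j, by simpa using hj, by simpa using hE⟩)
    refine (Finset.card_le_card hsub).trans ((Finset.card_union_le _ _).trans ?_)
    refine Nat.add_le_add (rr_loop_count i) ?_
    refine (Finset.card_biUnion_le_card_mul _ _ ((N * N * (d * d) * 2) * (N - 4).factorial) ?_).trans ?_
    · intro j hj
      exact rr_par_count i j (by simpa using hj)
    · refine Nat.mul_le_mul_right _ ((Finset.card_filter_le _ _).trans ?_)
      simp
  rw [h1]
  refine (Finset.sum_le_sum fun i _ => h2 i).trans ?_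
  simp only [Finset.sum_const, Finset.card_univ, Fintype.card_fin, smul_eq_mul]
  clear h1 h2 hN
  clear_value N
  obtain ⟨r, rfl⟩ : ∃ r, N = r + 6 := ⟨N - 6, by omega⟩
  have f1 : r + 6 - 2 = r + 4 := by omega
  have f2 : r + 6 - 4 = r + 2 := by omega
  rw [f1, f2]
  have e1 : (r + 6).factorial = (r + 6) * (r + 5) * (r + 4).factorial := by
    simp [Nat.factorial_succ]; ring
  have e2 : (r + 6).factorial = (r + 6) * (r + 5) * (r + 4) * (r + 3) * (r + 2).factorial := by
    simp [Nat.factorial_succ]; ring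
  rw [mul_add M, add_mul d]
  refine Nat.add_le_add ?_ ?_
  · rw [e1]
    calc M * ((r + 6) * d * (r + 4).factorial) ≤ (r + 5) * ((r + 6) * d * (r + 4).factorial) :=
          Nat.mul_le_mul_right _ (by omega)
      _ = _ := by ring
  · rw [e2]
    have hq : M * M * (r + 6) * 2 ≤ 4 * ((r + 5) * (r + 4) * (r + 3)) := by
      have : r + 6 = 2 * M := hM
      obtain ⟨q, rfl⟩ : ∃ q, M = q + 3 := ⟨M - 3, by omega⟩
      have : r = 2 * q := by omega
      subst this
      nlinarith [Nat.zero_le q, Nat.zero_le (q*q), Nat.zero_le (q*q*q)]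
    calc M * (M * ((r + 6) * (r + 6) * (d * d) * 2 * (r + 2).factorial))
        = (M * M * (r + 6) * 2) * ((r + 6) * (d * d) * (r + 2).factorial) := by ring
      _ ≤ 4 * ((r + 5) * (r + 4) * (r + 3)) * ((r + 6) * (d * d) * (r + 2).factorial) :=
          Nat.mul_le_mul_right _ hq
      _ = _ := by ring

lemma rr_card_cfg {n d M : ℕ} (hM : n * d = 2 * M) :
    Fintype.card (RRCfg n d M) = (n * d).factorial := by
  have e : (Fin M × Fin 2) ≃ (Fin n × Fin d) := Fintype.equivOfCardEq (by simp [hM, mul_comm])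
  rw [Fintype.card_equiv e]
  simp [hM, mul_comm]

lemma rr_simple_count {n d M : ℕ} (hd : 0 < d) (hM : n * d = 2 * M) (h6 : 6 ≤ n * d)
    (hbig : 2 * (d + 4 * d ^ 2) + (2 * d + 2) * d < M) :
    (n * d).factorial ≤ 2 * ((n * d) ^ 2) ^ (2 * (d + 4 * d ^ 2)) *
      (Finset.univ.filter (fun σ : RRCfg n d M => rrSimple σ)).card := by
  set c := d + 4 * d ^ 2 with hc
  have hc0 : 0 < c := by positivity
  have h1 := rr_switch_count (n := n) (d := d) (M := M) (2 * c) hbig (2 * c) le_rfl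
  have h2 := rr_sum_D (n := n) (d := d) hM h6
  have h3 : (Finset.univ.filter (fun σ : RRCfg n d M => ¬ rrD σ ≤ 2 * c)).card * (2 * c) ≤
      ∑ σ : RRCfg n d M, rrD σ := by
    rw [← smul_eq_mul]
    refine (Finset.card_nsmul_le_sum _ (fun σ => rrD σ) _ ?_).trans
      (Finset.sum_le_sum_of_subset (Finset.filter_subset _ _))
    intro σ hσ
    have := (Finset.mem_filter.1 hσ).2
    omega
  have h4 : (Finset.univ.filter (fun σ : RRCfg n d M => ¬ rrD σ ≤ 2 * c)).card * 2
      ≤ (n * d).factorial := by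
    have := h3.trans h2
    refine Nat.le_of_mul_le_mul_left (c := c) ?_ hc0
    calc _ = _ := by ring
      _ ≤ _ := this
  have h5 := Finset.card_filter_add_card_filter_not (s := (Finset.univ : Finset (RRCfg n d M))) (fun σ => rrD σ ≤ 2 * c)
  rw [Finset.card_univ, rr_card_cfg hM] at h5
  rw [← hM] at h1
  rw [mul_assoc]
  omega
end RR

section RR
open scoped Classical

noncomputable def rrReg (n d : ℕ) : Finset (SimpleGraph (Fin n)) :=
  Finset.univ.filter (fun G => ∀ v, G.degree v = d)

def rrHole {n : ℕ} (m : ℕ) (G : SimpleGraph (Fin n)) : Prop :=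
  ∃ A B : Finset (Fin n), A.card = m ∧ B.card = m ∧ Disjoint A B ∧
      ∀ a ∈ A, ∀ b ∈ B, ¬ G.Adj a b

def rrCl {n d : ℕ} (A B : Finset (Fin n)) (p : Fin n × Fin d) : Fin 3 :=
  if p.1 ∈ A then 0 else if p.1 ∈ B then 1 else 2

lemma rrCl_zero {n d : ℕ} (A B : Finset (Fin n)) (p : Fin n × Fin d) :
    rrCl A B p = 0 ↔ p.1 ∈ A := by
  unfold rrCl; split_ifs <;> simp_all

lemma rrCl_one {n d : ℕ} (A B : Finset (Fin n)) (h : Disjoint A B) (p : Fin n × Fin d) :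
    rrCl A B p = 1 ↔ p.1 ∈ B := by
  unfold rrCl
  have : p.1 ∈ A → p.1 ∉ B := fun hA => Finset.disjoint_left.1 h hA
  split_ifs <;> simp_all

lemma rr_card_pts {n d : ℕ} (A : Finset (Fin n)) :
    (Finset.univ.filter (fun p : Fin n × Fin d => p.1 ∈ A)).card = A.card * d := by
  have : (Finset.univ.filter (fun p : Fin n × Fin d => p.1 ∈ A)) = A ×ˢ Finset.univ := by
    ext p; simp
  rw [this]; simp

noncomputable def rrNo {n d M : ℕ} (A B : Finset (Fin n)) : Finset (RRCfg n d M) :=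
  Finset.univ.filter (fun σ : (Fin M × Fin 2) ≃ (Fin n × Fin d) => ∀ i : Fin M,
      ¬ (rrCl A B (σ (i,0)) = 0 ∧ rrCl A B (σ (i,1)) = 1) ∧
      ¬ (rrCl A B (σ (i,0)) = 1 ∧ rrCl A B (σ (i,1)) = 0))

lemma rr_no_card {n d M m : ℕ} (hn : 0 < n) (hd : 0 < d) (A B : Finset (Fin n))
    (hA : A.card = m) (hB : B.card = m) (hAB : Disjoint A B) :
    ((rrNo A B : Finset (RRCfg n d M)).card : ℝ) ≤
      (n * d).factorial * (Real.exp 1 * (n * d + 1)) ^ 3 * (1 - 2 * (m / n : ℝ) ^ 2) ^ M := by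
  have hn' : (0:ℝ) < n := by exact_mod_cast hn
  have hd' : (0:ℝ) < d := by exact_mod_cast hd
  have h := rr_noAB M (rrCl A B : Fin n × Fin d → Fin 3) (by simp; exact ⟨hn, hd⟩) (m / n : ℝ) (m / n : ℝ)
    (by
      rw [Fintype.card_subtype]
      simp only [rrCl_zero]
      rw [rr_card_pts, hA]
      simp; field_simp)
    (by
      rw [Fintype.card_subtype]
      simp only [rrCl_one A B hAB]
      rw [rr_card_pts, hB]
      simp; field_simp)
  rw [← pow_two] at h
  simp only [Fintype.card_prod, Fintype.card_fin, Nat.cast_mul] at h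
  exact h

lemma rr_main_bound {n d M m : ℕ} (hd : 0 < d) (hM : n * d = 2 * M) (h6 : 6 ≤ n * d)
    (hbig : 2 * (d + 4 * d ^ 2) + (2 * d + 2) * d < M) (hm : 2 * m ≤ n) :
    0 < (rrReg n d).card ∧ (((rrReg n d).filter (rrHole m)).card : ℝ) ≤ (rrReg n d).card *
      (2 * (((n * d : ℕ) : ℝ) ^ 2) ^ (2 * (d + 4 * d ^ 2)) * (n.choose m : ℝ) ^ 2 *
        (Real.exp 1 * (n * d + 1)) ^ 3 * (1 - 2 * (m / n : ℝ) ^ 2) ^ M) := by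
  have hn : 0 < n := by
    rcases Nat.eq_zero_or_pos n with h | h
    · subst h; simp at h6
    · exact h
  set L := M.factorial * 2 ^ M * d.factorial ^ n with hL
  have hL0 : 0 < L := by positivity
  set Rep : SimpleGraph (Fin n) → Finset (RRCfg n d M) := fun G =>
    Finset.univ.filter (fun σ : RRCfg n d M => rrRep G σ) with hRep
  have hRepc : ∀ G ∈ rrReg n d, (Rep G).card = L := fun G hG =>
    rr_card_rep G (Finset.mem_filter.1 hG).2 hM
  set S := (Finset.univ.filter (fun σ : RRCfg n d M => rrSimple σ)).card with hS
  have hsimple : S ≤ (rrReg n d).card * L := by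
    have hsub : Finset.univ.filter (fun σ : RRCfg n d M => rrSimple σ) ⊆ (rrReg n d).biUnion Rep := by
      intro σ hσ
      obtain ⟨G, hG, hr⟩ := rr_simple_rep σ (Finset.mem_filter.1 hσ).2
      exact Finset.mem_biUnion.2 ⟨G, Finset.mem_filter.2 ⟨Finset.mem_univ _, hG⟩,
        Finset.mem_filter.2 ⟨Finset.mem_univ _, hr⟩⟩
    exact (Finset.card_le_card hsub).trans
      (Finset.card_biUnion_le_card_mul _ _ _ fun G hG => (hRepc G hG).le)
  have hcount := rr_simple_count (n := n) hd hM h6 hbig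
  rw [← hS] at hcount
  have hfac : 0 < (n * d).factorial := Nat.factorial_pos _
  have hTpos : 0 < (rrReg n d).card := by
    rcases Nat.eq_zero_or_pos (rrReg n d).card with h | h
    · rw [h, zero_mul, Nat.le_zero] at hsimple
      rw [hsimple] at hcount
      simp at hcount
      omega
    · exact h
  refine ⟨hTpos, ?_⟩
  set R : ℝ := (Real.exp 1 * (n * d + 1)) ^ 3 * (1 - 2 * (m / n : ℝ) ^ 2) ^ M with hR
  have hR0 : 0 ≤ R := by
    have hn' : (0:ℝ) < n := by exact_mod_cast hn
    have hx : (m / n : ℝ) ≤ 1 / 2 := by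
      rw [div_le_div_iff₀ hn' (by norm_num)]
      have : (2 * m : ℝ) ≤ n := by exact_mod_cast hm
      linarith
    have hx0 : (0:ℝ) ≤ m / n := by positivity
    have : (0:ℝ) ≤ 1 - 2 * (m / n : ℝ) ^ 2 := by nlinarith
    positivity
  have hbad : ((((rrReg n d).filter (rrHole m)).card * L : ℕ) : ℝ) ≤
      (n.choose m : ℝ) ^ 2 * ((n * d).factorial * R) := by
    have hsub : ((rrReg n d).filter (rrHole m)).biUnion Rep ⊆
        (((Finset.univ.powersetCard m ×ˢ Finset.univ.powersetCard m :
          Finset (Finset (Fin n) × Finset (Fin n)))).filter (fun q => Disjoint q.1 q.2)).biUnion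
          (fun q => rrNo q.1 q.2) := by
      intro σ hσ
      obtain ⟨G, hG, hr⟩ := Finset.mem_biUnion.1 hσ
      obtain ⟨hG1, A, B, hA, hB, hAB, hno⟩ := Finset.mem_filter.1 hG
      have hr := (Finset.mem_filter.1 hr).2
      refine Finset.mem_biUnion.2 ⟨(A, B), ?_, ?_⟩
      · simp [Finset.mem_powersetCard, hA, hB, hAB]
      · refine Finset.mem_filter.2 ⟨Finset.mem_univ _, fun i => ⟨?_, ?_⟩⟩
        · rw [rrCl_zero, rrCl_one A B hAB]
          rintro ⟨h1, h2⟩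
          exact hno _ h1 _ h2 (hr.1 i)
        · rw [rrCl_zero, rrCl_one A B hAB]
          rintro ⟨h1, h2⟩
          exact hno _ h2 _ h1 (hr.1 i).symm
    have hcard : (((rrReg n d).filter (rrHole m)).biUnion Rep).card =
        ((rrReg n d).filter (rrHole m)).card * L := by
      rw [Finset.card_biUnion]
      · exact Finset.sum_const_nat fun G hG => hRepc G (Finset.mem_filter.1 hG).1
      · intro G hG G' hG' hne
        change Disjoint _ _
        rw [Finset.disjoint_left]
        intro σ h1 h2
        have hG := (Finset.mem_filter.1 (Finset.mem_filter.1 (Finset.mem_coe.1 hG)).1).2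
        have hG' := (Finset.mem_filter.1 (Finset.mem_filter.1 (Finset.mem_coe.1 hG')).1).2
        exact hne (rr_rep_unique G G' hG hG' hM σ (Finset.mem_filter.1 h1).2 (Finset.mem_filter.1 h2).2)
    rw [← hcard]
    have h1 := (Finset.card_le_card hsub).trans Finset.card_biUnion_le
    refine (Nat.cast_le.2 h1).trans ?_
    rw [Nat.cast_sum]
    refine (Finset.sum_le_card_nsmul _ _ ((n * d).factorial * R) ?_).trans ?_
    · intro q hq
      obtain ⟨hq1, hq2⟩ := Finset.mem_filter.1 hq
      rw [Finset.mem_product, Finset.mem_powersetCard, Finset.mem_powersetCard] at hq1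
      have := rr_no_card (M := M) hn hd q.1 q.2 hq1.1.2 hq1.2.2 hq2
      rw [hR, ← mul_assoc]
      exact this
    · rw [nsmul_eq_mul]
      refine mul_le_mul_of_nonneg_right ?_ (by positivity)
      have : (((Finset.univ.powersetCard m ×ˢ Finset.univ.powersetCard m :
          Finset (Finset (Fin n) × Finset (Fin n)))).filter (fun q => Disjoint q.1 q.2)).card ≤
          (n.choose m) ^ 2 := by
        refine (Finset.card_filter_le _ _).trans ?_
        simp [Finset.card_product, Finset.card_powersetCard, pow_two]
      exact_mod_cast this
  have hfac2 : ((n * d).factorial : ℝ) ≤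
      2 * (((n * d : ℕ) : ℝ) ^ 2) ^ (2 * (d + 4 * d ^ 2)) * ((rrReg n d).card * L) := by
    exact_mod_cast hcount.trans (Nat.mul_le_mul_left _ hsimple)
  have hLR : (0:ℝ) < L := by exact_mod_cast hL0
  refine le_of_mul_le_mul_right ?_ hLR
  rw [Nat.cast_mul] at hbad
  refine hbad.trans ?_
  have h7 := mul_le_mul_of_nonneg_left (mul_le_mul_of_nonneg_right hfac2 hR0)
    (by positivity : (0:ℝ) ≤ (n.choose m : ℝ) ^ 2)
  refine h7.trans (le_of_eq ?_)
  rw [hR]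
  ring
end RR

section RR
open scoped Classical

lemma rr_choose_le (n m : ℕ) (hm : 0 < m) (hmn : m ≤ n) :
    (n.choose m : ℝ) ≤ Real.exp (m * (1 - Real.log (m / n))) := by
  have hm' : (0:ℝ) < m := by exact_mod_cast hm
  have hn' : (0:ℝ) < n := by exact_mod_cast hm.trans_le hmn
  have h1 : (n.choose m : ℝ) ≤ (n:ℝ) ^ m / m.factorial := Nat.choose_le_pow_div m n
  have h2 := rr_pow_le_factorial m
  have h3 : Real.exp (m * (1 - Real.log (m / n))) = Real.exp m * ((n:ℝ) ^ m / (m:ℝ)^m) := by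
    rw [mul_sub, mul_one, Real.exp_sub, mul_comm (m:ℝ) (Real.log _), Real.exp_mul, Real.exp_log (by positivity),
      Real.rpow_natCast, div_pow]
    field_simp
  rw [h3]
  refine h1.trans ?_
  have hf : (0:ℝ) < m.factorial := by positivity
  rw [← mul_div_assoc, div_le_div_iff₀ hf (by positivity)]
  calc (n:ℝ)^m * (m:ℝ)^m ≤ (n:ℝ)^m * (m.factorial * Real.exp m) := by gcongr
    _ = _ := by ring

lemma rr_exp_bound (n d M m : ℕ) (hM : n * d = 2 * M) (hm : 0 < m) (hmn : 2 * m ≤ n)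
    (ε : ℝ) (hε : 0 < ε) (hl1 : 1 ≤ Real.log d) (hl3 : 3 ≤ ε * Real.log d)
    (hx : (2 + ε) * Real.log d / d ≤ (m : ℝ) / n) :
    (n.choose m : ℝ) ^ 2 * (1 - 2 * (m / n : ℝ) ^ 2) ^ M ≤ Real.exp (-m) := by
  have hm' : (0:ℝ) < m := by exact_mod_cast hm
  have hn : 0 < n := by omega
  have hn' : (0:ℝ) < n := by exact_mod_cast hn
  have hd : 0 < d := by
    rcases Nat.eq_zero_or_pos d with h | h
    · subst h; simp at hl1; linarith
    · exact h
  have hd' : (0:ℝ) < d := by exact_mod_cast hd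
  obtain ⟨x, hxd⟩ : ∃ x : ℝ, x = (m:ℝ) / n := ⟨_, rfl⟩
  have hmx : (m:ℝ) = x * n := by rw [hxd]; field_simp
  have hx2 : x ≤ 1 / 2 := by
    rw [hxd, div_le_div_iff₀ hn' (by norm_num)]
    have : (2 * m : ℝ) ≤ n := by exact_mod_cast hmn
    linarith
  have hx0 : 0 < x := by rw [hxd]; positivity
  have h1 := rr_choose_le n m hm (by omega)
  rw [← hxd] at h1 hx ⊢
  have h2 : (1 - 2 * x ^ 2) ^ M ≤ Real.exp (-(d * m * x)) := by
    have h3 : 1 - 2 * x ^ 2 ≤ Real.exp (-(2 * x ^ 2)) := by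
      have := Real.add_one_le_exp (-(2 * x ^ 2)); linarith
    have h4 : 0 ≤ 1 - 2 * x ^ 2 := by nlinarith
    refine (pow_le_pow_left₀ h4 h3 M).trans (le_of_eq ?_)
    rw [← Real.exp_nat_mul]
    congr 1
    have : (n * d : ℝ) = 2 * M := by exact_mod_cast hM
    rw [hmx]
    linear_combination (x^2) * this
  have hlog : -Real.log x ≤ Real.log d := by
    have hle : 1 / (d:ℝ) ≤ x := by
      refine le_trans ?_ hx
      gcongr
      nlinarith
    have := Real.log_le_log (by positivity) hle
    rw [one_div, Real.log_inv] at this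
    linarith
  have hdx : (2 + ε) * Real.log d ≤ d * x := by
    rw [div_le_iff₀ hd'] at hx; linarith
  calc (n.choose m : ℝ) ^ 2 * (1 - 2 * x ^ 2) ^ M
      ≤ (Real.exp (m * (1 - Real.log x))) ^ 2 * Real.exp (-(d * m * x)) := by
        gcongr
        exact pow_nonneg (by nlinarith) _
    _ = Real.exp (m * (2 - 2 * Real.log x - d * x)) := by
        rw [← Real.exp_nat_mul, ← Real.exp_add]; congr 1; push_cast; ring
    _ ≤ Real.exp (-m) := by
        apply Real.exp_le_exp.2
        nlinarith

lemma rr_prop_bounds (d n : ℕ) (P : SimpleGraph (Fin n) → Prop) (m : ℕ) (f : ℝ)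
    (hP : ∀ G, ¬ P G → rrHole m G) (h0 : 0 < (rrReg n d).card)
    (hf : (((rrReg n d).filter (rrHole m)).card : ℝ) ≤ (rrReg n d).card * f) :
    1 - f ≤ regularProportion d n P ∧ regularProportion d n P ≤ 1 := by
  have e1 : Nat.card {G : SimpleGraph (Fin n) // G.IsRegularOfDegree d} = (rrReg n d).card := by
    rw [Nat.card_eq_fintype_card, Fintype.card_subtype, rrReg]
    congr!
  have e2 : Nat.card {G : SimpleGraph (Fin n) // G.IsRegularOfDegree d ∧ P G} =
      ((rrReg n d).filter P).card := by
    rw [Nat.card_eq_fintype_card, Fintype.card_subtype, rrReg, Finset.filter_filter]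
    congr!
  have e3 : regularProportion d n P = (((rrReg n d).filter P).card : ℝ) / (rrReg n d).card := by
    rw [← e1, ← e2]; rfl
  have h0' : (0:ℝ) < (rrReg n d).card := by exact_mod_cast h0
  have h1 := Finset.card_filter_add_card_filter_not (s := rrReg n d) P
  have h2 : ((rrReg n d).filter (fun G => ¬ P G)).card ≤ ((rrReg n d).filter (rrHole m)).card :=
    Finset.card_le_card (Finset.monotone_filter_right _ (fun G _ => hP G))
  have h1' : ((((rrReg n d).filter P).card : ℝ)) + ((rrReg n d).filter (fun G => ¬ P G)).card =
    (rrReg n d).card := by exact_mod_cast h1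
  have h2' : (((rrReg n d).filter (fun G => ¬ P G)).card : ℝ) ≤ ((rrReg n d).filter (rrHole m)).card := by
    exact_mod_cast h2
  rw [e3]
  constructor
  · rw [le_div_iff₀ h0']; nlinarith
  · rw [div_le_one h0']
    have : (0:ℝ) ≤ ((rrReg n d).filter (fun G => ¬ P G)).card := by positivity
    linarith

lemma rr_tendsto (C γ : ℝ) (hγ : 0 < γ) (d k : ℕ) (hd : 0 < d) :
    Filter.Tendsto (fun n : ℕ => C * ((n:ℝ) * d + 1) ^ k * Real.exp (-(γ * n)))
      Filter.atTop (nhds 0) := by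
  have hd' : (0:ℝ) < d := by exact_mod_cast hd
  have h1 := Real.tendsto_pow_mul_exp_neg_atTop_nhds_zero k
  have h2 : Filter.Tendsto (fun n : ℕ => γ / d * ((n:ℝ) * d + 1)) Filter.atTop Filter.atTop := by
    refine Filter.Tendsto.const_mul_atTop (by positivity) ?_
    refine Filter.tendsto_atTop_add_const_right _ _ ?_
    exact Filter.Tendsto.atTop_mul_const hd' tendsto_natCast_atTop_atTop
  have h3 := ((h1.comp h2).const_mul (C * (d / γ) ^ k * Real.exp (γ / d)))
  rw [mul_zero] at h3
  refine h3.congr fun n => ?_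
  simp only [Function.comp]
  have e1 : Real.exp (-(γ / d * ((n:ℝ) * d + 1))) = Real.exp (-(γ * n)) * (Real.exp (γ / d))⁻¹ := by
    rw [← Real.exp_neg, ← Real.exp_add]; congr 1; field_simp; ring
  rw [e1, mul_pow]
  have e2 : (d / γ) ^ k * (γ / d) ^ k = 1 := by
    rw [← mul_pow]; field_simp; simp
  have e3 : Real.exp (γ / d) * (Real.exp (γ / d))⁻¹ = 1 := mul_inv_cancel₀ (Real.exp_ne_zero _)
  calc _ = C * ((n:ℝ) * d + 1) ^ k * Real.exp (-(γ * n)) * ((d / γ) ^ k * (γ / d) ^ k) *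
        (Real.exp (γ / d) * (Real.exp (γ / d))⁻¹) := by ring
    _ = _ := by rw [e2, e3]; ring

lemma rr_d0 (ε : ℝ) (hε : 0 < ε) : ∃ d₀ : ℕ, ∀ d : ℕ, d₀ ≤ d → 0 < d ∧ 1 ≤ Real.log d ∧
    3 ≤ ε * Real.log d ∧ (1 + ε) * (4 * Real.log d) / d ≤ 1 := by
  have hl : Filter.Tendsto (fun d : ℕ => Real.log d) Filter.atTop Filter.atTop :=
    Real.tendsto_log_atTop.comp tendsto_natCast_atTop_atTop
  have h1 := hl.eventually_ge_atTop 1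
  have h2 := hl.eventually_ge_atTop (3 / ε)
  have h3 : Filter.Tendsto (fun d : ℕ => Real.log d / d) Filter.atTop (nhds 0) :=
    (Real.isLittleO_log_id_atTop.tendsto_div_nhds_zero).comp tendsto_natCast_atTop_atTop
  have h4 := h3.eventually_le_const (show (0:ℝ) < 1 / ((1 + ε) * 4) by positivity)
  obtain ⟨d₀, h⟩ := Filter.eventually_atTop.1
    ((((Filter.eventually_gt_atTop (0:ℕ)).and h1).and h2).and h4)
  refine ⟨d₀, fun d hd => ?_⟩
  obtain ⟨⟨⟨a, b⟩, c⟩, e⟩ := h d hd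
  refine ⟨a, b, ?_, ?_⟩
  · rw [div_le_iff₀ hε] at c; linarith
  · rw [le_div_iff₀ (by positivity)] at e
    calc _ = Real.log d / d * ((1 + ε) * 4) := by ring
      _ ≤ 1 := e
end RR

/-- For every `ε > 0` there is `d₀` such that for every fixed `d ≥ d₀`, a.a.s. (as
`n → ∞` along `n` with `dn` even) a uniformly random simple `d`-regular graph `G` on `n`
labelled vertices satisfies `Z(G) ≥ n (1 − (1+ε) · 4 log d / d)`. -/
theorem aas_zeroForcing_lower (ε : ℝ) (hε : 0 < ε) :
    ∃ d₀ : ℕ, ∀ d : ℕ, d₀ ≤ d →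
      Filter.Tendsto
        (fun n : ℕ => regularProportion d n fun G =>
          n * (1 - (1 + ε) * (4 * Real.log d) / d) ≤ (zeroForcingNumber G : ℝ))
        (Filter.atTop ⊓ Filter.principal {n : ℕ | Even (d * n)}) (nhds 1) := by
  obtain ⟨d₀, hd₀⟩ := rr_d0 ε hε
  refine ⟨d₀, fun d hdd => ?_⟩
  obtain ⟨hd, hl1, hl3, hβ1⟩ := hd₀ d hdd
  have hd' : (0:ℝ) < d := by exact_mod_cast hd
  obtain ⟨γ, hγ⟩ : ∃ γ : ℝ, γ = (2 + ε) * Real.log d / d := ⟨_, rfl⟩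
  obtain ⟨β, hβ⟩ : ∃ β : ℝ, β = (1 + ε) * (4 * Real.log d) / d := ⟨_, rfl⟩
  obtain ⟨δ, hδ⟩ : ∃ δ : ℝ, δ = ε * Real.log d / d := ⟨_, rfl⟩
  have hβγ : β / 2 = γ + δ := by rw [hβ, hγ, hδ]; ring
  have hlp : 0 < Real.log d := by linarith
  have hγ0 : 0 < γ := by rw [hγ]; positivity
  have hδ0 : 0 < δ := by rw [hδ]; positivity
  rw [← hβ] at hβ1 ⊢
  set c := d + 4 * d ^ 2 with hc
  set C : ℝ := 2 * Real.exp 1 ^ 3 with hC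
  have hlim : Filter.Tendsto (fun n : ℕ => 1 - C * ((n:ℝ) * d + 1) ^ (4 * c + 3) * Real.exp (-(γ * n)))
      (Filter.atTop ⊓ Filter.principal {n : ℕ | Even (d * n)}) (nhds 1) := by
    have := (rr_tendsto C γ hγ0 d (4 * c + 3) hd).const_sub 1
    rw [sub_zero] at this
    exact this.mono_left inf_le_left
  have hev : ∀ᶠ n : ℕ in Filter.atTop ⊓ Filter.principal {n : ℕ | Even (d * n)},
      1 - C * ((n:ℝ) * d + 1) ^ (4 * c + 3) * Real.exp (-(γ * n)) ≤
        regularProportion d n (fun G => n * (1 - β) ≤ (zeroForcingNumber G : ℝ)) ∧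
      regularProportion d n (fun G => n * (1 - β) ≤ (zeroForcingNumber G : ℝ)) ≤ 1 := by
    rw [Filter.eventually_inf_principal]
    have hδn : ∀ᶠ n : ℕ in Filter.atTop, 1 ≤ δ * n :=
      (Filter.Tendsto.const_mul_atTop hδ0 tendsto_natCast_atTop_atTop).eventually_ge_atTop 1
    filter_upwards [hδn, Filter.eventually_ge_atTop (2 * (2 * c + (2 * d + 2) * d) + 6)]
      with n hn1 hn2 hev
    obtain ⟨M, hM⟩ := hev
    have hM : n * d = 2 * M := by rw [mul_comm, hM]; ring
    have hnd : n ≤ n * d := Nat.le_mul_of_pos_right n hd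
    have hn0 : 0 < n := by omega
    have hn0' : (0:ℝ) < n := by exact_mod_cast hn0
    set m := ⌊β / 2 * n⌋₊ with hm
    have hβn : 0 ≤ β / 2 * n := by rw [hβγ]; positivity
    have hm1 : (m:ℝ) ≤ β / 2 * n := Nat.floor_le hβn
    have hm2 : β / 2 * n < m + 1 := Nat.lt_floor_add_one _
    have hmγ : γ * n ≤ m := by rw [hβγ] at hm2; linarith
    have hm0 : 0 < m := by
      have : (0:ℝ) < m := lt_of_lt_of_le (by positivity) hmγ
      exact_mod_cast this
    have hmn : 2 * m ≤ n := by
      have : (2 * m : ℝ) ≤ n := by nlinarith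
      exact_mod_cast this
    obtain ⟨hT, hB⟩ := rr_main_bound (n := n) (d := d) (M := M) (m := m) hd hM (by omega)
      (by rw [← hc]; omega) hmn
    rw [← hc] at hB
    have hE := rr_exp_bound n d M m hM hm0 hmn ε hε hl1 hl3 (by
      rw [← hγ, le_div_iff₀ hn0']; exact hmγ)
    refine rr_prop_bounds d n _ m _ ?_ hT (hB.trans ?_)
    · intro G hG
      rw [not_le] at hG
      refine rr_zf_hole G m ?_
      have : (zeroForcingNumber G + 2 * m : ℝ) ≤ n := by linarith
      exact_mod_cast this
    · refine mul_le_mul_of_nonneg_left ?_ (by positivity)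
      have h1 : (((n * d : ℕ) : ℝ) ^ 2) ^ (2 * c) ≤ ((n:ℝ) * d + 1) ^ (4 * c) := by
        rw [← pow_mul, show 2 * (2 * c) = 4 * c by ring]
        push_cast
        gcongr
        linarith
      have h2 : Real.exp (-(m:ℝ)) ≤ Real.exp (-(γ * n)) := Real.exp_le_exp.2 (by linarith)
      calc _ = 2 * (((n * d : ℕ) : ℝ) ^ 2) ^ (2 * c) * (Real.exp 1 * (n * d + 1)) ^ 3 *
            ((n.choose m : ℝ) ^ 2 * (1 - 2 * (m / n : ℝ) ^ 2) ^ M) := by ring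
        _ ≤ 2 * ((n:ℝ) * d + 1) ^ (4 * c) * (Real.exp 1 * (n * d + 1)) ^ 3 * Real.exp (-(γ * n)) := by
            have := hE.trans h2
            have hmn' : (m / n : ℝ) ≤ 1 / 2 := by
              rw [div_le_iff₀ hn0']
              have : (2 * m : ℝ) ≤ n := by exact_mod_cast hmn
              linarith
            have hq0 : (0:ℝ) ≤ m / n := by positivity
            have hb0 : (0:ℝ) ≤ 1 - 2 * (m / n : ℝ) ^ 2 := by nlinarith
            have hnn : (0:ℝ) ≤ (n.choose m : ℝ) ^ 2 * (1 - 2 * (m / n : ℝ) ^ 2) ^ M :=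
              mul_nonneg (by positivity) (pow_nonneg hb0 M)
            gcongr
        _ = _ := by rw [hC]; ring
  exact tendsto_of_tendsto_of_tendsto_of_le_of_le' hlim tendsto_const_nhds
    (hev.mono fun _ h => h.1) (hev.mono fun _ h => h.2)
end

section
/- For every ε > 0 there exists d₀ such that for every fixed integer d ≥ d₀ the following holds: asymptotically almost surely, a uniformly random simple d-regular graph on n labelled vertices contains no q-bipartite hole with q = ⌈(1+ε)·(2 n log d)/d⌉; that is, the probability that there exist two disjoint sets of q vertices each with no edges between them tends to 0 as n → ∞ (along integers n with dn even). Here log denotes the natural logarithm. -/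
/-- `G` has a `q`-bipartite hole: two disjoint sets of `q` vertices each with no edges
of `G` between them. -/
def HasBipartiteHole {V : Type*} (G : SimpleGraph V) (q : ℕ) : Prop :=
  ∃ A B : Finset V, A.card = q ∧ B.card = q ∧ Disjoint A B ∧
    ∀ a ∈ A, ∀ b ∈ B, ¬ G.Adj a b
open Finset

open scoped Classical in
/-- regularity in terms of filter cardinalities -/
def RegF {V : Type*} [Fintype V] (d : ℕ) (G : SimpleGraph V) : Prop :=
  ∀ v, (univ.filter fun w => G.Adj v w).card = d

open scoped Classical in
lemma regF_iff {n d : ℕ} (G : SimpleGraph (Fin n)) :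
    G.IsRegularOfDegree d ↔ RegF d G := by
  unfold SimpleGraph.IsRegularOfDegree RegF
  refine forall_congr' fun v => ?_
  rw [← SimpleGraph.card_neighborFinset_eq_degree, SimpleGraph.neighborFinset_eq_filter]

/-- switching -/
def sw {V : Type*} (G : SimpleGraph V) (a x b y : V) : SimpleGraph V :=
  SimpleGraph.fromEdgeSet ((G.edgeSet \ {s(a,x), s(b,y)}) ∪ {s(a,b), s(x,y)})

lemma sw_adj {V : Type*} (G : SimpleGraph V) (a x b y u v : V) :
    (sw G a x b y).Adj u v ↔ ((G.Adj u v ∧ ¬ (s(u,v) = s(a,x) ∨ s(u,v) = s(b,y))) ∨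
      (s(u,v) = s(a,b) ∨ s(u,v) = s(x,y))) ∧ u ≠ v := by
  unfold sw
  rw [SimpleGraph.fromEdgeSet_adj]
  simp only [Set.mem_union, Set.mem_sdiff, Set.mem_insert_iff, Set.mem_singleton_iff,
    SimpleGraph.mem_edgeSet]

lemma sw_sw {V : Type*} (G : SimpleGraph V) (a x b y : V) (hax : G.Adj a x) (hby : G.Adj b y)
    (hab : ¬ G.Adj a b) (hxy : ¬ G.Adj x y) (hne : a ≠ b) (h2 : x ≠ y) (h3 : x ≠ b) (h4 : y ≠ a) :
    sw (sw G a x b y) a b x y = G := by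
  have := hax.ne
  have := hby.ne
  have := hax.symm
  have := hby.symm
  have h5 : ¬ G.Adj b a := fun h => hab h.symm
  have h6 : ¬ G.Adj y x := fun h => hxy h.symm
  ext u v
  rw [sw_adj, sw_adj]
  constructor
  · rintro ⟨⟨⟨h | h, _⟩, h'⟩ | h, _⟩
    · exact h.1
    · exact absurd h h'
    · simp only [Sym2.eq_iff] at h
      rcases h with (⟨rfl, rfl⟩ | ⟨rfl, rfl⟩) | ⟨rfl, rfl⟩ | ⟨rfl, rfl⟩ <;> assumption
  · intro h
    have hn := h.ne
    refine ⟨?_, hn⟩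
    by_cases h7 : s(u,v) = s(a,x) ∨ s(u,v) = s(b,y)
    · exact Or.inr h7
    · left
      refine ⟨⟨Or.inl ⟨h, h7⟩, hn⟩, ?_⟩
      simp only [Sym2.eq_iff]
      rintro ((⟨rfl, rfl⟩ | ⟨rfl, rfl⟩) | ⟨rfl, rfl⟩ | ⟨rfl, rfl⟩) <;> contradiction

open scoped Classical in
lemma sw_reg {V : Type*} [Fintype V] {d : ℕ} (G : SimpleGraph V) (hG : RegF d G)
    (a x b y : V) (hax : G.Adj a x) (hby : G.Adj b y)
    (hab : ¬ G.Adj a b) (hxy : ¬ G.Adj x y) (hne : a ≠ b) (h2 : x ≠ y) (h3 : x ≠ b) (h4 : y ≠ a) :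
    RegF d (sw G a x b y) := by
  have n1 := hax.ne
  have n2 := hby.ne
  have h5 : ¬ G.Adj b a := fun h => hab h.symm
  have h6 : ¬ G.Adj y x := fun h => hxy h.symm
  have key : ∀ (S : Finset V) (p r : V), p ∈ S → r ∉ S → (insert r (S.erase p)).card = S.card := by
    intro S p r hp hr
    rw [card_insert_of_notMem (by simp [hr]), card_erase_add_one hp]
  intro v
  rw [← hG v]
  by_cases va : v = a
  · subst va
    rw [← key (univ.filter fun w => G.Adj v w) x b (by simpa) (by simpa)]
    congr 1
    ext w
    simp only [mem_filter, mem_univ, true_and, sw_adj, mem_insert, mem_erase, Sym2.eq_iff]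
    have := fun h : G.Adj v w => h.ne
    grind
  by_cases vx : v = x
  · subst vx
    rw [← key (univ.filter fun w => G.Adj v w) a y (by simpa using hax.symm) (by simpa)]
    congr 1
    ext w
    simp only [mem_filter, mem_univ, true_and, sw_adj, mem_insert, mem_erase, Sym2.eq_iff]
    have := fun h : G.Adj v w => h.ne
    grind
  by_cases vb : v = b
  · subst vb
    rw [← key (univ.filter fun w => G.Adj v w) y a (by simpa) (by simpa)]
    congr 1
    ext w
    simp only [mem_filter, mem_univ, true_and, sw_adj, mem_insert, mem_erase, Sym2.eq_iff]
    have := fun h : G.Adj v w => h.ne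
    grind
  by_cases vy : v = y
  · subst vy
    rw [← key (univ.filter fun w => G.Adj v w) b x (by simpa using hby.symm) (by simpa)]
    congr 1
    ext w
    simp only [mem_filter, mem_univ, true_and, sw_adj, mem_insert, mem_erase, Sym2.eq_iff]
    have := fun h : G.Adj v w => h.ne
    grind
  congr 1
  ext w
  simp only [mem_filter, mem_univ, true_and, sw_adj, Sym2.eq_iff]
  have := fun h : G.Adj v w => h.ne
  grind

open scoped Classical in
/-- edges between A and B -/
noncomputable def EAB {V : Type*} (A B : Finset V) (G : SimpleGraph V) : Finset (V × V) :=
  (A ×ˢ B).filter fun p => G.Adj p.1 p.2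

open scoped Classical in
lemma EAB_sw {V : Type*} (A B : Finset V) (hd : Disjoint A B) (G : SimpleGraph V) 
    (a x b y : V) (ha : a ∈ A) (hb : b ∈ B) (hx : x ∉ B) (hy : y ∉ A) (h2 : x ≠ y)  :
    EAB A B (sw G a x b y) = if x ∈ A ∧ y ∈ B then insert (x,y) (insert (a,b) (EAB A B G)) else
      insert (a,b) (EAB A B G) := by
  have hd' : ∀ v, v ∈ A → v ∉ B := fun v h1 h2 => (Finset.disjoint_left.mp hd) h1 h2
  have := hd' a ha
  have hbA : b ∉ A := fun h => hd' b h hb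
  split_ifs with h
  all_goals
    ext ⟨u, v⟩
    simp only [EAB, mem_filter, mem_product, sw_adj, mem_insert, Sym2.eq_iff, Prod.mk.injEq]
    have := fun h : G.Adj u v => h.ne
    have h1 := hd' u
    have h2 := hd' v
    constructor
    · rintro ⟨⟨hu, hv⟩, h, -⟩
      grind
    · grind

open scoped Classical in
/-- neighbours -/
noncomputable def nb {V : Type*} [Fintype V] (G : SimpleGraph V) (v : V) : Finset V :=
  univ.filter fun w => G.Adj v w

lemma mem_nb {V : Type*} [Fintype V] (G : SimpleGraph V) (v w : V) : w ∈ nb G v ↔ G.Adj v w := by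
  simp [nb]

open scoped Classical in
/-- regular graphs with exactly `k` edges between A and B -/
noncomputable def GK {V : Type*} [Fintype V] (d : ℕ) (A B : Finset V) (k : ℕ) :
    Finset (SimpleGraph V) :=
  univ.filter fun G => RegF d G ∧ (EAB A B G).card = k

open scoped Classical in
/-- half edges from A avoiding B -/
noncomputable def HE {V : Type*} [Fintype V] (A B : Finset V) (G : SimpleGraph V) :
    Finset (V × V) :=
  (A ×ˢ univ).filter fun p => G.Adj p.1 p.2 ∧ p.2 ∉ B

open scoped Classical in
/-- valid switching tuples -/
noncomputable def VT {V : Type*} [Fintype V] (A B : Finset V) (G : SimpleGraph V) :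
    Finset ((V × V) × (V × V)) :=
  (HE A B G ×ˢ HE B A G).filter fun p => p.1.2 ≠ p.2.2 ∧ ¬ G.Adj p.1.2 p.2.2 ∧ ¬ G.Adj p.1.1 p.2.1

open scoped Classical in
lemma card_arcs {V : Type*} [Fintype V] {d : ℕ} (A : Finset V) (G : SimpleGraph V)
    (hG : RegF d G) : ((A ×ˢ univ).filter fun p : V × V => G.Adj p.1 p.2).card = A.card * d := by
  rw [card_filter, sum_product]
  have : ∀ v ∈ A, (∑ w, if G.Adj v w then 1 else 0) = d := by
    intro v _
    rw [← card_filter]; exact hG v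
  rw [sum_congr rfl this]; simp

open scoped Classical in
lemma card_HE {V : Type*} [Fintype V] {d : ℕ} (A B : Finset V) (G : SimpleGraph V)
    (hG : RegF d G) : (HE A B G).card + (EAB A B G).card = A.card * d := by
  rw [← card_arcs A G hG, ← card_filter_add_card_filter_not
    (s := (A ×ˢ univ).filter fun p : V × V => G.Adj p.1 p.2) (fun p => p.2 ∉ B)]
  congr 2
  · ext p; simp [HE]; tauto
  · ext p; simp [EAB]; tauto

open scoped Classical in
lemma card_EAB_symm {V : Type*} (A B : Finset V) (G : SimpleGraph V) :
    (EAB B A G).card = (EAB A B G).card := by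
  apply card_bij (fun p _ => p.swap)
  · rintro ⟨u, v⟩; simp [EAB, G.adj_comm]; tauto
  · rintro ⟨u, v⟩ _ ⟨w, z⟩ _; simp; tauto
  · rintro ⟨u, v⟩ h; refine ⟨(v, u), ?_, rfl⟩
    revert h; simp [EAB, G.adj_comm]; tauto

open scoped Classical in
lemma card_VT {V : Type*} [Fintype V] {d q k : ℕ} (A B : Finset V) (G : SimpleGraph V)
    (hG : RegF d G) (hA : A.card = q) (hB : B.card = q) (hk : (EAB A B G).card = k) :
    (q * d - k) ^ 2 ≤ (VT A B G).card + 3 * d ^ 3 * q := by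
  have h1 := card_HE A B G hG
  have h2 := card_HE B A G hG
  rw [card_EAB_symm A B G, hk, hB] at h2
  rw [hk, hA] at h1
  have e1 : (HE A B G).card = q * d - k := by omega
  have e2 : (HE B A G).card = q * d - k := by omega
  have e3 : (HE A B G ×ˢ HE B A G).card = (q * d - k) ^ 2 := by
    rw [card_product, e1, e2, sq]
  rw [← e3, ← card_filter_add_card_filter_not (s := HE A B G ×ˢ HE B A G)
    (fun p => p.1.2 ≠ p.2.2 ∧ ¬ G.Adj p.1.2 p.2.2 ∧ ¬ G.Adj p.1.1 p.2.1)]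
  refine Nat.add_le_add_left ?_ _
  have nbc : ∀ v, (nb G v).card ≤ d := fun v => (hG v).le
  let S1 : Finset ((V × V) × (V × V)) := A.biUnion fun a => (nb G a).biUnion fun x =>
    (nb G x).image fun b => ((a, x), (b, x))
  let S2 : Finset ((V × V) × (V × V)) := A.biUnion fun a => (nb G a).biUnion fun x =>
    (nb G x).biUnion fun y => (nb G y).image fun b => ((a, x), (b, y))
  let S3 : Finset ((V × V) × (V × V)) := A.biUnion fun a => (nb G a).biUnion fun x =>
    (nb G a).biUnion fun b => (nb G b).image fun y => ((a, x), (b, y))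
  have c1 : S1.card ≤ q * (d * d) := by
    rw [← hA]
    refine card_biUnion_le_card_mul _ _ _ fun a _ => ?_
    refine (card_biUnion_le_card_mul _ _ d fun x _ => ?_).trans (Nat.mul_le_mul_right _ (nbc _))
    exact card_image_le.trans (nbc _)
  have c2 : S2.card ≤ q * (d * (d * d)) := by
    rw [← hA]
    refine card_biUnion_le_card_mul _ _ _ fun a _ => ?_
    refine (card_biUnion_le_card_mul _ _ (d * d) fun x _ => ?_).trans
      (Nat.mul_le_mul_right _ (nbc _))
    refine (card_biUnion_le_card_mul _ _ d fun x _ => ?_).trans (Nat.mul_le_mul_right _ (nbc _))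
    exact card_image_le.trans (nbc _)
  have c3 : S3.card ≤ q * (d * (d * d)) := by
    rw [← hA]
    refine card_biUnion_le_card_mul _ _ _ fun a _ => ?_
    refine (card_biUnion_le_card_mul _ _ (d * d) fun x _ => ?_).trans
      (Nat.mul_le_mul_right _ (nbc _))
    refine (card_biUnion_le_card_mul _ _ d fun x _ => ?_).trans (Nat.mul_le_mul_right _ (nbc _))
    exact card_image_le.trans (nbc _)
  have hsub : ((HE A B G ×ˢ HE B A G).filter
      (fun p => ¬ (p.1.2 ≠ p.2.2 ∧ ¬ G.Adj p.1.2 p.2.2 ∧ ¬ G.Adj p.1.1 p.2.1))) ⊆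
      S1 ∪ (S2 ∪ S3) := by
    rintro ⟨⟨a, x⟩, ⟨b, y⟩⟩ h
    simp only [HE, mem_filter, mem_product, mem_univ, and_true] at h
    obtain ⟨⟨⟨ha, hax, hx⟩, hb, hby, hy⟩, h⟩ := h
    simp only [mem_union]
    by_cases h1 : x = y
    · left
      simp only [S1, mem_biUnion, mem_image, mem_nb]
      exact ⟨a, ha, x, hax, b, h1 ▸ hby.symm, by rw [h1]⟩
    · right
      by_cases h2 : G.Adj x y
      · left
        simp only [S2, mem_biUnion, mem_image, mem_nb]
        exact ⟨a, ha, x, hax, y, h2, b, hby.symm, rfl⟩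
      · right
        have h3 : G.Adj a b := by tauto
        simp only [S3, mem_biUnion, mem_image, mem_nb]
        exact ⟨a, ha, x, hax, b, h3, y, hby, rfl⟩
  have := (card_le_card hsub).trans ((card_union_le _ _).trans
    (Nat.add_le_add_left (card_union_le _ _) _))
  have hd : d * d ≤ d ^ 3 := by
    rcases Nat.eq_zero_or_pos d with rfl | h
    · simp
    · calc d * d = d ^ 2 := by ring
        _ ≤ d ^ 3 := Nat.pow_le_pow_right h (by norm_num)
  have := Nat.mul_le_mul_left q hd
  have e : q * (d * (d * d)) = q * d ^ 3 := by ring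
  have e' : 3 * d ^ 3 * q = 3 * (q * d ^ 3) := by ring
  refine (this |> fun _ => ‹_ ≤ #S1 + (#S2 + #S3)›).trans ?_
  omega

open scoped Classical in
/-- the double counting recursion -/
lemma recursion {V : Type*} [Fintype V] {d q k : ℕ} (A B : Finset V) (hAB : Disjoint A B)
    (hA : A.card = q) (hB : B.card = q) :
    (GK d A B k).card * (q * d - k) ^ 2 ≤ (GK d A B k).card * (3 * d ^ 3 * q)
      + (GK d A B (k+1)).card * ((k+1) * (Fintype.card V * d))
      + (GK d A B (k+2)).card * ((k+2) * (k+1)) := by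
  let Om := (GK d A B k).sigma fun G => VT A B G
  have hOm : (GK d A B k).card * (q * d - k) ^ 2 ≤ (GK d A B k).card * (3 * d ^ 3 * q) + Om.card := by
    have e1 := sum_const (s := GK d A B k) ((q * d - k) ^ 2)
    have e2 := sum_const (s := GK d A B k) (3 * d ^ 3 * q)
    rw [smul_eq_mul] at e1 e2
    rw [card_sigma, ← e1, ← e2, ← sum_add_distrib]
    refine sum_le_sum fun G hG => ?_
    simp only [GK, mem_filter, mem_univ, true_and] at hG
    rw [add_comm]
    exact card_VT A B G hG.1 hA hB hG.2
  let T1 := (GK d A B (k+1)).sigma fun G => ((EAB A B G) ×ˢ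
    ((univ ×ˢ univ).filter fun p : V × V => G.Adj p.1 p.2))
  let T2 := (GK d A B (k+2)).sigma fun G => (EAB A B G).offDiag
  have c1 : T1.card = (GK d A B (k+1)).card * ((k+1) * (Fintype.card V * d)) := by
    rw [card_sigma, ← smul_eq_mul, ← sum_const]
    refine sum_congr rfl fun G hG => ?_
    simp only [GK, mem_filter, mem_univ, true_and] at hG
    rw [card_product, hG.2, card_arcs univ G hG.1, card_univ]
  have c2 : T2.card = (GK d A B (k+2)).card * ((k+2) * (k+1)) := by
    rw [card_sigma, ← smul_eq_mul, ← sum_const]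
    refine sum_congr rfl fun G hG => ?_
    simp only [GK, mem_filter, mem_univ, true_and] at hG
    rw [offDiag_card, hG.2]
    have : (k+2) * (k+2) = (k+2)*(k+1) + (k+2) := by ring
    omega
  have hle : Om.card ≤ (T1 ∪ T2).card := by
    apply card_le_card_of_injOn
      (fun z => (⟨sw z.1 z.2.1.1 z.2.1.2 z.2.2.1 z.2.2.2,
        ((z.2.1.1, z.2.2.1), (z.2.1.2, z.2.2.2))⟩ : (_ : SimpleGraph V) × (V × V) × (V × V)))
    · rintro ⟨G, ⟨a, x⟩, ⟨b, y⟩⟩ h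
      simp only [Om, mem_coe, mem_sigma, GK, VT, HE, mem_filter, mem_univ, true_and, mem_product,
        and_true] at h
      obtain ⟨⟨hr, hk⟩, ⟨⟨ha, hax, hx⟩, hb, hby, hy⟩, h2, hxy, hab⟩ := h
      have hne : a ≠ b := fun h => (Finset.disjoint_left.mp hAB) ha (h ▸ hb)
      have h3 : x ≠ b := fun h => hx (h ▸ hb)
      have h4 : y ≠ a := fun h => hy (h ▸ ha)
      have hr' := sw_reg G hr a x b y hax hby hab hxy hne h2 h3 h4
      have hE := EAB_sw A B hAB G a x b y ha hb hx hy h2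
      have n1 : (a, b) ∉ EAB A B G := by simp [EAB, hab]
      simp only [mem_coe, mem_union, T1, T2, mem_sigma, GK, mem_filter, mem_univ, true_and,
        mem_product, mem_offDiag]
      split_ifs at hE with hc
      · right
        have n2 : (x, y) ∉ insert (a, b) (EAB A B G) := by
          simp [EAB, hxy, hax.ne.symm]
        refine ⟨⟨hr', ?_⟩, ?_, ?_, ?_⟩
        · rw [hE, card_insert_of_notMem n2, card_insert_of_notMem n1, hk]
        · rw [hE]; simp
        · rw [hE]; simp
        · simp [hax.ne]
      · left
        refine ⟨⟨hr', ?_⟩, ?_, ?_⟩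
        · rw [hE, card_insert_of_notMem n1, hk]
        · rw [hE]; simp
        · rw [sw_adj]; exact ⟨Or.inr (Or.inr rfl), h2⟩
    · rintro ⟨G, ⟨a, x⟩, ⟨b, y⟩⟩ h ⟨G', ⟨a', x'⟩, ⟨b', y'⟩⟩ h' heq
      simp only [Om, mem_coe, mem_sigma, GK, VT, HE, mem_filter, mem_univ, true_and, mem_product,
        and_true] at h h'
      simp only [Sigma.mk.injEq, heq_eq_eq, Prod.mk.injEq] at heq
      obtain ⟨hs, ⟨rfl, rfl⟩, rfl, rfl⟩ := heq
      obtain ⟨⟨hr, hk⟩, ⟨⟨ha, hax, hx⟩, hb, hby, hy⟩, h2, hxy, hab⟩ := h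
      obtain ⟨⟨hr', hk'⟩, ⟨⟨ha', hax', hx'⟩, hb', hby', hy'⟩, h2', hxy', hab'⟩ := h'
      have hne : a ≠ b := fun h => (Finset.disjoint_left.mp hAB) ha (h ▸ hb)
      have h3 : x ≠ b := fun h => hx (h ▸ hb)
      have h4 : y ≠ a := fun h => hy (h ▸ ha)
      have e1 := sw_sw G a x b y hax hby hab hxy hne h2 h3 h4
      have e2 := sw_sw G' a x b y hax' hby' hab' hxy' hne h2 h3 h4
      rw [hs, e2] at e1
      rw [e1]
  have := hle.trans (card_union_le _ _)
  rw [c1, c2] at this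
  omega

lemma chain {V : Type*} [Fintype V] {d q K L : ℕ} (A B : Finset V) (hAB : Disjoint A B)
    (hA : A.card = q) (hB : B.card = q) (hKL : K + 1 ≤ L)
    (H : L * (Fintype.card V * d) + L ^ 2 + 3 * d ^ 3 * q ≤ (q * d - L) ^ 2) :
    ∀ k, k ≤ K → (L ^ k * (GK d A B 0).card ≤ (GK d A B k).card * k.factorial ∨
      L ^ (k+1) * (GK d A B 0).card ≤ (GK d A B (k+1)).card * (k+1).factorial) := by
  intro k
  induction k with
  | zero => intro _; left; simp
  | succ k ih =>
    intro hk
    rcases ih (by omega) with h | h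
    · by_contra! hcon
      obtain ⟨h1, h2⟩ := hcon
      have hrec := recursion (d := d) (k := k) A B hAB hA hB
      have hmono : (q * d - L) ^ 2 ≤ (q * d - k) ^ 2 := Nat.pow_le_pow_left (by omega) 2
      have hrec2 : (GK d A B k).card * (L * (Fintype.card V * d) + L ^ 2) ≤
          (GK d A B (k+1)).card * ((k+1) * (Fintype.card V * d))
          + (GK d A B (k+2)).card * ((k+2) * (k+1)) := by
        have := Nat.mul_le_mul_left (GK d A B k).card (H.trans hmono)
        nlinarith
      have hrec3 := Nat.mul_le_mul_left k.factorial hrec2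
      rw [Nat.factorial_succ] at h1
      rw [Nat.factorial_succ, Nat.factorial_succ] at h2
      set f := k.factorial
      set g0 := (GK d A B 0).card
      set gk := (GK d A B k).card
      set g1 := (GK d A B (k+1)).card
      set g2 := (GK d A B (k+1+1)).card
      set m := Fintype.card V * d
      have a1 := Nat.mul_le_mul_left (L * m + L ^ 2) h
      have a2 := Nat.mul_le_mul_left m h1.le
      have e1 : (L * m + L ^ 2) * (L ^ k * g0) = m * (L ^ (k+1) * g0) + L ^ (k+1+1) * g0 := by ring
      have e2 : (L * m + L ^ 2) * (gk * f) = f * (gk * (L * m + L ^ 2)) := by ring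
      have e3 : f * (g1 * ((k+1) * m) + g2 * ((k+2) * (k+1))) =
        m * (g1 * ((k + 1) * f)) + g2 * ((k+1+1) * ((k+1) * f)) := by ring
      have hrec4 : f * (gk * (L * m + L ^ 2)) ≤ f * (g1 * ((k+1) * m) + g2 * ((k+2) * (k+1))) := hrec3
      omega
    · exact Or.inl h

lemma fact_le (K : ℕ) : ((K+1).factorial : ℝ) ≤
    Real.exp 1 * (K+1 : ℕ) * ((K+1 : ℕ) : ℝ) ^ (K+1) * Real.exp (-((K+1 : ℕ) : ℝ)) := by
  induction K with
  | zero => simp [← Real.exp_add]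
  | succ K ih =>
    rw [Nat.factorial_succ]
    set m : ℕ := K + 1 with hm
    have hm0 : (0:ℝ) < m := by positivity
    have key : Real.exp 1 * (m : ℝ) ^ (m+1) ≤ ((m+1 : ℕ) : ℝ) ^ (m+1) := by
      have h := Real.one_sub_inv_le_log_of_pos (x := ((m:ℝ)+1)/m) (by positivity)
      have h1 : (1:ℝ) ≤ (m+1 : ℕ) * Real.log (((m:ℝ)+1)/m) := by
        have h2 : 1 - (((m:ℝ)+1)/m)⁻¹ = 1 / ((m:ℝ)+1) := by field_simp; ring
        rw [h2, div_le_iff₀ (by positivity)] at h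
        push_cast; linarith
      have h3 := Real.exp_le_exp.mpr h1
      rw [Real.exp_nat_mul, Real.exp_log (by positivity), div_pow, le_div_iff₀ (by positivity)] at h3
      exact_mod_cast h3
    calc (((m+1) * m.factorial : ℕ) : ℝ) = (m+1 : ℕ) * (m.factorial : ℝ) := by push_cast; ring
      _ ≤ (m+1 : ℕ) * (Real.exp 1 * m * (m:ℝ)^m * Real.exp (-(m:ℝ))) := by gcongr
      _ = (m+1 : ℕ) * (Real.exp 1 * (m:ℝ)^(m+1)) * Real.exp (-(m:ℝ)) := by ring
      _ ≤ (m+1 : ℕ) * (((m+1 : ℕ) : ℝ) ^ (m+1)) * Real.exp (-(m:ℝ)) := by gcongr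
      _ = _ := by
        have : Real.exp (-(m:ℝ)) = Real.exp 1 * Real.exp (-((m+1:ℕ):ℝ)) := by
          rw [← Real.exp_add]; push_cast; ring_nf
        rw [this]; ring

open scoped Classical in
/-- all regular graphs -/
noncomputable def RG (V : Type*) [Fintype V] (d : ℕ) : Finset (SimpleGraph V) :=
  univ.filter fun G => RegF d G

lemma one_pair {V : Type*} [Fintype V] {d q K L : ℕ} (A B : Finset V) (hAB : Disjoint A B)
    (hA : A.card = q) (hB : B.card = q) (hK : 1 ≤ K) (hKL : K + 1 ≤ L)
    (H : L * (Fintype.card V * d) + L ^ 2 + 3 * d ^ 3 * q ≤ (q * d - L) ^ 2) :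
    ((GK d A B 0).card : ℝ) ≤ Real.exp 1 * L * Real.exp (-(K : ℝ)) * (RG V d).card := by
  have key : ∀ k, K ≤ k → k ≤ L → L ^ k * (GK d A B 0).card ≤ (GK d A B k).card * k.factorial →
      ((GK d A B 0).card : ℝ) ≤ Real.exp 1 * L * Real.exp (-(K : ℝ)) * (RG V d).card := by
    intro k h1 h2 h
    have hle : (GK d A B k).card ≤ (RG V d).card := by
      classical
      apply card_le_card
      intro G
      simp only [GK, RG, mem_filter, mem_univ, true_and]
      exact fun h => h.1
    have hf : (k.factorial : ℝ) ≤ Real.exp 1 * k * (k : ℝ) ^ k * Real.exp (-(k : ℝ)) := by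
      obtain ⟨j, rfl⟩ : ∃ j, k = j + 1 := ⟨k - 1, by omega⟩
      exact fact_le j
    have hL : (0 : ℝ) < (L : ℝ) ^ k := by
      have : 0 < L := by omega
      positivity
    have h' : (L : ℝ) ^ k * (GK d A B 0).card ≤ (GK d A B k).card * k.factorial := by
      exact_mod_cast h
    have hkL : (k : ℝ) ≤ L := by exact_mod_cast h2
    have hKk : (K : ℝ) ≤ k := by exact_mod_cast h1
    refine le_of_mul_le_mul_left ?_ hL
    calc (L : ℝ) ^ k * (GK d A B 0).card ≤ (GK d A B k).card * k.factorial := h'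
      _ ≤ (RG V d).card * (Real.exp 1 * k * (k : ℝ) ^ k * Real.exp (-(k : ℝ))) := by
        gcongr
      _ ≤ (RG V d).card * (Real.exp 1 * L * (L : ℝ) ^ k * Real.exp (-(K : ℝ))) := by
        gcongr
      _ = _ := by ring
  rcases chain A B hAB hA hB hKL H K le_rfl with h | h
  · exact key K le_rfl (by omega) h
  · exact key (K+1) (by omega) hKL h

open scoped Classical in
lemma union_bound {n d q K L : ℕ} (hK : 1 ≤ K) (hKL : K + 1 ≤ L)
    (H : L * (n * d) + L ^ 2 + 3 * d ^ 3 * q ≤ (q * d - L) ^ 2) :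
    (((RG (Fin n) d).filter fun G => HasBipartiteHole G q).card : ℝ) ≤
      (n.choose q : ℝ) ^ 2 * (Real.exp 1 * L * Real.exp (-(K : ℝ)) * (RG (Fin n) d).card) := by
  let P := ((powersetCard q (univ : Finset (Fin n))) ×ˢ (powersetCard q (univ : Finset (Fin n)))).filter
    fun p => Disjoint p.1 p.2
  have hsub : ((RG (Fin n) d).filter fun G => HasBipartiteHole G q) ⊆
      P.biUnion fun p => GK d p.1 p.2 0 := by
    intro G hG
    simp only [RG, mem_filter, mem_univ, true_and] at hG
    obtain ⟨hr, A, B, hA, hB, hAB, hno⟩ := hG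
    simp only [mem_biUnion]
    refine ⟨(A, B), by simp [P, mem_powersetCard, hA, hB, hAB], ?_⟩
    simp only [GK, mem_filter, mem_univ, true_and, card_eq_zero]
    refine ⟨hr, ?_⟩
    ext ⟨u, v⟩
    simp only [EAB, mem_filter, mem_product, notMem_empty, iff_false]
    rintro ⟨⟨h1, h2⟩, h3⟩
    exact hno u h1 v h2 h3
  have hP : (P.card : ℝ) ≤ (n.choose q : ℝ) ^ 2 := by
    have : P.card ≤ (n.choose q) ^ 2 := by
      refine (card_filter_le _ _).trans ?_
      rw [card_product, card_powersetCard, card_univ, Fintype.card_fin, sq]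
    exact_mod_cast this
  have h1 : (((RG (Fin n) d).filter fun G => HasBipartiteHole G q).card : ℝ) ≤
      ∑ p ∈ P, ((GK d p.1 p.2 0).card : ℝ) := by
    exact_mod_cast (card_le_card hsub).trans card_biUnion_le
  refine h1.trans ?_
  calc ∑ p ∈ P, ((GK d p.1 p.2 0).card : ℝ) ≤
      ∑ p ∈ P, (Real.exp 1 * L * Real.exp (-(K : ℝ)) * (RG (Fin n) d).card) := by
        refine sum_le_sum fun p hp => ?_
        simp only [P, mem_filter, mem_product, mem_powersetCard] at hp
        exact one_pair p.1 p.2 hp.2 hp.1.1.2 hp.1.2.2 hK hKL (by simpa using H)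
    _ = P.card * (Real.exp 1 * L * Real.exp (-(K : ℝ)) * (RG (Fin n) d).card) := by
        rw [sum_const, nsmul_eq_mul]
    _ ≤ _ := by gcongr

lemma choose_bound {n d q : ℕ} (hq : 0 < q) (h : Real.exp 1 * n ≤ d * q) :
    (n.choose q : ℝ) ≤ (d : ℝ) ^ q := by
  have h1 : (n.choose q : ℝ) ≤ (n : ℝ) ^ q / q.factorial := Nat.choose_le_pow_div q n
  have h2 := Real.pow_div_factorial_le_exp (x := (q : ℝ)) (by positivity) q
  have hq' : (0 : ℝ) < (q : ℝ) ^ q := by positivity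
  refine h1.trans ?_
  rw [div_le_iff₀ (by positivity)] at h2 ⊢
  refine le_of_mul_le_mul_right ?_ hq'
  calc (n : ℝ) ^ q * (q : ℝ) ^ q ≤ (n : ℝ) ^ q * (Real.exp q * q.factorial) := by gcongr
    _ = (Real.exp 1 * n) ^ q * q.factorial := by
      rw [mul_pow, ← Real.exp_nat_mul, mul_one]; ring
    _ ≤ (d * q) ^ q * q.factorial := by gcongr
    _ = _ := by rw [mul_pow]; ring

open scoped Classical in
lemma circ_exists {m d : ℕ} (S : Finset (Fin (m+1))) (h0 : (0 : Fin (m+1)) ∉ S)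
    (hneg : ∀ s ∈ S, -s ∈ S) (hc : S.card = d) : (RG (Fin (m+1)) d).Nonempty := by
  let G : SimpleGraph (Fin (m+1)) :=
    { Adj := fun u v => v - u ∈ S
      symm := ⟨by
        intro u v h
        have := hneg _ h
        rwa [neg_sub] at this⟩
      loopless := ⟨by intro u h; simp only [sub_self] at h; exact h0 h⟩ }
  refine ⟨G, ?_⟩
  simp only [RG, mem_filter, mem_univ, true_and]
  intro v
  rw [← hc]
  apply card_bij (fun w _ => w - v)
  · intro w hw
    simpa [G] using hw
  · intro w _ w' _ h
    simpa using h
  · intro s hs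
    exact ⟨s + v, by simpa [G] using hs, by simp⟩

lemma reg_exists {n d : ℕ} (hn : 2 * d + 2 < n) (he : Even (d * n)) : (RG (Fin n) d).Nonempty := by
  obtain ⟨m, rfl⟩ : ∃ m, n = m + 1 := ⟨n - 1, by omega⟩
  have hv : ∀ s : Fin (m+1), s.val ≠ 0 → (-s).val = m + 1 - s.val := by
    intro s hs
    rw [Fin.val_neg']
    exact Nat.mod_eq_of_lt (by omega)
  have hmk : ∀ T : Finset ℕ, (∀ t ∈ T, 0 < t ∧ t < m + 1 ∧ m + 1 - t ∈ T) → T.card = d →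
      (RG (Fin (m+1)) d).Nonempty := by
    intro T hT hc
    refine circ_exists (univ.filter fun s : Fin (m+1) => s.val ∈ T) ?_ ?_ ?_
    · intro h
      simp only [mem_filter, mem_univ, true_and] at h
      have := (hT _ h).1
      simp at this
    · intro s hs
      simp only [mem_filter, mem_univ, true_and] at hs ⊢
      have := hT _ hs
      rw [hv s (by omega)]
      exact this.2.2
    · rw [← hc]
      apply card_bij (fun s _ => s.val)
      · intro s hs
        simpa using hs
      · intro s _ s' _ h
        exact Fin.ext h
      · intro t ht
        exact ⟨⟨t, (hT t ht).2.1⟩, by simpa using ht, rfl⟩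
  obtain ⟨e, rfl | rfl⟩ := Nat.even_or_odd' d
  · apply hmk (Icc 1 e ∪ Ico (m + 1 - e) (m + 1))
    · intro t ht
      simp only [mem_union, mem_Icc, mem_Ico] at ht ⊢
      omega
    · rw [card_union_of_disjoint]
      · simp only [Nat.card_Icc, Nat.card_Ico]; omega
      · rw [Finset.disjoint_left]
        intro t
        simp only [mem_Icc, mem_Ico]
        omega
  · have hev : Even (m + 1) := by
      rcases Nat.even_mul.mp he with h | h
      · exact absurd h (by simp)
      · exact h
    obtain ⟨p, hp⟩ := hev
    apply hmk (insert p (Icc 1 e ∪ Ico (m + 1 - e) (m + 1)))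
    · intro t ht
      simp only [mem_insert, mem_union, mem_Icc, mem_Ico] at ht ⊢
      omega
    · rw [card_insert_of_notMem, card_union_of_disjoint]
      · simp only [Nat.card_Icc, Nat.card_Ico]; omega
      · rw [Finset.disjoint_left]
        intro t
        simp only [mem_Icc, mem_Ico]
        omega
      · simp only [mem_union, mem_Icc, mem_Ico]
        omega

open scoped Classical in
lemma bad_bound {ε : ℝ} (hε : 0 < ε) {n d q : ℕ} (hd : 0 < d) (hq : 0 < q)
    (hl : 2 ≤ Real.log d)
    (hlo : 2 * (1 + ε) * Real.log d * n ≤ d * q)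
    (hhi : 2 * (2 + ε) * Real.log d * q + (2 * d + 4 + 3 * d ^ 2) ≤ ε * Real.log d * n) :
    (((RG (Fin n) d).filter fun G => HasBipartiteHole G q).card : ℝ) ≤
      (Real.exp 1 * d * (q * Real.exp (-(ε * q)))) * (RG (Fin n) d).card := by
  set l := Real.log d with hldef
  have hq' : (1 : ℝ) ≤ q := by exact_mod_cast hq
  have hd' : (1 : ℝ) ≤ d := by exact_mod_cast hd
  have hn0 : (0 : ℝ) ≤ n := by positivity
  set K := ⌈(2 + ε) * q * l⌉₊ with hKdef
  have hxpos : 0 < (2 + ε) * q * l := by positivity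
  have hK1 : 1 ≤ K := Nat.one_le_iff_ne_zero.mpr (Nat.ceil_pos.mpr hxpos).ne'
  have hKlo : (2 + ε) * q * l ≤ K := Nat.le_ceil _
  have hKhi : (K : ℝ) < (2 + ε) * q * l + 1 := Nat.ceil_lt_add_one hxpos.le
  set L := K + 1 with hL
  have hLr : (L : ℝ) ≤ (2 + ε) * q * l + 2 := by rw [hL]; push_cast; linarith
  have hL0 : (0 : ℝ) ≤ L := by positivity
  have hnq : (n : ℝ) ≤ d * q := by
    have : 1 * (n : ℝ) ≤ 2 * (1 + ε) * l * n := by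
      gcongr
      nlinarith
    linarith
  have main : (L : ℝ) * (n + 2 * q) + 3 * d ^ 2 * q ≤ q ^ 2 * d := by
    calc (L : ℝ) * (n + 2 * q) + 3 * d ^ 2 * q
        ≤ ((2 + ε) * q * l + 2) * (n + 2 * q) + 3 * d ^ 2 * q := by gcongr
      _ = (2 + ε) * q * l * (n + 2 * q) + 2 * n + 4 * q + 3 * d ^ 2 * q := by ring
      _ ≤ (2 + ε) * q * l * (n + 2 * q) + 2 * (d * q) + 4 * q + 3 * d ^ 2 * q := by gcongr
      _ = q * ((2 + ε) * l * n + (2 * (2 + ε) * l * q + (2 * d + 4 + 3 * d ^ 2))) := by ring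
      _ ≤ q * ((2 + ε) * l * n + ε * l * n) := by gcongr
      _ = q * (2 * (1 + ε) * l * n) := by ring
      _ ≤ q * (d * q) := by gcongr
      _ = q ^ 2 * d := by ring
  have hLq : (L : ℝ) ≤ q * d := by
    have : (L : ℝ) * q ≤ (q * d) * q := by
      have h1 : (0:ℝ) ≤ L * n := by positivity
      have h2 : (0:ℝ) ≤ L * q := by positivity
      have h3 : (0:ℝ) ≤ 3 * d ^ 2 * q := by positivity
      nlinarith
    exact le_of_mul_le_mul_right this (by linarith)
  have hLqN : L ≤ q * d := by exact_mod_cast hLq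
  have H : L * (n * d) + L ^ 2 + 3 * d ^ 3 * q ≤ (q * d - L) ^ 2 := by
    have : (L : ℝ) * (n * d) + L ^ 2 + 3 * d ^ 3 * q ≤ (q * d - L) ^ 2 := by
      have := mul_le_mul_of_nonneg_left main (by linarith : (0:ℝ) ≤ d)
      nlinarith
    have h2 : ((L * (n * d) + L ^ 2 + 3 * d ^ 3 * q : ℕ) : ℝ) ≤ (((q * d - L) ^ 2 : ℕ) : ℝ) := by
      push_cast [Nat.cast_sub hLqN]
      exact this
    exact_mod_cast h2
  have hu := union_bound (n := n) (d := d) (q := q) hK1 le_rfl H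
  refine hu.trans ?_
  have hch := choose_bound (n := n) (d := d) hq (by
    have he : Real.exp 1 ≤ 2 * (1 + ε) * l := by
      have := Real.exp_one_lt_d9
      nlinarith
    calc Real.exp 1 * n ≤ 2 * (1 + ε) * l * n := by gcongr
      _ ≤ _ := hlo)
  have hdq : (d : ℝ) ^ q = Real.exp (q * l) := by
    rw [Real.exp_nat_mul, hldef, Real.exp_log (by linarith)]
  calc (n.choose q : ℝ) ^ 2 * (Real.exp 1 * L * Real.exp (-(K : ℝ)) * (RG (Fin n) d).card)
      ≤ ((d : ℝ) ^ q) ^ 2 * (Real.exp 1 * (q * d) * Real.exp (-((2 + ε) * q * l)) *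
        (RG (Fin n) d).card) := by gcongr
    _ = Real.exp 1 * d * (q * (Real.exp (q * l) ^ 2 * Real.exp (-((2 + ε) * q * l)))) *
        (RG (Fin n) d).card := by rw [hdq]; ring
    _ = Real.exp 1 * d * (q * Real.exp (-(ε * q * l))) * (RG (Fin n) d).card := by
        rw [← Real.exp_nat_mul, ← Real.exp_add]
        congr 4
        push_cast; ring
    _ ≤ _ := by
        have h1 : 0 < ε * q := by positivity
        have h2 : Real.exp (-(ε * q * l)) ≤ Real.exp (-(ε * q)) :=
          Real.exp_le_exp.mpr (by nlinarith)
        gcongr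

open scoped Classical in
lemma prop_eq {n d q : ℕ} (hne : (RG (Fin n) d).Nonempty) :
    regularProportion d n (fun G => ¬ HasBipartiteHole G q) =
      1 - (((RG (Fin n) d).filter fun G => HasBipartiteHole G q).card : ℝ) /
        (RG (Fin n) d).card := by
  have h0 : ((RG (Fin n) d).card : ℝ) ≠ 0 := by
    exact_mod_cast (card_pos.mpr hne).ne'
  have e1 : Nat.card {G : SimpleGraph (Fin n) // G.IsRegularOfDegree d} = (RG (Fin n) d).card := by
    rw [Nat.card_eq_fintype_card, Fintype.card_subtype]
    congr 1
    ext G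
    simp only [RG, mem_filter, mem_univ, true_and]
    exact regF_iff G
  have e2 : Nat.card {G : SimpleGraph (Fin n) // G.IsRegularOfDegree d ∧ ¬ HasBipartiteHole G q} =
      ((RG (Fin n) d).filter fun G => ¬ HasBipartiteHole G q).card := by
    rw [Nat.card_eq_fintype_card, Fintype.card_subtype]
    congr 1
    ext G
    simp only [RG, mem_filter, mem_univ, true_and]
    exact and_congr (regF_iff G) Iff.rfl
  have e3 := card_filter_add_card_filter_not (s := RG (Fin n) d) (fun G => HasBipartiteHole G q)
  have e4 : (((RG (Fin n) d).filter fun G => HasBipartiteHole G q).card : ℝ) +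
    ((RG (Fin n) d).filter fun G => ¬ HasBipartiteHole G q).card = (RG (Fin n) d).card := by
    exact_mod_cast e3
  have e5 : regularProportion d n (fun G => ¬ HasBipartiteHole G q) =
      (((RG (Fin n) d).filter fun G => ¬ HasBipartiteHole G q).card : ℝ) /
        (RG (Fin n) d).card := by
    rw [← e1, ← e2]
    rfl
  rw [e5]
  field_simp
  linarith

/-- For every `ε > 0` there is `d₀` such that for every fixed `d ≥ d₀`, a.a.s. (as
`n → ∞` along `n` with `dn` even) a uniformly random simple `d`-regular graph on `n`
labelled vertices has no `q`-bipartite hole with `q = ⌈(1+ε) · 2 n log d / d⌉`. -/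
theorem aas_no_bipartite_hole (ε : ℝ) (hε : 0 < ε) :
    ∃ d₀ : ℕ, ∀ d : ℕ, d₀ ≤ d →
      Filter.Tendsto
        (fun n : ℕ => regularProportion d n fun G =>
          ¬ HasBipartiteHole G ⌈(1 + ε) * (2 * n * Real.log d) / d⌉₊)
        (Filter.atTop ⊓ Filter.principal {n : ℕ | Even (d * n)}) (nhds 1) := by
  
  classical
  have hlim : Filter.Tendsto (fun d : ℕ => Real.log d / d) Filter.atTop (nhds 0) := by
    have h := Real.isLittleO_log_id_atTop.tendsto_div_nhds_zero
    exact h.comp tendsto_natCast_atTop_atTop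
  set η : ℝ := ε / (8 * (1 + ε) * (2 + ε)) with hη
  have hηpos : 0 < η := by positivity
  have hev : ∀ᶠ d : ℕ in Filter.atTop, 0 < d ∧ 2 ≤ Real.log d ∧ Real.log d / d ≤ η := by
    have hlog : Filter.Tendsto (fun d : ℕ => Real.log d) Filter.atTop Filter.atTop :=
      Real.tendsto_log_atTop.comp tendsto_natCast_atTop_atTop
    filter_upwards [Filter.eventually_gt_atTop 0, hlog.eventually_ge_atTop 2,
      hlim.eventually_le_const hηpos] with d h1 h2 h3 using ⟨h1, h2, h3⟩
  obtain ⟨d₀, hd₀⟩ := Filter.eventually_atTop.mp hev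
  refine ⟨d₀, fun d hdd => ?_⟩
  obtain ⟨hd, hl, hs⟩ := hd₀ d hdd
  have hd' : (1 : ℝ) ≤ d := by exact_mod_cast hd
  set l := Real.log d with hldef
  set α : ℝ := 2 * (1 + ε) * l / d with hα
  have hαpos : 0 < α := by positivity
  have hq : ∀ n : ℕ, (1 + ε) * (2 * n * l) / d = α * n := by
    intro n; rw [hα]; ring
  simp only [hq]
  have hαs : 2 * (2 + ε) * α ≤ ε / 2 := by
    have : 2 * (2 + ε) * α = 4 * (2 + ε) * (1 + ε) * (l / d) := by rw [hα]; ring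
    rw [this]
    calc 4 * (2 + ε) * (1 + ε) * (l / d) ≤ 4 * (2 + ε) * (1 + ε) * η := by gcongr
      _ = ε / 2 := by rw [hη]; field_simp; ring
  -- q tends to infinity
  have hαn : Filter.Tendsto (fun n : ℕ => α * (n : ℝ)) Filter.atTop Filter.atTop :=
    Filter.Tendsto.const_mul_atTop hαpos tendsto_natCast_atTop_atTop
  have hqt : Filter.Tendsto (fun n : ℕ => ((⌈α * (n : ℝ)⌉₊ : ℕ) : ℝ)) Filter.atTop Filter.atTop :=
    Filter.tendsto_atTop_mono (fun n => Nat.le_ceil _) hαn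
  have hexp : Filter.Tendsto (fun x : ℝ => x * Real.exp (-(ε * x))) Filter.atTop (nhds 0) := by
    have h := (Real.tendsto_pow_mul_exp_neg_atTop_nhds_zero 1).comp
      (Filter.Tendsto.const_mul_atTop hε Filter.tendsto_id)
    have h' := h.const_mul ε⁻¹
    rw [mul_zero] at h'
    refine h'.congr fun x => ?_
    simp only [Function.comp, id, pow_one]
    field_simp
  have hbd : Filter.Tendsto (fun n : ℕ => 1 - Real.exp 1 * d *
      ((⌈α * (n : ℝ)⌉₊ : ℝ) * Real.exp (-(ε * (⌈α * (n : ℝ)⌉₊ : ℝ))))) Filter.atTop (nhds 1) := by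
    have h := ((hexp.comp hqt).const_mul (Real.exp 1 * d)).const_sub 1
    rw [mul_zero, sub_zero] at h
    exact h
  have hlarge : ∀ᶠ n : ℕ in Filter.atTop,
      2 * (2 + ε) * l + (2 * d + 4 + 3 * (d : ℝ) ^ 2) ≤ ε * l / 2 * n := by
    have h : Filter.Tendsto (fun n : ℕ => ε * l / 2 * (n : ℝ)) Filter.atTop Filter.atTop :=
      Filter.Tendsto.const_mul_atTop (by positivity) tendsto_natCast_atTop_atTop
    exact h.eventually_ge_atTop _
  have hall : ∀ᶠ n : ℕ in Filter.atTop ⊓ Filter.principal {n : ℕ | Even (d * n)},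
      (RG (Fin n) d).Nonempty ∧
      ((((RG (Fin n) d).filter fun G => HasBipartiteHole G ⌈α * (n : ℝ)⌉₊).card : ℝ) ≤
      (Real.exp 1 * d * ((⌈α * (n : ℝ)⌉₊ : ℝ) * Real.exp (-(ε * (⌈α * (n : ℝ)⌉₊ : ℝ))))) *
        (RG (Fin n) d).card) := by
    rw [Filter.eventually_inf_principal]
    filter_upwards [hlarge, Filter.eventually_gt_atTop (2 * d + 2)] with n h1 h2 he
    refine ⟨reg_exists h2 he, ?_⟩
    have hn : (0 : ℝ) < n := by
      have : 0 < n := by omega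
      exact_mod_cast this
    have hpos : 0 < α * n := by positivity
    have hlo := Nat.le_ceil (α * (n : ℝ))
    have hhi := Nat.ceil_lt_add_one hpos.le
    apply bad_bound hε hd (Nat.ceil_pos.mpr hpos) hl
    · calc 2 * (1 + ε) * l * n = d * (α * n) := by rw [hα]; field_simp
        _ ≤ _ := by gcongr
    · calc 2 * (2 + ε) * l * (⌈α * (n : ℝ)⌉₊ : ℝ) + (2 * d + 4 + 3 * (d : ℝ) ^ 2)
          ≤ 2 * (2 + ε) * l * (α * n + 1) + (2 * d + 4 + 3 * (d : ℝ) ^ 2) := by gcongr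
        _ = (2 * (2 + ε) * α) * (l * n) + (2 * (2 + ε) * l + (2 * d + 4 + 3 * (d : ℝ) ^ 2)) := by
          ring
        _ ≤ ε / 2 * (l * n) + ε * l / 2 * n := by gcongr
        _ = _ := by ring
  refine tendsto_of_tendsto_of_tendsto_of_le_of_le' (hbd.mono_left inf_le_left)
    tendsto_const_nhds ?_ ?_
  · filter_upwards [hall] with n hn
    rw [prop_eq hn.1]
    have hp : (0 : ℝ) < (RG (Fin n) d).card := by exact_mod_cast card_pos.mpr hn.1
    have := (div_le_iff₀ hp).mpr hn.2
    linarith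
  · filter_upwards [hall] with n hn
    rw [prop_eq hn.1]
    have : (0 : ℝ) ≤ (((RG (Fin n) d).filter fun G =>
      HasBipartiteHole G ⌈α * (n : ℝ)⌉₊).card : ℝ) / (RG (Fin n) d).card := by positivity
    linarith
end
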